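/- Let 1 < p < ∞ and let Ω ⊆ ℝ² be a nonempty open connected set. Let F_n : Ω → ℝ² (n = 1, 2, ...) be maps whose coordinate functions are p-harmonic on Ω, each F_n injective on Ω with Jacobian determinant det DF_n(x) > 0 at every x ∈ Ω, and suppose F_n converges uniformly on Ω to a map F : Ω → ℝ² whose coordinate functions are p-harmonic on Ω. Then either det DF(x) > 0 for every x ∈ Ω, or det DF(x) = 0 for every x ∈ Ω. -/

import Mathlib

open MeasureTheory Set Filter
open scoped RealInnerProductSpace

/-- `φ` is `p`-harmonic on the open set `Ω ⊆ ℝ²`: it is `C¹` on `Ω` and satisfies the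
weak form of `div(‖∇φ‖^{p-2} ∇φ) = 0` against all compactly supported `C¹` test
functions supported in `Ω`. -/
def PHarmonicOn (p : ℝ) (Ω : Set (EuclideanSpace ℝ (Fin 2)))
    (φ : EuclideanSpace ℝ (Fin 2) → ℝ) : Prop :=
  ContDiffOn ℝ 1 φ Ω ∧
  ∀ η : EuclideanSpace ℝ (Fin 2) → ℝ, ContDiff ℝ 1 η → HasCompactSupport η →
    tsupport η ⊆ Ω →
    ∫ x in Ω, ‖gradient φ x‖ ^ (p - 2) * ⟪gradient φ x, gradient η x⟫ = 0

namespace PHarmonic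

open scoped Topology ContDiff ComplexConjugate

/-! ### Test functions and integration by parts in the plane -/

theorem contDiff_mul_of_tsupport_subset {n : ℕ∞} {U : Set ℂ} (hU : IsOpen U) {η w : ℂ → ℝ}
    (hη : ContDiff ℝ n η) (hs : tsupport η ⊆ U) (hw : ContDiffOn ℝ n w U) :
    ContDiff ℝ n (fun z => η z * w z) := by
  rw [contDiff_iff_contDiffAt]
  intro z
  by_cases hz : z ∈ tsupport η
  · exact hη.contDiffAt.mul (hw.contDiffAt (hU.mem_nhds (hs hz)))
  · have : (fun z => η z * w z) =ᶠ[𝓝 z] fun _ => 0 := by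
      filter_upwards [notMem_tsupport_iff_eventuallyEq.1 hz] with y hy
      simp [hy]
    exact contDiffAt_const.congr_of_eventuallyEq this

theorem tsupport_mul_subset_of_left {η w : ℂ → ℝ} :
    tsupport (fun z => η z * w z) ⊆ tsupport η :=
  tsupport_mul_subset_left

theorem exists_bump {K O : Set ℂ} (hK : IsCompact K) (hO : IsOpen O) (hKO : K ⊆ O) :
    ∃ η : ℂ → ℝ, ContDiff ℝ ∞ η ∧ HasCompactSupport η ∧ tsupport η ⊆ O ∧
      (∀ z, 0 ≤ η z ∧ η z ≤ 1) ∧ ∃ O' : Set ℂ, IsOpen O' ∧ K ⊆ O' ∧ ∀ z ∈ O', η z = 1 := by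
  obtain ⟨L, hL, hKL, hLO⟩ := exists_compact_between hK hO hKO
  obtain ⟨f, h1, h0, hf⟩ := exists_contMDiffMap_one_nhds_of_subset_interior (n := ⊤)
    (modelWithCornersSelf ℝ ℂ) hK.isClosed hKL
  have hsupp : tsupport f ⊆ L := closure_minimal
    (fun z hz => by by_contra h; exact hz (h0 z h)) hL.isClosed
  refine ⟨f, f.contMDiff.contDiff, HasCompactSupport.of_support_subset_isCompact hL
    ((subset_tsupport _).trans hsupp), hsupp.trans hLO, fun z => hf z, ?_⟩
  obtain ⟨O', hO', hKO', h⟩ := eventually_nhdsSet_iff_exists.1 h1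
  exact ⟨O', hO', hKO', h⟩

theorem continuous_fderiv_apply_of_contDiff {w : ℂ → ℝ} (hw : ContDiff ℝ 1 w) (v : ℂ) :
    Continuous fun z => fderiv ℝ w z v :=
  (hw.continuous_fderiv (by norm_num)).clm_apply continuous_const

theorem hasCompactSupport_fderiv_apply {w : ℂ → ℝ} (hc : HasCompactSupport w) (v : ℂ) :
    HasCompactSupport fun z => fderiv ℝ w z v :=
  hc.fderiv_apply ℝ v

theorem integral_fderiv_eq_zero {w : ℂ → ℝ} (hw : ContDiff ℝ 1 w) (hc : HasCompactSupport w)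
    (v : ℂ) : ∫ z, fderiv ℝ w z v = 0 := by
  have hi : Integrable (fun z => fderiv ℝ w z v) :=
    (continuous_fderiv_apply_of_contDiff hw v).integrable_of_hasCompactSupport
      (hasCompactSupport_fderiv_apply hc v)
  have := integral_mul_fderiv_eq_neg_fderiv_mul_of_integrable (μ := volume) (𝕜 := ℝ)
    (f := fun _ : ℂ => (1 : ℝ)) (g := w) (v := v) (by simp) (by simpa using hi)
    (by simpa using hw.continuous.integrable_of_hasCompactSupport hc)
    (fun x _ => by fun_prop) (fun x _ => hw.differentiable (by norm_num) x)
  simpa using this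

/-- Friedrichs' inequality for functions supported in a strip. -/
theorem integral_sq_le_of_hasCompactSupport {w : ℂ → ℝ} (hw : ContDiff ℝ 1 w)
    (hc : HasCompactSupport w) {r : ℝ} (hr : ∀ z ∈ tsupport w, |z.re| ≤ r) :
    ∫ z, w z ^ 2 ≤ 4 * r ^ 2 * ∫ z, (fderiv ℝ w z 1) ^ 2 := by
  have hd := continuous_fderiv_apply_of_contDiff hw 1
  have hdc := hasCompactSupport_fderiv_apply hc 1
  have hi1 : Integrable (fun z => w z ^ 2) :=
    (hw.continuous.pow 2).integrable_of_hasCompactSupport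
      (by simpa [pow_two] using hc.mul_right (f' := w))
  have hi2 : Integrable (fun z => (fderiv ℝ w z 1) ^ 2) :=
    (hd.pow 2).integrable_of_hasCompactSupport
      (by simpa [pow_two] using hdc.mul_right (f' := fun z => fderiv ℝ w z 1))
  have hre : ContDiff ℝ 1 (fun z : ℂ => z.re) := Complex.reCLM.contDiff
  have hW : ContDiff ℝ 1 (fun z : ℂ => w z * (w z * z.re)) := hw.mul (hw.mul hre)
  have hWc : HasCompactSupport (fun z : ℂ => w z * (w z * z.re)) := hc.mul_right
  have h0 := integral_fderiv_eq_zero hW hWc 1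
  have hder : ∀ z, fderiv ℝ (fun z : ℂ => w z * (w z * z.re)) z 1
      = w z ^ 2 + 2 * z.re * (w z * fderiv ℝ w z 1) := by
    intro z
    have hwz : HasFDerivAt w (fderiv ℝ w z) z :=
      (hw.differentiable (by norm_num) z).hasFDerivAt
    have : HasFDerivAt (fun z : ℂ => w z * (w z * z.re))
        (w z • (w z • Complex.reCLM + z.re • fderiv ℝ w z) + (w z * z.re) • fderiv ℝ w z) z :=
      hwz.mul (hwz.mul Complex.reCLM.hasFDerivAt)
    rw [this.fderiv]
    simp
    ring
  have hi3 : Integrable (fun z : ℂ => 2 * z.re * (w z * fderiv ℝ w z 1)) := by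
    refine Continuous.integrable_of_hasCompactSupport ?_ ?_
    · have := hw.continuous
      fun_prop
    · exact (hc.mul_right (f' := fun z => fderiv ℝ w z 1)).mul_left
  simp_rw [hder] at h0
  rw [integral_add hi1 hi3] at h0
  have hmono : ∫ z, -(2 * z.re * (w z * fderiv ℝ w z 1)) ≤
      ∫ z, ((1 / 2) * w z ^ 2 + (2 * r ^ 2) * (fderiv ℝ w z 1) ^ 2) := by
    refine integral_mono hi3.neg ((hi1.const_mul _).add (hi2.const_mul _)) ?_
    intro z
    by_cases hz : z ∈ tsupport w
    · have h1 := hr z hz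
      have h2 : z.re ^ 2 ≤ r ^ 2 := sq_le_sq' (by linarith [abs_le.1 h1]) (abs_le.1 h1).2
      have h3 := mul_le_mul_of_nonneg_right h2 (sq_nonneg (fderiv ℝ w z 1))
      simp only
      nlinarith [sq_nonneg (w z + 2 * z.re * fderiv ℝ w z 1)]
    · have : w z = 0 := image_eq_zero_of_notMem_tsupport hz
      simp only [this]
      simp
      positivity
  rw [integral_neg, integral_add (hi1.const_mul _) (hi2.const_mul _), integral_const_mul,
    integral_const_mul] at hmono
  linarith

/-- A compactly supported exact form is orthogonal to closed forms. -/
theorem integral_wedge_eq_zero {U : Set ℂ} (hU : IsOpen U) {a₁ a₂ ψ : ℂ → ℝ}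
    (h₁ : ContDiffOn ℝ 1 a₁ U) (h₂ : ContDiffOn ℝ 1 a₂ U)
    (hcl : ∀ z ∈ U, fderiv ℝ a₂ z 1 = fderiv ℝ a₁ z Complex.I)
    (hψ : ContDiff ℝ 1 ψ) (hc : HasCompactSupport ψ) (hs : tsupport ψ ⊆ U) :
    ∫ z, (fderiv ℝ ψ z 1 * a₂ z - fderiv ℝ ψ z Complex.I * a₁ z) = 0 := by
  have e₁ := contDiff_mul_of_tsupport_subset (n := 1) hU hψ hs h₁
  have e₂ := contDiff_mul_of_tsupport_subset (n := 1) hU hψ hs h₂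
  have c₁ : HasCompactSupport (fun z => ψ z * a₁ z) := hc.mul_right
  have c₂ : HasCompactSupport (fun z => ψ z * a₂ z) := hc.mul_right
  have key : ∀ z, fderiv ℝ ψ z 1 * a₂ z - fderiv ℝ ψ z Complex.I * a₁ z =
      fderiv ℝ (fun z => ψ z * a₂ z) z 1 - fderiv ℝ (fun z => ψ z * a₁ z) z Complex.I := by
    intro z
    by_cases hz : z ∈ tsupport ψ
    · have d : DifferentiableAt ℝ ψ z := hψ.differentiable (by norm_num) z
      have d₁ : DifferentiableAt ℝ a₁ z :=
        (h₁.contDiffAt (hU.mem_nhds (hs hz))).differentiableAt (by norm_num)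
      have d₂ : DifferentiableAt ℝ a₂ z :=
        (h₂.contDiffAt (hU.mem_nhds (hs hz))).differentiableAt (by norm_num)
      rw [fderiv_fun_mul d d₂, fderiv_fun_mul d d₁]
      simp [hcl z (hs hz)]
      ring
    · have h0 : ψ =ᶠ[𝓝 z] 0 := notMem_tsupport_iff_eventuallyEq.1 hz
      have g₁ : (fun z => ψ z * a₁ z) =ᶠ[𝓝 z] fun _ => (0 : ℝ) := by
        filter_upwards [h0] with y hy; simp [hy]
      have g₂ : (fun z => ψ z * a₂ z) =ᶠ[𝓝 z] fun _ => (0 : ℝ) := by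
        filter_upwards [h0] with y hy; simp [hy]
      rw [g₁.fderiv_eq, g₂.fderiv_eq, h0.fderiv_eq]
      simp
  simp_rw [key]
  rw [integral_sub, integral_fderiv_eq_zero e₂ c₂, integral_fderiv_eq_zero e₁ c₁, sub_zero]
  · exact (continuous_fderiv_apply_of_contDiff e₂ _).integrable_of_hasCompactSupport
      (hasCompactSupport_fderiv_apply c₂ _)
  · exact (continuous_fderiv_apply_of_contDiff e₁ _).integrable_of_hasCompactSupport
      (hasCompactSupport_fderiv_apply c₁ _)

/-! ### The nonlinearity `w ↦ ‖w‖ ^ (p - 2) • w` -/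

/-- The vector field whose divergence defines the `p`-Laplacian. -/
noncomputable def flux (p : ℝ) (w : ℂ) : ℂ := ‖w‖ ^ (p - 2) • w

theorem flux_zero (p : ℝ) : flux p 0 = 0 := by simp [flux]

theorem norm_flux {p : ℝ} (hp : 1 < p) (w : ℂ) : ‖flux p w‖ = ‖w‖ ^ (p - 1) := by
  by_cases hw : w = 0
  · simp [hw, flux, Real.zero_rpow (by linarith : p - 1 ≠ 0)]
  · have h : 0 < ‖w‖ := norm_pos_iff.2 hw
    rw [flux, norm_smul, Real.norm_of_nonneg (by positivity), ← Real.rpow_add_one h.ne']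
    ring_nf

theorem contDiffAt_flux (p : ℝ) {w : ℂ} (hw : w ≠ 0) : ContDiffAt ℝ ∞ (flux p) w := by
  unfold flux
  exact ((contDiffAt_norm ℝ hw).rpow_const_of_ne (norm_ne_zero_iff.2 hw)).smul contDiffAt_id

theorem continuous_flux {p : ℝ} (hp : 1 < p) : Continuous (flux p) := by
  rw [continuous_iff_continuousAt]
  intro w
  by_cases hw : w = 0
  · subst hw
    rw [ContinuousAt, flux_zero, tendsto_zero_iff_norm_tendsto_zero]
    simp_rw [norm_flux hp]
    have : ContinuousAt (fun w : ℂ => ‖w‖ ^ (p - 1)) 0 :=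
      (continuous_norm.continuousAt).rpow_const (Or.inr (by linarith))
    simpa [ContinuousAt, Real.zero_rpow (by linarith : p - 1 ≠ 0)] using this
  · exact (contDiffAt_flux p hw).continuousAt

/-- The monotonicity form of the flux. -/
noncomputable def gap (p : ℝ) (a b : ℂ) : ℝ := ⟪flux p a - flux p b, a - b⟫

theorem continuous_gap {p : ℝ} (hp : 1 < p) : Continuous fun x : ℂ × ℂ => gap p x.1 x.2 := by
  have := continuous_flux hp
  unfold gap
  fun_prop

theorem gap_eq (p : ℝ) (a b : ℂ) : gap p a b =
    (‖a‖ ^ (p - 2) + ‖b‖ ^ (p - 2)) / 2 * ‖a - b‖ ^ 2 +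
      (‖a‖ ^ (p - 2) - ‖b‖ ^ (p - 2)) / 2 * (‖a‖ ^ 2 - ‖b‖ ^ 2) := by
  unfold gap flux
  rw [norm_sub_sq_real]
  simp only [inner_sub_left, inner_sub_right, real_inner_smul_left, real_inner_self_eq_norm_sq,
    real_inner_comm a b]
  ring

theorem inner_flux_self {p : ℝ} (hp : 1 < p) (a : ℂ) : ⟪flux p a, a⟫ = ‖a‖ ^ p := by
  by_cases ha : a = 0
  · simp [ha, Real.zero_rpow (by linarith : p ≠ 0)]
  · have h : 0 < ‖a‖ := norm_pos_iff.2 ha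
    rw [flux, real_inner_smul_left, real_inner_self_eq_norm_sq, ← Real.rpow_natCast,
      ← Real.rpow_add h]
    norm_num

theorem le_gap {p : ℝ} (hp : 1 < p) (a b : ℂ) :
    ‖a‖ ^ p - ‖a‖ ^ (p - 1) * ‖b‖ - ‖b‖ ^ (p - 1) * ‖a‖ + ‖b‖ ^ p ≤ gap p a b := by
  have h1 := real_inner_le_norm (flux p a) b
  have h2 := real_inner_le_norm (flux p b) a
  rw [norm_flux hp] at h1 h2
  unfold gap
  simp only [inner_sub_left, inner_sub_right, inner_flux_self hp]
  linarith

theorem rpow_sub_one_mul_self {p : ℝ} (hp : 1 < p) {x : ℝ} (hx : 0 ≤ x) :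
    x ^ (p - 1) * x = x ^ p := by
  rcases hx.eq_or_lt with rfl | h
  · simp [Real.zero_rpow (by linarith : p ≠ 0)]
  · rw [← Real.rpow_add_one h.ne']; ring_nf

theorem gap_pos {p : ℝ} (hp : 1 < p) {a b : ℂ} (hab : a ≠ b) : 0 < gap p a b := by
  rcases lt_trichotomy ‖a‖ ‖b‖ with h | h | h
  · have h1 := le_gap hp a b
    have h2 := Real.rpow_lt_rpow (norm_nonneg a) h (by linarith : 0 < p - 1)
    rw [← rpow_sub_one_mul_self hp (norm_nonneg a), ← rpow_sub_one_mul_self hp (norm_nonneg b)] at h1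
    nlinarith
  · rw [gap_eq, h]
    have hb : 0 < ‖b‖ := by
      rcases (norm_nonneg b).eq_or_lt with h0 | h0
      · rw [← h0] at h
        exact absurd ((norm_eq_zero.1 h).trans (norm_eq_zero.1 h0.symm).symm) hab
      · exact h0
    have hab' : 0 < ‖a - b‖ := norm_pos_iff.2 (sub_ne_zero.2 hab)
    have : 0 < ‖b‖ ^ (p - 2) := by positivity
    have : 0 < ‖b‖ ^ (p - 2) * ‖a - b‖ ^ 2 := by positivity
    nlinarith
  · have h1 := le_gap hp a b
    have h2 := Real.rpow_lt_rpow (norm_nonneg b) h (by linarith : 0 < p - 1)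
    rw [← rpow_sub_one_mul_self hp (norm_nonneg a), ← rpow_sub_one_mul_self hp (norm_nonneg b)] at h1
    nlinarith

theorem gap_nonneg {p : ℝ} (hp : 1 < p) (a b : ℂ) : 0 ≤ gap p a b := by
  by_cases h : a = b
  · simp [h, gap]
  · exact (gap_pos hp h).le

theorem inner_flux_le_gap {p : ℝ} (hp : 1 < p) (b e : ℂ) {δ t : ℝ} (h : δ < t) (ht : 0 ≤ t) :
    t * ⟪flux p (b + δ • e) - flux p b, e⟫ ≤ gap p (b + t • e) b := by
  have h2 := gap_nonneg hp (b + t • e) (b + δ • e)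
  have h3 : b + t • e - (b + δ • e) = (t - δ) • e := by rw [sub_smul]; ring
  rw [gap, h3, real_inner_smul_right] at h2
  have h2' : 0 ≤ ⟪flux p (b + t • e) - flux p (b + δ • e), e⟫ :=
    nonneg_of_mul_nonneg_right h2 (by linarith)
  rw [gap, add_sub_cancel_left, real_inner_smul_right]
  refine mul_le_mul_of_nonneg_left ?_ ht
  simp only [inner_sub_left] at h2' ⊢
  linarith

theorem exists_le_gap_add_smul {p : ℝ} (hp : 1 < p) (M : ℝ) {δ : ℝ} (hδ : 0 < δ) :
    ∃ c > 0, ∀ b e : ℂ, ‖b‖ ≤ M → ‖e‖ = 1 → c ≤ gap p (b + δ • e) b := by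
  have hcont : Continuous fun x : ℂ × ℂ => gap p (x.1 + δ • x.2) x.1 := by
    have := continuous_flux hp
    unfold gap
    fun_prop
  rcases lt_or_ge M 0 with hM | hM
  · exact ⟨1, one_pos, fun b e hb => absurd ((norm_nonneg b).trans hb) (by linarith)⟩
  have hcomp : IsCompact (Metric.closedBall (0 : ℂ) M ×ˢ Metric.sphere (0 : ℂ) 1) :=
    (isCompact_closedBall 0 M).prod (isCompact_sphere 0 1)
  obtain ⟨x, hx, hmin⟩ := hcomp.exists_isMinOn
    ⟨((0 : ℂ), (1 : ℂ)), by simp [hM]⟩ hcont.continuousOn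
  refine ⟨_, gap_pos hp ?_, fun b e hb he => isMinOn_iff.1 hmin (b, e)
    (mk_mem_prod (mem_closedBall_zero_iff.2 hb) (mem_sphere_zero_iff_norm.2 he))⟩
  have h1 : ‖x.2‖ = 1 := mem_sphere_zero_iff_norm.1 hx.2
  simp only [ne_eq, add_eq_left, smul_eq_zero, not_or]
  refine ⟨hδ.ne', fun h => ?_⟩
  rw [h, norm_zero] at h1
  exact zero_ne_one h1

theorem exists_norm_sub_le_gap {p : ℝ} (hp : 1 < p) (M : ℝ) {δ : ℝ} (hδ : 0 < δ) :
    ∃ c > 0, ∀ a b : ℂ, ‖b‖ ≤ M → c * (‖a - b‖ - δ) ≤ gap p a b := by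
  obtain ⟨c, hc, hcle⟩ := exists_le_gap_add_smul hp M hδ
  refine ⟨c / δ, by positivity, fun a b hb => ?_⟩
  rcases le_or_gt ‖a - b‖ δ with h | h
  · exact (mul_nonpos_of_nonneg_of_nonpos (by positivity) (by linarith)).trans (gap_nonneg hp a b)
  · obtain ⟨t, ht⟩ : ∃ t, t = ‖a - b‖ := ⟨_, rfl⟩
    rw [← ht] at h ⊢
    have htpos : 0 < t := hδ.trans h
    obtain ⟨e, hnorm, rfl⟩ : ∃ e : ℂ, ‖e‖ = 1 ∧ a = b + t • e := by
      refine ⟨t⁻¹ • (a - b), ?_, ?_⟩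
      · rw [norm_smul, norm_inv, Real.norm_of_nonneg htpos.le, ← ht, inv_mul_cancel₀ htpos.ne']
      · rw [smul_smul, mul_inv_cancel₀ htpos.ne', one_smul]; ring
    have h1 : c ≤ gap p (b + δ • e) b :=
      hcle b e hb hnorm
    have h2 := inner_flux_le_gap hp b e h htpos.le
    rw [gap, add_sub_cancel_left, real_inner_smul_right] at h1
    have h5 : c / δ ≤ ⟪flux p (b + δ • e) - flux p b, e⟫ := by
      rw [div_le_iff₀ hδ]; linarith
    have : 0 < c / δ := by positivity
    nlinarith

theorem exists_norm_rpow_le_gap {p : ℝ} (hp : 1 < p) {M : ℝ} (hM : 0 ≤ M) :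
    ∃ C > 0, ∀ a b : ℂ, ‖b‖ ≤ M → ‖a‖ ^ p ≤ C * (1 + gap p a b) := by
  set X := max (4 * M) (M * 4 ^ (1 / (p - 1))) with hX
  have hX0 : 0 ≤ X := le_max_of_le_left (by linarith)
  refine ⟨max 2 (X ^ p), lt_max_of_lt_left (by norm_num), fun a b hb => ?_⟩
  have hg := gap_nonneg hp a b
  rcases le_or_gt ‖a‖ X with h | h
  · calc ‖a‖ ^ p ≤ X ^ p := Real.rpow_le_rpow (norm_nonneg _) h (by linarith)
      _ ≤ max 2 (X ^ p) := le_max_right _ _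
      _ ≤ _ := le_mul_of_one_le_right (le_max_of_le_left (by norm_num)) (by linarith)
  · have ha : 0 ≤ ‖a‖ := norm_nonneg a
    have h1 := le_gap hp a b
    have e1 : ‖a‖ ^ (p - 1) * ‖b‖ ≤ ‖a‖ ^ p / 4 := by
      rw [← rpow_sub_one_mul_self hp ha]
      have : 4 * ‖b‖ ≤ ‖a‖ := by linarith [le_max_left (4 * M) (M * 4 ^ (1 / (p - 1)))]
      have h0 : 0 ≤ ‖a‖ ^ (p - 1) := by positivity
      nlinarith
    have e2 : ‖b‖ ^ (p - 1) * ‖a‖ ≤ ‖a‖ ^ p / 4 := by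
      rw [← rpow_sub_one_mul_self hp ha]
      have hle : ‖b‖ * 4 ^ (1 / (p - 1)) ≤ ‖a‖ := by
        refine le_trans ?_ ((le_max_right (4 * M) (M * 4 ^ (1 / (p - 1)))).trans h.le)
        gcongr
      have := Real.rpow_le_rpow (by positivity) hle (by linarith : 0 ≤ p - 1)
      rw [Real.mul_rpow (norm_nonneg _) (by positivity), ← Real.rpow_mul (by norm_num),
        one_div_mul_cancel (by linarith), Real.rpow_one] at this
      nlinarith
    have e3 : 0 ≤ ‖b‖ ^ p := by positivity
    have e4 : (2 : ℝ) ≤ max 2 (X ^ p) := le_max_left _ _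
    nlinarith

theorem exists_weighted_flux_le {p : ℝ} (hp : 1 < p) {M : ℝ} (hM : 0 ≤ M) {k : ℕ}
    (hk : p ≤ k + 1) :
    ∃ C > 0, ∀ a b : ℂ, ‖b‖ ≤ M → ∀ t : ℝ, 0 ≤ t → t ≤ 1 →
      t ^ k * ‖flux p a‖ ≤ C * (1 + t ^ (k + 1) * gap p a b) := by
  obtain ⟨C, hC, h⟩ := exists_norm_rpow_le_gap hp hM
  refine ⟨C + 1, by positivity, fun a b hb t ht0 ht1 => ?_⟩
  have ha : 0 ≤ ‖a‖ := norm_nonneg a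
  have hg := gap_nonneg hp a b
  have htk : 0 ≤ t ^ (k + 1) := by positivity
  have htk1 : t ^ (k + 1) ≤ 1 := pow_le_one₀ ht0 ht1
  rw [norm_flux hp]
  suffices hs : t ^ k * ‖a‖ ^ (p - 1) ≤ 1 + t ^ (k + 1) * ‖a‖ ^ p by
    have := mul_le_mul_of_nonneg_left (h a b hb) htk
    have h2 : 0 ≤ t ^ (k + 1) * gap p a b := by positivity
    nlinarith
  rcases le_or_gt 1 (t * ‖a‖) with h1 | h1
  · rw [← rpow_sub_one_mul_self hp ha, pow_succ]
    have h2 : 0 ≤ t ^ k * ‖a‖ ^ (p - 1) := by positivity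
    nlinarith
  · have h2 : t ^ k ≤ t ^ (p - 1) := by
      rcases ht0.eq_or_lt with rfl | h0
      · rw [Real.zero_rpow (by linarith), zero_pow]
        rintro rfl
        norm_num at hk
        linarith
      · rw [← Real.rpow_natCast]
        exact Real.rpow_le_rpow_of_exponent_ge h0 ht1 (by linarith)
    have h3 : t ^ k * ‖a‖ ^ (p - 1) ≤ (t * ‖a‖) ^ (p - 1) := by
      rw [Real.mul_rpow ht0 ha]
      gcongr
    have h4 : (t * ‖a‖) ^ (p - 1) ≤ 1 := Real.rpow_le_one (by positivity) h1.le (by linarith)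
    have h5 : 0 ≤ t ^ (k + 1) * ‖a‖ ^ p := by positivity
    linarith

/-- The normalized linearization of the flux at `b`. -/
noncomputable def linFlux (p : ℝ) (b z : ℂ) : ℂ := z + ((p - 2) * ⟪b, z⟫ / ‖b‖ ^ 2) • b

theorem fderiv_flux_apply (p : ℝ) {b : ℂ} (hb : b ≠ 0) (z : ℂ) :
    fderiv ℝ (flux p) b z = ‖b‖ ^ (p - 2) • linFlux p b z := by
  have hn : 0 < ‖b‖ := norm_pos_iff.2 hb
  have hsq : HasFDerivAt (fun w : ℂ => ‖w‖ ^ 2) (2 • innerSL ℝ b) b :=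
    (hasStrictFDerivAt_norm_sq b).hasFDerivAt
  have hr := hsq.rpow_const (p := (p - 2) / 2) (Or.inl (by positivity))
  have heq : (fun w : ℂ => (‖w‖ ^ 2) ^ ((p - 2) / 2)) = fun w : ℂ => ‖w‖ ^ (p - 2) := by
    funext w
    rw [← Real.rpow_natCast, ← Real.rpow_mul (norm_nonneg _)]
    congr 1
    push_cast
    ring
  rw [heq] at hr
  have := (hr.smul (hasFDerivAt_id b)).fderiv
  have hf : flux p = fun w => ‖w‖ ^ (p - 2) • id w := rfl
  have hpow : ((‖b‖ ^ 2 : ℝ) ^ ((p - 2) / 2 - 1)) = ‖b‖ ^ (p - 2) / ‖b‖ ^ 2 := by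
    rw [Real.rpow_sub (by positivity), Real.rpow_one]
    congr 1
    exact congrFun heq b
  rw [hf]
  erw [this]
  simp only [hpow, linFlux]
  simp [smul_add]
  ring

theorem norm_linFlux_le (p : ℝ) (b z : ℂ) : ‖linFlux p b z‖ ≤ (1 + |p - 2|) * ‖z‖ := by
  unfold linFlux
  refine (norm_add_le _ _).trans ?_
  rw [norm_smul, Real.norm_eq_abs, abs_div, abs_mul, abs_of_nonneg (by positivity : 0 ≤ ‖b‖ ^ 2)]
  have h := abs_real_inner_le_norm b z
  by_cases hb : ‖b‖ = 0
  · rw [hb]; simp; nlinarith [abs_nonneg (p - 2), norm_nonneg z]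
  · have hb' : 0 < ‖b‖ := lt_of_le_of_ne (norm_nonneg b) (Ne.symm hb)
    have : |p - 2| * |⟪b, z⟫| / ‖b‖ ^ 2 * ‖b‖ ≤ |p - 2| * ‖z‖ := by
      rw [div_mul_eq_mul_div, div_le_iff₀ (by positivity)]
      have := mul_le_mul_of_nonneg_left h (mul_nonneg (abs_nonneg (p - 2)) hb'.le)
      nlinarith
    linarith

theorem le_inner_linFlux (p : ℝ) (b z : ℂ) :
    min 1 (p - 1) * ‖z‖ ^ 2 ≤ ⟪linFlux p b z, z⟫ := by
  unfold linFlux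
  rw [inner_add_left, real_inner_smul_left, real_inner_self_eq_norm_sq]
  have h := abs_real_inner_le_norm b z
  have hz := sq_nonneg ‖z‖
  set q := ⟪b, z⟫ ^ 2 / ‖b‖ ^ 2 with hq
  have hq0 : 0 ≤ q := by positivity
  have hq1 : q ≤ ‖z‖ ^ 2 := by
    refine div_le_of_le_mul₀ (by positivity) (by positivity) ?_
    rw [← sq_abs, ← mul_pow, mul_comm]
    gcongr
  have e : (p - 2) * ⟪b, z⟫ / ‖b‖ ^ 2 * ⟪b, z⟫ = (p - 2) * q := by rw [hq]; ring
  rw [e]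
  rcases le_total 1 (p - 1) with h1 | h1
  · rw [min_eq_left h1]; nlinarith
  · rw [min_eq_right h1]; nlinarith

/-- Uniform first-order Taylor expansion of the flux on compact sets avoiding the origin. -/
theorem exists_flux_taylor (p : ℝ) {S : Set ℂ} (hS : IsCompact S) (h0 : (0 : ℂ) ∉ S)
    {ε : ℝ} (hε : 0 < ε) :
    ∃ δ > 0, ∀ b ∈ S, ∀ a : ℂ, ‖a - b‖ < δ →
      ‖flux p a - flux p b - fderiv ℝ (flux p) b (a - b)‖ ≤ ε * ‖a - b‖ := by
  have hne : ∀ b ∈ S, b ≠ 0 := fun b hb h => h0 (h ▸ hb)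
  have hloc : ∀ b ∈ S, ∃ W : Set ℂ, IsOpen W ∧ b ∈ W ∧ ∀ x ∈ W, ∀ y ∈ W,
      ‖flux p x - flux p y - fderiv ℝ (flux p) y (x - y)‖ ≤ ε * ‖x - y‖ := by
    intro b hb
    have hc := contDiffAt_flux p (hne b hb)
    have hstrict : HasStrictFDerivAt (flux p) (fderiv ℝ (flux p) b) b :=
      hc.hasStrictFDerivAt (by simp)
    have h1 : ∀ᶠ x : ℂ × ℂ in 𝓝 (b, b),
        ‖flux p x.1 - flux p x.2 - fderiv ℝ (flux p) b (x.1 - x.2)‖ ≤ ε / 2 * ‖x.1 - x.2‖ :=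
      hstrict.isLittleO.def (half_pos hε)
    have hcont : ContinuousAt (fderiv ℝ (flux p)) b :=
      (hc.fderiv_right (m := 0) (by simp)).continuousAt
    have h2 := Metric.continuousAt_iff'.1 hcont (ε / 2) (half_pos hε)
    rw [nhds_prod_eq] at h1
    obtain ⟨W1, hW1, hW1'⟩ := mem_prod_self_iff.1 h1
    obtain ⟨W, hWs, hWo, hbW⟩ := mem_nhds_iff.1 (inter_mem hW1 h2)
    refine ⟨W, hWo, hbW, fun x hx y hy => ?_⟩
    have e1 : ‖flux p x - flux p y - fderiv ℝ (flux p) b (x - y)‖ ≤ ε / 2 * ‖x - y‖ := by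
      have e0 := hW1' (mk_mem_prod (hWs hx).1 (hWs hy).1)
      simpa only [mem_ofPred_eq] using e0
    have e2 : dist (fderiv ℝ (flux p) y) (fderiv ℝ (flux p) b) < ε / 2 := (hWs hy).2
    rw [dist_eq_norm] at e2
    calc ‖flux p x - flux p y - fderiv ℝ (flux p) y (x - y)‖
        = ‖(flux p x - flux p y - fderiv ℝ (flux p) b (x - y)) -
            (fderiv ℝ (flux p) y - fderiv ℝ (flux p) b) (x - y)‖ := by
          congr 1
          simp only [sub_apply]
          ring
      _ ≤ ε / 2 * ‖x - y‖ + ε / 2 * ‖x - y‖ := by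
          refine (norm_sub_le _ _).trans (add_le_add e1 ?_)
          exact (ContinuousLinearMap.le_opNorm _ _).trans (by gcongr)
      _ = ε * ‖x - y‖ := by ring
  choose! W hWo hbW hW using hloc
  obtain ⟨δ, hδ, hleb⟩ := lebesgue_number_lemma_of_metric (c := fun b : S => W b) hS
    (fun b => hWo b b.2) (fun b hb => mem_iUnion.2 ⟨⟨b, hb⟩, hbW b hb⟩)
  refine ⟨δ, hδ, fun b hb a hab => ?_⟩
  obtain ⟨i, hi⟩ := hleb b hb
  exact hW i i.2 a (hi (by simpa [dist_eq_norm] using hab)) b (hi (Metric.mem_ball_self hδ))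

/-- Local ellipticity bounds for the flux on compact sets avoiding the origin. -/
theorem exists_flux_elliptic {p : ℝ} (hp : 1 < p) {S : Set ℂ} (hS : IsCompact S)
    (h0 : (0 : ℂ) ∉ S) :
    ∃ δ > 0, ∃ c > 0, ∃ C > 0, ∀ b ∈ S, ∀ a : ℂ, ‖a - b‖ < δ →
      c * ‖a - b‖ ^ 2 ≤ gap p a b ∧ ‖flux p a - flux p b‖ ≤ C * ‖a - b‖ := by
  have hne : ∀ b ∈ S, b ≠ 0 := fun b hb h => h0 (h ▸ hb)
  have hcont : ContinuousOn (fun b : ℂ => ‖b‖ ^ (p - 2)) S := fun b hb =>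
    (continuous_norm.continuousAt.rpow_const
      (Or.inl (norm_ne_zero_iff.2 (hne b hb)))).continuousWithinAt
  obtain ⟨m, hm, hmle⟩ := hS.exists_forall_le' hcont (a := 0)
    (fun b hb => by have := norm_pos_iff.2 (hne b hb); positivity)
  obtain ⟨M, hM⟩ := hS.bddAbove_image hcont
  have hM' : ∀ b ∈ S, ‖b‖ ^ (p - 2) ≤ M := fun b hb => hM (mem_image_of_mem _ hb)
  set κ := min 1 (p - 1) with hκ
  have hκ0 : 0 < κ := lt_min one_pos (by linarith)
  obtain ⟨δ, hδ, h⟩ := exists_flux_taylor p hS h0 (ε := m * κ / 2) (by positivity)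
  refine ⟨δ, hδ, m * κ / 2, by positivity, |M| * (1 + |p - 2|) + m * κ / 2, by positivity,
    fun b hb a hab => ⟨?_, ?_⟩⟩
  · have h1 := h b hb a hab
    have h2 := le_inner_linFlux p b (a - b)
    have h3 : gap p a b = ⟪flux p a - flux p b - fderiv ℝ (flux p) b (a - b), a - b⟫ +
        ‖b‖ ^ (p - 2) * ⟪linFlux p b (a - b), a - b⟫ := by
      rw [fderiv_flux_apply p (hne b hb), ← real_inner_smul_left, ← inner_add_left, gap]
      congr 1
      ring
    have h4 := neg_le_of_abs_le (abs_real_inner_le_norm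
      (flux p a - flux p b - fderiv ℝ (flux p) b (a - b)) (a - b))
    have h5 := mul_le_mul_of_nonneg_right h1 (norm_nonneg (a - b))
    have h6 : m * (κ * ‖a - b‖ ^ 2) ≤ ‖b‖ ^ (p - 2) * ⟪linFlux p b (a - b), a - b⟫ :=
      mul_le_mul (hmle b hb) h2 (by positivity) (hm.le.trans (hmle b hb))
    rw [h3]
    nlinarith
  · have h1 := h b hb a hab
    have h2 := norm_linFlux_le p b (a - b)
    have h3 : ‖fderiv ℝ (flux p) b (a - b)‖ ≤ |M| * ((1 + |p - 2|) * ‖a - b‖) := by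
      rw [fderiv_flux_apply p (hne b hb), norm_smul, Real.norm_of_nonneg (by positivity)]
      exact mul_le_mul ((hM' b hb).trans (le_abs_self M)) h2 (norm_nonneg _) (abs_nonneg _)
    have h4 := norm_add_le (flux p a - flux p b - fderiv ℝ (flux p) b (a - b))
      (fderiv ℝ (flux p) b (a - b))
    rw [sub_add_cancel] at h4
    linarith

attribute [irreducible] flux gap linFlux

/-! ### Gradients and `p`-harmonic functions of a complex variable -/

/-- The gradient of a real function on the complex plane, as a complex number. -/
noncomputable def cgrad (u : ℂ → ℝ) (z : ℂ) : ℂ := ⟨fderiv ℝ u z 1, fderiv ℝ u z Complex.I⟩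

theorem real_inner_eq (a b : ℂ) : ⟪a, b⟫ = a.re * b.re + a.im * b.im := by
  rw [Complex.inner]; simp [mul_comm]

theorem fderiv_eq_inner_cgrad (u : ℂ → ℝ) (z w : ℂ) : fderiv ℝ u z w = ⟪cgrad u z, w⟫ := by
  have hw : w = w.re • (1 : ℂ) + w.im • Complex.I := by simp [Complex.re_add_im]
  rw [real_inner_eq, cgrad]
  conv_lhs => rw [hw]
  rw [map_add, map_smul, map_smul]
  simp [mul_comm]

theorem eq_cgrad_of_forall_inner {u : ℂ → ℝ} {z a : ℂ} (h : ∀ w, fderiv ℝ u z w = ⟪a, w⟫) :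
    cgrad u z = a := by
  apply Complex.ext
  · simp [cgrad, h]
  · simp [cgrad, h]

theorem continuous_cgrad {u : ℂ → ℝ} (hu : ContDiff ℝ 1 u) : Continuous (cgrad u) := by
  have h : cgrad u = fun z => ((fderiv ℝ u z 1 : ℝ) : ℂ) + (fderiv ℝ u z Complex.I : ℝ) * Complex.I := by
    funext z
    exact Complex.mk_eq_add_mul_I _ _
  have h1 := continuous_fderiv_apply_of_contDiff hu 1
  have h2 := continuous_fderiv_apply_of_contDiff hu Complex.I
  rw [h]
  fun_prop

theorem cgrad_eq_of_eventuallyEq {u v : ℂ → ℝ} {z : ℂ} (h : u =ᶠ[𝓝 z] v) :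
    cgrad u z = cgrad v z := by
  simp [cgrad, h.fderiv_eq]

theorem cgrad_eq_zero_of_notMem_tsupport {u : ℂ → ℝ} {z : ℂ} (hz : z ∉ tsupport u) :
    cgrad u z = 0 := by
  have h : u =ᶠ[𝓝 z] fun _ => 0 := notMem_tsupport_iff_eventuallyEq.1 hz
  rw [cgrad_eq_of_eventuallyEq h]
  simp [cgrad, Complex.ext_iff]

theorem hasCompactSupport_cgrad {u : ℂ → ℝ} (hc : HasCompactSupport u) :
    HasCompactSupport (cgrad u) :=
  HasCompactSupport.of_support_subset_isCompact hc fun _ hz => by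
    by_contra h
    exact hz (cgrad_eq_zero_of_notMem_tsupport h)

theorem cgrad_sub {u v : ℂ → ℝ} {z : ℂ} (hu : DifferentiableAt ℝ u z)
    (hv : DifferentiableAt ℝ v z) : cgrad (fun z => u z - v z) z = cgrad u z - cgrad v z := by
  simp [cgrad, fderiv_fun_sub hu hv, Complex.ext_iff]

theorem cgrad_mul {u v : ℂ → ℝ} {z : ℂ} (hu : DifferentiableAt ℝ u z)
    (hv : DifferentiableAt ℝ v z) :
    cgrad (fun z => u z * v z) z = u z • cgrad v z + v z • cgrad u z := by
  simp [cgrad, fderiv_fun_mul hu hv, Complex.ext_iff]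

theorem cgrad_pow {u : ℂ → ℝ} {z : ℂ} (hu : DifferentiableAt ℝ u z) (k : ℕ) :
    cgrad (fun z => u z ^ (k + 1)) z = ((k + 1) * u z ^ k) • cgrad u z := by
  simp only [cgrad, fderiv_fun_pow (k + 1) hu, Complex.ext_iff, Complex.smul_re, Complex.smul_im]
  simp

/-- A compactly supported `C¹` function which is `p`-harmonic on `V`. -/
structure PH (p : ℝ) (V : Set ℂ) (u : ℂ → ℝ) : Prop where
  contDiff : ContDiff ℝ 1 u
  hasCompactSupport : HasCompactSupport u
  weak : ∀ ψ : ℂ → ℝ, ContDiff ℝ 1 ψ → HasCompactSupport ψ → tsupport ψ ⊆ V →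
    ∫ z, ⟪flux p (cgrad u z), cgrad ψ z⟫ = 0

theorem PH.mono {p : ℝ} {V W : Set ℂ} {u : ℂ → ℝ} (h : PH p V u) (hW : W ⊆ V) : PH p W u :=
  ⟨h.1, h.2, fun ψ h1 h2 h3 => h.3 ψ h1 h2 (h3.trans hW)⟩

theorem PH.differentiable {p : ℝ} {V : Set ℂ} {u : ℂ → ℝ} (h : PH p V u) : Differentiable ℝ u :=
  h.contDiff.differentiable (by norm_num)

theorem PH.continuous_cgrad {p : ℝ} {V : Set ℂ} {u : ℂ → ℝ} (h : PH p V u) :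
    Continuous (cgrad u) := PHarmonic.continuous_cgrad h.contDiff

theorem PH.exists_norm_cgrad_le {p : ℝ} {V : Set ℂ} {u : ℂ → ℝ} (h : PH p V u) :
    ∃ M : ℝ, 0 ≤ M ∧ ∀ z, ‖cgrad u z‖ ≤ M := by
  obtain ⟨M, hM⟩ := (hasCompactSupport_cgrad h.hasCompactSupport).exists_bound_of_continuous
    h.continuous_cgrad
  exact ⟨M, (norm_nonneg _).trans (hM 0), hM⟩

theorem integrable_of_tsupport {f : ℂ → ℝ} (hf : Continuous f) {η : ℂ → ℝ}
    (hη : HasCompactSupport η) (h : ∀ z, z ∉ tsupport η → f z = 0) : Integrable f :=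
  hf.integrable_of_hasCompactSupport (HasCompactSupport.of_support_subset_isCompact hη
    fun z hz => by by_contra h'; exact hz (h z h'))

theorem integrable_inner_flux_cgrad {p : ℝ} (hp : 1 < p) {u ψ : ℂ → ℝ} (hu : ContDiff ℝ 1 u)
    (hψ : ContDiff ℝ 1 ψ) (hc : HasCompactSupport ψ) :
    Integrable fun z => ⟪flux p (cgrad u z), cgrad ψ z⟫ := by
  refine integrable_of_tsupport ?_ hc fun z hz => by
    rw [cgrad_eq_zero_of_notMem_tsupport hz, inner_zero_right]
  have h1 := (continuous_flux hp).comp (continuous_cgrad hu)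
  exact h1.inner (continuous_cgrad hψ)

/-- A Caccioppoli-type estimate for the difference of two `p`-harmonic functions. -/
theorem exists_integral_gap_le {p : ℝ} (hp : 1 < p) {V : Set ℂ} {u : ℂ → ℝ} (hu : PH p V u)
    {η : ℂ → ℝ} (hη : ContDiff ℝ ∞ η) (hηc : HasCompactSupport η) (hηV : tsupport η ⊆ V)
    (hη01 : ∀ z, 0 ≤ η z ∧ η z ≤ 1) (k : ℕ) (hk : p ≤ k + 1) :
    ∃ C > 0, ∀ v, PH p V v → ∀ ε, 0 ≤ ε → (∀ z ∈ V, |v z - u z| ≤ ε) →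
      ∫ z, η z ^ (k + 1) * gap p (cgrad v z) (cgrad u z) ≤
        ε * (C * (1 + ∫ z, η z ^ (k + 1) * gap p (cgrad v z) (cgrad u z))) := by
  obtain ⟨M, hM0, hM⟩ := hu.exists_norm_cgrad_le
  obtain ⟨C₀, hC₀, hw⟩ := exists_weighted_flux_le hp hM0 hk
  have hη1 : ContDiff ℝ 1 η := hη.of_le (by simp)
  obtain ⟨D, hD⟩ := (hasCompactSupport_cgrad hηc).exists_bound_of_continuous (continuous_cgrad hη1)
  have hD0 : 0 ≤ D := (norm_nonneg _).trans (hD 0)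
  have hA : ∀ z, ‖flux p (cgrad u z)‖ ≤ M ^ (p - 1) := fun z => by
    rw [norm_flux hp]
    exact Real.rpow_le_rpow (norm_nonneg _) (hM z) (by linarith)
  set A := M ^ (p - 1) with hAdef
  have hA0 : 0 ≤ A := by positivity
  have hcη := continuous_cgrad hη1
  set S := ∫ z, ‖cgrad η z‖ with hS
  have hS0 : 0 ≤ S := integral_nonneg fun z => norm_nonneg _
  refine ⟨(k + 1) * ((C₀ + A) * S + C₀ * D) + 1, by positivity, fun v hv ε hε hvu => ?_⟩
  set I := ∫ z, η z ^ (k + 1) * gap p (cgrad v z) (cgrad u z) with hI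
  have hgapc : Continuous fun z => gap p (cgrad v z) (cgrad u z) :=
    (continuous_gap hp).comp (hv.continuous_cgrad.prodMk hu.continuous_cgrad)
  have hI0 : 0 ≤ I := integral_nonneg fun z =>
    mul_nonneg (pow_nonneg (hη01 z).1 _) (gap_nonneg hp _ _)
  have hInt : Integrable fun z => η z ^ (k + 1) * gap p (cgrad v z) (cgrad u z) := by
    refine integrable_of_tsupport ((hη.continuous.pow _).mul hgapc) hηc fun z hz => ?_
    rw [image_eq_zero_of_notMem_tsupport hz]
    simp
  have hSint : Integrable fun z => ‖cgrad η z‖ := by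
    refine integrable_of_tsupport hcη.norm hηc fun z hz => ?_
    rw [cgrad_eq_zero_of_notMem_tsupport hz, norm_zero]
  set ψ : ℂ → ℝ := fun z => η z ^ (k + 1) * (v z - u z) with hψ
  have hψ1 : ContDiff ℝ 1 ψ := (hη1.pow _).mul (hv.contDiff.sub hu.contDiff)
  have hψs : tsupport ψ ⊆ tsupport η := by
    refine closure_minimal (fun z hz => ?_) (isClosed_tsupport _)
    by_contra h
    exact hz (by simp [hψ, image_eq_zero_of_notMem_tsupport h])
  have hψc : HasCompactSupport ψ := HasCompactSupport.of_support_subset_isCompact hηc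
    ((subset_tsupport _).trans hψs)
  have e1 := hv.weak ψ hψ1 hψc (hψs.trans hηV)
  have e2 := hu.weak ψ hψ1 hψc (hψs.trans hηV)
  have hgψ : ∀ z, cgrad ψ z = η z ^ (k + 1) • (cgrad v z - cgrad u z) +
      (v z - u z) • ((k + 1) * η z ^ k) • cgrad η z := fun z => by
    have hd : DifferentiableAt ℝ η z := hη1.differentiable (by norm_num) z
    rw [hψ, cgrad_mul (hd.fun_pow _) ((hv.differentiable z).fun_sub (hu.differentiable z)),
      cgrad_sub (hv.differentiable z) (hu.differentiable z), cgrad_pow hd]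
  have e3 : ∫ z, (⟪flux p (cgrad v z), cgrad ψ z⟫ - ⟪flux p (cgrad u z), cgrad ψ z⟫) = 0 := by
    rw [integral_sub (integrable_inner_flux_cgrad hp hv.contDiff hψ1 hψc)
      (integrable_inner_flux_cgrad hp hu.contDiff hψ1 hψc), e1, e2, sub_zero]
  have hdint : Integrable fun z =>
      ⟪flux p (cgrad v z), cgrad ψ z⟫ - ⟪flux p (cgrad u z), cgrad ψ z⟫ := (integrable_inner_flux_cgrad hp hv.contDiff hψ1 hψc).sub
      (integrable_inner_flux_cgrad hp hu.contDiff hψ1 hψc)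
  have hle : I - 0 ≤ ∫ z, (ε * (k + 1)) * ((C₀ + A) * ‖cgrad η z‖ +
      (C₀ * D) * (η z ^ (k + 1) * gap p (cgrad v z) (cgrad u z))) := by
    rw [← e3, hI, ← integral_sub hInt hdint]
    refine integral_mono (hInt.sub hdint)
      (((hSint.const_mul _).add (hInt.const_mul _)).const_mul _) fun z => ?_
    simp only
    rw [← inner_sub_left, hgψ z, inner_add_right, real_inner_smul_right, real_inner_smul_right,
      real_inner_smul_right]
    have h0 : 0 ≤ η z := (hη01 z).1
    have hg := gap_nonneg hp (cgrad v z) (cgrad u z)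
    have hw' := hw (cgrad v z) (cgrad u z) (hM z) (η z) h0 (hη01 z).2
    have hηk : η z ^ k ≤ 1 := pow_le_one₀ h0 (hη01 z).2
    have hηk0 : 0 ≤ η z ^ k := by positivity
    by_cases hz : z ∈ tsupport η
    · have h1 := abs_real_inner_le_norm (flux p (cgrad v z) - flux p (cgrad u z)) (cgrad η z)
      have h2 : η z ^ k * ‖flux p (cgrad v z) - flux p (cgrad u z)‖ ≤
          C₀ * (1 + η z ^ (k + 1) * gap p (cgrad v z) (cgrad u z)) + A := by
        have := norm_sub_le (flux p (cgrad v z)) (flux p (cgrad u z))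
        have := hA z
        have : η z ^ k * ‖flux p (cgrad u z)‖ ≤ 1 * A := mul_le_mul hηk (hA z) (norm_nonneg _) (by norm_num)
        nlinarith
      have h3 : -((v z - u z) * (((k : ℝ) + 1) * η z ^ k *
          ⟪flux p (cgrad v z) - flux p (cgrad u z), cgrad η z⟫)) ≤
          ε * ((k + 1) * (η z ^ k * (‖flux p (cgrad v z) - flux p (cgrad u z)‖ * ‖cgrad η z‖))) := by
        refine (neg_le_abs _).trans ?_
        rw [abs_mul, abs_mul, abs_of_nonneg (by positivity : 0 ≤ ((k : ℝ) + 1) * η z ^ k), mul_assoc]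
        have := hvu z (hηV hz)
        gcongr
      have h4 : η z ^ k * (‖flux p (cgrad v z) - flux p (cgrad u z)‖ * ‖cgrad η z‖) ≤
          (C₀ + A) * ‖cgrad η z‖ +
          (C₀ * D) * (η z ^ (k + 1) * gap p (cgrad v z) (cgrad u z)) := by
        rw [← mul_assoc]
        refine (mul_le_mul_of_nonneg_right h2 (norm_nonneg _)).trans ?_
        have h5 : 0 ≤ C₀ * (η z ^ (k + 1) * gap p (cgrad v z) (cgrad u z)) := by positivity
        nlinarith [mul_le_mul_of_nonneg_left (hD z) h5]
      have h6 := mul_le_mul_of_nonneg_left h4 (by positivity : 0 ≤ ε * ((k : ℝ) + 1))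
      simp only [gap] at *
      nlinarith
    · rw [image_eq_zero_of_notMem_tsupport hz, cgrad_eq_zero_of_notMem_tsupport hz]
      simp
  rw [sub_zero, integral_const_mul, integral_add (hSint.const_mul _) (hInt.const_mul _),
    integral_const_mul, integral_const_mul] at hle
  rw [← hI, ← hS] at hle
  refine hle.trans ?_
  rw [mul_assoc]
  refine mul_le_mul_of_nonneg_left ?_ hε
  have : 0 ≤ ((k : ℝ) + 1) * ((C₀ + A) * S) * I := by positivity
  have : 0 ≤ ((k : ℝ) + 1) * (C₀ * D) := by positivity
  nlinarith

/-- Uniform convergence of `p`-harmonic functions implies local `L¹` convergence of gradients. -/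
theorem tendsto_integral_norm_cgrad_sub {p : ℝ} (hp : 1 < p) {V : Set ℂ} (hV : IsOpen V)
    {u : ℂ → ℝ} (hu : PH p V u) {w : ℕ → ℂ → ℝ} (hw : ∀ n, PH p V (w n))
    (hlim : TendstoUniformlyOn w u atTop V) {K : Set ℂ} (hK : IsCompact K) (hKV : K ⊆ V) :
    Tendsto (fun n => ∫ z in K, ‖cgrad (w n) z - cgrad u z‖) atTop (𝓝 0) := by
  obtain ⟨η, hη, hηc, hηV, hη01, O', hO', hKO', hη1⟩ := exists_bump hK hV hKV
  obtain ⟨M, hM0, hM⟩ := hu.exists_norm_cgrad_le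
  obtain ⟨k, hk⟩ := exists_nat_ge p
  have hk' : p ≤ (k : ℝ) + 1 := by linarith
  obtain ⟨C, hC, hCac⟩ := exists_integral_gap_le hp hu hη hηc hηV hη01 k hk'
  rw [Metric.tendsto_atTop]
  intro ε hε
  set m := volume.real K with hm
  have hm0 : 0 ≤ m := measureReal_nonneg
  obtain ⟨c, hc, hgap⟩ := exists_norm_sub_le_gap hp M (δ := ε / (2 * (m + 1))) (by positivity)
  set τ := min (1 / (2 * C)) (c * ε / (8 * C)) with hτ
  have hτ0 : 0 < τ := lt_min (by positivity) (by positivity)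
  have hev := Metric.tendstoUniformlyOn_iff.1 hlim τ hτ0
  obtain ⟨N, hN⟩ := eventually_atTop.1 hev
  refine ⟨N, fun n hn => ?_⟩
  have hcl := hCac (w n) (hw n) τ hτ0.le fun z hz => by
    have := (hN n hn z hz).le
    rwa [dist_comm, Real.dist_eq] at this
  set I := ∫ z, η z ^ (k + 1) * gap p (cgrad (w n) z) (cgrad u z) with hI
  have hgapc : Continuous fun z => gap p (cgrad (w n) z) (cgrad u z) :=
    (continuous_gap hp).comp ((hw n).continuous_cgrad.prodMk hu.continuous_cgrad)
  have hInt : Integrable fun z => η z ^ (k + 1) * gap p (cgrad (w n) z) (cgrad u z) := by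
    refine integrable_of_tsupport ((hη.continuous.pow _).mul hgapc) hηc fun z hz => ?_
    rw [image_eq_zero_of_notMem_tsupport hz]
    simp
  have hI0 : 0 ≤ I := integral_nonneg fun z =>
    mul_nonneg (pow_nonneg (hη01 z).1 _) (gap_nonneg hp _ _)
  have hτ1 : τ * C ≤ 1 / 2 := by
    calc τ * C ≤ 1 / (2 * C) * C := by gcongr; exact min_le_left _ _
      _ = 1 / 2 := by field_simp
  have hτ2 : τ * C ≤ c * ε / 8 := by
    calc τ * C ≤ c * ε / (8 * C) * C := by gcongr; exact min_le_right _ _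
      _ = c * ε / 8 := by field_simp
  have hIle : I ≤ c * ε / 4 := by nlinarith
  have hKle : ∫ z in K, gap p (cgrad (w n) z) (cgrad u z) ≤ I := by
    have : ∫ z in K, gap p (cgrad (w n) z) (cgrad u z) =
        ∫ z in K, η z ^ (k + 1) * gap p (cgrad (w n) z) (cgrad u z) :=
      setIntegral_congr_fun hK.measurableSet fun z hz => by simp [hη1 z (hKO' hz)]
    rw [this]
    exact setIntegral_le_integral hInt (Eventually.of_forall fun z =>
      mul_nonneg (pow_nonneg (hη01 z).1 _) (gap_nonneg hp _ _))
  have hK1 : IntegrableOn (fun z => ‖cgrad (w n) z - cgrad u z‖) K :=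
    (((hw n).continuous_cgrad.sub hu.continuous_cgrad).norm).continuousOn.integrableOn_compact hK
  have hK2 : IntegrableOn (fun z => gap p (cgrad (w n) z) (cgrad u z)) K :=
    hgapc.continuousOn.integrableOn_compact hK
  have hfin : ∫ z in K, ‖cgrad (w n) z - cgrad u z‖ ≤
      ∫ z in K, (ε / (2 * (m + 1)) + c⁻¹ * gap p (cgrad (w n) z) (cgrad u z)) := by
    refine integral_mono hK1 ((integrableOn_const hK.measure_lt_top.ne).add (hK2.const_mul _))
      fun z => ?_
    have := hgap (cgrad (w n) z) (cgrad u z) (hM z)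
    simp only
    rw [← sub_le_iff_le_add', inv_mul_eq_div, le_div_iff₀ hc]
    linarith
  have hKc : Integrable (fun _ : ℂ => ε / (2 * (m + 1))) (volume.restrict K) :=
    integrableOn_const hK.measure_lt_top.ne
  rw [integral_add hKc (hK2.const_mul _),
    integral_const_mul, setIntegral_const, smul_eq_mul, ← hm] at hfin
  have h0 : 0 ≤ ∫ z in K, ‖cgrad (w n) z - cgrad u z‖ := integral_nonneg fun z => norm_nonneg _
  rw [Real.dist_eq, sub_zero, abs_of_nonneg h0]
  have h1 : m * (ε / (2 * (m + 1))) ≤ ε / 2 := by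
    rw [← mul_div_assoc, div_le_div_iff₀ (by positivity) (by norm_num)]
    nlinarith
  have h2 : c⁻¹ * ∫ z in K, gap p (cgrad (w n) z) (cgrad u z) ≤ ε / 4 := by
    rw [inv_mul_eq_div, div_le_iff₀ hc]
    linarith
  linarith

/-! ### Rigid motions -/

theorem flux_circle_smul (p : ℝ) (a : Circle) (w : ℂ) : flux p (a * w) = a * flux p w := by
  unfold flux
  rw [norm_mul, Circle.norm_coe, one_mul, mul_smul_comm]

theorem inner_circle_mul (a : Circle) (z w : ℂ) : ⟪(a : ℂ) * z, a * w⟫ = ⟪z, w⟫ :=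
  (rotation a).inner_map_map z w

/-- The rigid motion `z ↦ a * z + h`. -/
noncomputable def rigid (a : Circle) (h : ℂ) : ℂ ≃ₜ ℂ :=
  (rotation a).toHomeomorph.trans (Homeomorph.addRight h)

theorem rigid_apply (a : Circle) (h z : ℂ) : rigid a h z = a * z + h := rfl

theorem rigid_symm_apply (a : Circle) (h z : ℂ) : (rigid a h).symm z = (a⁻¹ : Circle) * (z - h) := by
  rw [Homeomorph.symm_apply_eq, rigid_apply, ← mul_assoc, ← Circle.coe_mul]
  simp

theorem contDiff_rigid (a : Circle) (h : ℂ) : ContDiff ℝ 1 (rigid a h) := by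
  have : (rigid a h : ℂ → ℂ) = fun z => a * z + h := rfl
  rw [this]
  fun_prop

theorem contDiff_rigid_symm (a : Circle) (h : ℂ) : ContDiff ℝ 1 (rigid a h).symm := by
  have : ((rigid a h).symm : ℂ → ℂ) = fun z => ((a⁻¹ : Circle) : ℂ) * (z - h) :=
    funext (rigid_symm_apply a h)
  rw [this]
  fun_prop

theorem integral_comp_rigid (a : Circle) (h : ℂ) (g : ℂ → ℝ) :
    ∫ z, g (rigid a h z) = ∫ z, g z := by
  have h1 : ∫ z, g (rigid a h z) = ∫ z, (fun z => g (z + h)) (rotation a z) := rfl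
  rw [h1]
  refine ((rotation a).measurePreserving.integral_comp
    (rotation a).toHomeomorph.measurableEmbedding fun z => g (z + h)).trans ?_
  exact integral_add_right_eq_self g h

theorem hasFDerivAt_rigid (a : Circle) (h z : ℂ) :
    HasFDerivAt (rigid a h) ((rotation a).toContinuousLinearEquiv : ℂ →L[ℝ] ℂ) z :=
  ((rotation a).toContinuousLinearEquiv.hasFDerivAt (x := z)).add_const h

theorem cgrad_comp_rigid {u : ℂ → ℝ} (hu : Differentiable ℝ u) (a : Circle) (h z : ℂ) :
    cgrad (fun z => u (rigid a h z)) z = (a⁻¹ : Circle) * cgrad u (rigid a h z) := by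
  refine eq_cgrad_of_forall_inner fun w => ?_
  have h1 : HasFDerivAt (fun z => u (rigid a h z)) _ z :=
    (hu (rigid a h z)).hasFDerivAt.comp z (hasFDerivAt_rigid a h z)
  rw [h1.fderiv]
  have h2 : ⟪((a⁻¹ : Circle) : ℂ) * cgrad u (rigid a h z), w⟫ =
      ⟪cgrad u (rigid a h z), a * w⟫ := by
    rw [← inner_circle_mul a, ← mul_assoc, ← Circle.coe_mul]
    simp
  rw [h2, ← fderiv_eq_inner_cgrad]
  rfl

theorem tsupport_comp_homeomorph {X Y : Type*} [TopologicalSpace X] [TopologicalSpace Y]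
    (φ : X ≃ₜ Y) (g : Y → ℝ) :
    tsupport (fun z => g (φ z)) = φ ⁻¹' tsupport g := by
  rw [tsupport, tsupport, φ.preimage_closure]
  rfl

theorem PH.comp_rigid {p : ℝ} {V : Set ℂ} {u : ℂ → ℝ} (hu : PH p V u) (a : Circle) (h : ℂ) :
    PH p (rigid a h ⁻¹' V) (fun z => u (rigid a h z)) := by
  refine ⟨hu.contDiff.comp (contDiff_rigid a h),
    hu.hasCompactSupport.comp_homeomorph (rigid a h), fun ψ h1 h2 h3 => ?_⟩
  set χ : ℂ → ℝ := fun z => ψ ((rigid a h).symm z) with hχ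
  have hχ1 : ContDiff ℝ 1 χ := h1.comp (contDiff_rigid_symm a h)
  have hχs : tsupport χ ⊆ V := by
    rw [hχ, tsupport_comp_homeomorph]
    intro z hz
    simpa using h3 hz
  have hw := hu.weak χ hχ1 (h2.comp_homeomorph (rigid a h).symm) hχs
  have hψ : ψ = fun z => χ (rigid a h z) := by
    funext z
    simp [hχ]
  rw [← integral_comp_rigid a h] at hw
  rw [← hw]
  congr 1
  funext z
  rw [hψ, cgrad_comp_rigid hu.differentiable, cgrad_comp_rigid (hχ1.differentiable (by norm_num)),
    flux_circle_smul, inner_circle_mul]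

theorem PH.neg {p : ℝ} {V : Set ℂ} {u : ℂ → ℝ} (hu : PH p V u) : PH p V (fun z => -u z) := by
  have hc : ∀ z, cgrad (fun z => -u z) z = -cgrad u z := fun z => by
    simp [cgrad, fderiv_fun_neg, Complex.ext_iff]
  refine ⟨hu.contDiff.neg, hu.hasCompactSupport.neg, fun ψ h1 h2 h3 => ?_⟩
  have hf : ∀ w, flux p (-w) = -flux p w := fun w => by simp [flux]
  simp only [hc, hf, inner_neg_left, integral_neg, hu.weak ψ h1 h2 h3, neg_zero]

/-! ### Difference quotients -/

theorem exists_integral_sq_sub_le {p : ℝ} (hp : 1 < p) {V : Set ℂ} (hV : IsOpen V) {u : ℂ → ℝ}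
    (hu : PH p V u) (hne : ∀ z ∈ V, cgrad u z ≠ 0) {K : Set ℂ} (hK : IsCompact K) (hKV : K ⊆ V) :
    ∃ C > 0, ∃ r > 0, ∀ h : ℂ, ‖h‖ < r →
      ∫ z in K, ‖cgrad u (z + h) - cgrad u z‖ ^ 2 ≤ C * ‖h‖ ^ 2 := by
  obtain ⟨η, hη, hηc, hηV, hη01, O', hO', hKO', hη1⟩ := exists_bump hK hV hKV
  have hηd : ContDiff ℝ 1 η := hη.of_le (by simp)
  have hf := hu.continuous_cgrad
  obtain ⟨M, hM0, hM⟩ := hu.exists_norm_cgrad_le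
  have hlip : ∀ x y : ℂ, |u x - u y| ≤ M * ‖x - y‖ := fun x y => by
    have := (convex_univ (𝕜 := ℝ) (E := ℂ)).norm_image_sub_le_of_norm_fderiv_le (f := u)
      (x := y) (y := x) (C := M) (fun z _ => hu.differentiable z)
      (fun z _ => ContinuousLinearMap.opNorm_le_bound _ hM0 fun w => by
        rw [fderiv_eq_inner_cgrad]
        exact (abs_real_inner_le_norm _ _).trans (by gcongr; exact hM z)) (mem_univ _) (mem_univ _)
    simpa using this
  obtain ⟨δ, hδ, c, hc, C, hC, hell⟩ := exists_flux_elliptic hp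
    (S := cgrad u '' tsupport η) (hηc.isCompact.image hf) (by
      rintro ⟨z, hz, h0⟩
      exact hne z (hηV hz) h0)
  have huc : UniformContinuous (cgrad u) :=
    hf.uniformContinuous_of_tendsto_cocompact
      (hasCompactSupport_cgrad hu.hasCompactSupport).is_zero_at_infty
  obtain ⟨r₁, hr₁, hr₁'⟩ := Metric.uniformContinuous_iff.1 huc δ hδ
  obtain ⟨r₂, hr₂, hr₂'⟩ := hηc.isCompact.exists_thickening_subset_open hV hηV
  set S := ∫ z, ‖cgrad η z‖ ^ 2 with hS
  have hS0 : 0 ≤ S := integral_nonneg fun z => by positivity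
  have hSint : Integrable fun z => ‖cgrad η z‖ ^ 2 :=
    integrable_of_tsupport ((continuous_cgrad hηd).norm.pow 2) hηc fun z hz => by
      rw [cgrad_eq_zero_of_notMem_tsupport hz]; simp
  refine ⟨(2 / c) * (2 * C ^ 2 / c * M ^ 2 * S) + 1, by positivity, min r₁ r₂, lt_min hr₁ hr₂,
    fun h hh => ?_⟩
  have hh₁ : ‖h‖ < r₁ := hh.trans_le (min_le_left _ _)
  have hh₂ : ‖h‖ < r₂ := hh.trans_le (min_le_right _ _)
  set v : ℂ → ℝ := fun z => u (rigid 1 h z) with hv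
  have hrig : ∀ z, rigid 1 h z = z + h := fun z => by simp [rigid_apply]
  have hvPH : PH p (rigid 1 h ⁻¹' V) v := hu.comp_rigid 1 h
  have hvg : ∀ z, cgrad v z = cgrad u (z + h) := fun z => by
    rw [hv, cgrad_comp_rigid hu.differentiable, hrig]; simp
  have hηV' : tsupport η ⊆ rigid 1 h ⁻¹' V := fun z hz => by
    rw [mem_preimage, hrig]
    refine hr₂' (Metric.mem_thickening_iff.2 ⟨z, hz, ?_⟩)
    simpa [dist_eq_norm] using hh₂
  set ψ : ℂ → ℝ := fun z => η z ^ (1 + 1) * (v z - u z) with hψ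
  have hψ1 : ContDiff ℝ 1 ψ := (hηd.pow _).mul (hvPH.contDiff.sub hu.contDiff)
  have hψs : tsupport ψ ⊆ tsupport η := by
    refine closure_minimal (fun z hz => ?_) (isClosed_tsupport _)
    by_contra h
    exact hz (by simp [hψ, image_eq_zero_of_notMem_tsupport h])
  have hψc : HasCompactSupport ψ := HasCompactSupport.of_support_subset_isCompact hηc
    ((subset_tsupport _).trans hψs)
  have e1 := hvPH.weak ψ hψ1 hψc (hψs.trans hηV')
  have e2 := hu.weak ψ hψ1 hψc (hψs.trans hηV)
  have hgψ : ∀ z, cgrad ψ z = η z ^ 2 • (cgrad v z - cgrad u z) +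
      (v z - u z) • (2 * η z) • cgrad η z := fun z => by
    have hd : DifferentiableAt ℝ η z := hηd.differentiable (by norm_num) z
    rw [hψ, cgrad_mul (hd.fun_pow _) ((hvPH.differentiable z).fun_sub (hu.differentiable z)),
      cgrad_sub (hvPH.differentiable z) (hu.differentiable z), cgrad_pow hd]
    norm_num
  have i1 := integrable_inner_flux_cgrad hp hvPH.contDiff hψ1 hψc
  have i2 := integrable_inner_flux_cgrad hp hu.contDiff hψ1 hψc
  have hdint : Integrable fun z =>
      ⟪flux p (cgrad v z), cgrad ψ z⟫ - ⟪flux p (cgrad u z), cgrad ψ z⟫ := i1.sub i2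
  have e3 : ∫ z, (⟪flux p (cgrad v z), cgrad ψ z⟫ - ⟪flux p (cgrad u z), cgrad ψ z⟫) = 0 := by
    rw [integral_sub i1 i2, e1, e2, sub_zero]
  have hInt : Integrable fun z => η z ^ 2 * ‖cgrad v z - cgrad u z‖ ^ 2 :=
    integrable_of_tsupport ((hη.continuous.pow 2).mul
      ((hvPH.continuous_cgrad.sub hf).norm.pow 2)) hηc fun z hz => by
        rw [image_eq_zero_of_notMem_tsupport hz]; simp
  have hle : ∫ z, (c / 2) * (η z ^ 2 * ‖cgrad v z - cgrad u z‖ ^ 2) ≤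
      ∫ z, ((⟪flux p (cgrad v z), cgrad ψ z⟫ - ⟪flux p (cgrad u z), cgrad ψ z⟫) +
        (2 * C ^ 2 / c * M ^ 2 * ‖h‖ ^ 2) * ‖cgrad η z‖ ^ 2) := by
    refine integral_mono (hInt.const_mul _) (hdint.add (hSint.const_mul _)) fun z => ?_
    simp only
    by_cases hz : z ∈ tsupport η
    · obtain ⟨h1, h2⟩ := hell (cgrad u z) (mem_image_of_mem _ hz) (cgrad v z) (by
        rw [hvg, ← dist_eq_norm]
        exact hr₁' (by simpa [dist_eq_norm] using hh₁))
      rw [← inner_sub_left, hgψ z, inner_add_right, real_inner_smul_right, real_inner_smul_right,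
        real_inner_smul_right]
      have h3 := neg_le_of_abs_le
        (abs_real_inner_le_norm (flux p (cgrad v z) - flux p (cgrad u z)) (cgrad η z))
      have h4 : |v z - u z| ≤ M * ‖h‖ := by
        have := hlip (z + h) z
        simpa [hv, hrig] using this
      have h5 : |⟪flux p (cgrad v z) - flux p (cgrad u z), cgrad η z⟫| ≤
          C * ‖cgrad v z - cgrad u z‖ * ‖cgrad η z‖ :=
        (abs_real_inner_le_norm _ _).trans (by gcongr)
      have h6 : |(v z - u z) * (2 * η z * ⟪flux p (cgrad v z) - flux p (cgrad u z), cgrad η z⟫)| ≤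
          M * ‖h‖ * (2 * η z * (C * ‖cgrad v z - cgrad u z‖ * ‖cgrad η z‖)) := by
        have := (hη01 z).1
        rw [abs_mul, abs_mul, abs_of_nonneg (by positivity : 0 ≤ 2 * η z)]
        gcongr
      have h7 := neg_le_of_abs_le h6
      have h8 := mul_le_mul_of_nonneg_left h1 (sq_nonneg (η z))
      rw [gap] at h8
      have h9 : M * ‖h‖ * (2 * η z * (C * ‖cgrad v z - cgrad u z‖ * ‖cgrad η z‖)) ≤
          (c / 2) * (η z ^ 2 * ‖cgrad v z - cgrad u z‖ ^ 2) +
          (2 * C ^ 2 / c * M ^ 2 * ‖h‖ ^ 2) * ‖cgrad η z‖ ^ 2 := by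
        have := sq_nonneg (c * (η z * ‖cgrad v z - cgrad u z‖) - 2 * C * M * ‖h‖ * ‖cgrad η z‖)
        rw [← mul_le_mul_iff_right₀ (by positivity : 0 < 2 * c)]
        field_simp
        nlinarith
      linarith
    · rw [hgψ, image_eq_zero_of_notMem_tsupport hz, cgrad_eq_zero_of_notMem_tsupport hz]
      simp
  rw [integral_add hdint (hSint.const_mul _), e3, integral_const_mul, integral_const_mul, zero_add,
    ← hS] at hle
  have hKle : ∫ z in K, ‖cgrad u (z + h) - cgrad u z‖ ^ 2 ≤
      ∫ z, η z ^ 2 * ‖cgrad v z - cgrad u z‖ ^ 2 := by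
    have : ∫ z in K, ‖cgrad u (z + h) - cgrad u z‖ ^ 2 =
        ∫ z in K, η z ^ 2 * ‖cgrad v z - cgrad u z‖ ^ 2 :=
      setIntegral_congr_fun hK.measurableSet fun z hz => by simp [hη1 z (hKO' hz), hvg]
    rw [this]
    exact setIntegral_le_integral hInt (Eventually.of_forall fun z => by positivity)
  refine hKle.trans ?_
  rw [← mul_le_mul_iff_right₀ (by positivity : 0 < c / 2)]
  refine hle.trans ?_
  have : (c / 2) * ((2 / c * (2 * C ^ 2 / c * M ^ 2 * S) + 1) * ‖h‖ ^ 2) =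
      2 * C ^ 2 / c * M ^ 2 * ‖h‖ ^ 2 * S + c / 2 * ‖h‖ ^ 2 := by
    field_simp
  rw [this]
  have : 0 ≤ c / 2 * ‖h‖ ^ 2 := by positivity
  linarith

/-! ### Mollification -/

theorem fderiv_fderiv_comm {F : Type*} [NormedAddCommGroup F] [NormedSpace ℝ F] {f : ℂ → F} {z : ℂ}
    (hf : ContDiffAt ℝ 2 f z) (v w : ℂ) :
    fderiv ℝ (fun y => fderiv ℝ f y v) z w = fderiv ℝ (fun y => fderiv ℝ f y w) z v := by
  have hd : DifferentiableAt ℝ (fderiv ℝ f) z :=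
    (hf.fderiv_right (m := 1) (by norm_num)).differentiableAt (by norm_num)
  have hs : IsSymmSndFDerivAt ℝ f z := hf.isSymmSndFDerivAt (by simp)
  have key : ∀ v w : ℂ, fderiv ℝ (fun y => fderiv ℝ f y v) z w = fderiv ℝ (fderiv ℝ f) z w v := by
    intro v w
    rw [fderiv_clm_apply hd (differentiableAt_const v)]
    simp
  rw [key, key]
  exact hs w v

/-- The convolution of a real kernel with a complex-valued function. -/
noncomputable def moll (ρ : ℂ → ℝ) (f : ℂ → ℂ) (x : ℂ) : ℂ := ∫ t, ρ t • f (x - t)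

theorem contDiff_moll {ρ : ℂ → ℝ} {f : ℂ → ℂ} (hρ : ContDiff ℝ ∞ ρ) (hρc : HasCompactSupport ρ)
    (hf : Continuous f) : ContDiff ℝ ∞ (moll ρ f) :=
  hρc.contDiff_convolution_left (μ := volume) (ContinuousLinearMap.lsmul ℝ ℝ) hρ
    hf.locallyIntegrable

theorem integrable_smul_comp_sub {k : ℂ → ℝ} {f : ℂ → ℂ} (hk : Continuous k)
    (hkc : HasCompactSupport k) (hf : Continuous f) (x : ℂ) :
    Integrable fun t => k t • f (x - t) := by
  refine Continuous.integrable_of_hasCompactSupport (by fun_prop) ?_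
  exact hkc.smul_right

theorem fderiv_moll {ρ : ℂ → ℝ} {f : ℂ → ℂ} (hρ : ContDiff ℝ ∞ ρ) (hρc : HasCompactSupport ρ)
    (hf : Continuous f) (x v : ℂ) :
    fderiv ℝ (moll ρ f) x v = ∫ t, fderiv ℝ ρ t v • f (x - t) := by
  have hρ1 : ContDiff ℝ 1 ρ := hρ.of_le (by simp)
  have h := hρc.hasFDerivAt_convolution_left (μ := volume)
    (ContinuousLinearMap.lsmul ℝ ℝ : ℝ →L[ℝ] ℂ →L[ℝ] ℂ) hρ1 hf.locallyIntegrable x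
  have hi : Integrable fun t => ((ContinuousLinearMap.lsmul ℝ ℝ : ℝ →L[ℝ] ℂ →L[ℝ] ℂ).precompL ℂ)
      (fderiv ℝ ρ t) (f (x - t)) := by
    refine Continuous.integrable_of_hasCompactSupport ?_ ?_
    · have := hρ1.continuous_fderiv (by norm_num)
      exact (((ContinuousLinearMap.lsmul ℝ ℝ : ℝ →L[ℝ] ℂ →L[ℝ] ℂ).precompL ℂ).continuous.comp
        this).clm_apply (by fun_prop)
    · refine HasCompactSupport.of_support_subset_isCompact (hρc.fderiv ℝ).isCompact fun t ht => ?_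
      by_contra h0
      exact ht (by simp [image_eq_zero_of_notMem_tsupport h0])
  have h' : fderiv ℝ (moll ρ f) x = ∫ t, ((ContinuousLinearMap.lsmul ℝ ℝ :
      ℝ →L[ℝ] ℂ →L[ℝ] ℂ).precompL ℂ) (fderiv ℝ ρ t) (f (x - t)) := h.fderiv
  rw [h', ContinuousLinearMap.integral_apply hi]
  simp only [ContinuousLinearMap.precompL_apply, ContinuousLinearMap.lsmul_apply]

theorem integral_smul_comp_sub_sub {k : ℂ → ℝ} {f : ℂ → ℂ} (hk : Continuous k)
    (hkc : HasCompactSupport k) (hf : Continuous f) (x c : ℂ) :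
    ∫ t, k t • (f (x - t) - c) = (∫ t, k t • f (x - t)) - (∫ t, k t) • c := by
  simp_rw [smul_sub]
  rw [integral_sub (integrable_smul_comp_sub hk hkc hf x)
    (integrable_smul_comp_sub hk hkc continuous_const x), integral_smul_const]

theorem moll_sub_eq {ρ : ℂ → ℝ} {f : ℂ → ℂ} (hρ : ContDiff ℝ ∞ ρ) (hρc : HasCompactSupport ρ)
    (hf : Continuous f) (h1 : ∫ t, ρ t = 1) (x c : ℂ) :
    moll ρ f x - c = ∫ t, ρ t • (f (x - t) - c) := by
  rw [integral_smul_comp_sub_sub hρ.continuous hρc hf, h1, one_smul, moll]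

theorem fderiv_moll_eq {ρ : ℂ → ℝ} {f : ℂ → ℂ} (hρ : ContDiff ℝ ∞ ρ) (hρc : HasCompactSupport ρ)
    (hf : Continuous f) (x v c : ℂ) :
    fderiv ℝ (moll ρ f) x v = ∫ t, fderiv ℝ ρ t v • (f (x - t) - c) := by
  have hρ1 : ContDiff ℝ 1 ρ := hρ.of_le (by simp)
  rw [integral_smul_comp_sub_sub (continuous_fderiv_apply_of_contDiff hρ1 v)
    (hasCompactSupport_fderiv_apply hρc v) hf, integral_fderiv_eq_zero hρ1 hρc, zero_smul, sub_zero,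
    fderiv_moll hρ hρc hf]

/-- Mollified gradients are curl-free. -/
theorem fderiv_moll_cgrad_symm {ρ u : ℂ → ℝ} (hρ : ContDiff ℝ ∞ ρ) (hρc : HasCompactSupport ρ)
    (hu : ContDiff ℝ 1 u) (huc : HasCompactSupport u) (x : ℂ) :
    (fderiv ℝ (moll ρ (cgrad u)) x 1).im = (fderiv ℝ (moll ρ (cgrad u)) x Complex.I).re := by
  have hf := continuous_cgrad hu
  have hρ1 : ContDiff ℝ 1 ρ := hρ.of_le (by simp)
  have hρ2 : ContDiff ℝ 2 ρ := hρ.of_le (by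
    have : ((2 : ℕ∞) : WithTop ℕ∞) ≤ ((⊤ : ℕ∞) : WithTop ℕ∞) := by exact_mod_cast le_top
    simpa using this)
  have hi : ∀ v, Integrable fun t => fderiv ℝ ρ t v • cgrad u (x - t) := fun v =>
    integrable_smul_comp_sub (continuous_fderiv_apply_of_contDiff hρ1 v)
      (hasCompactSupport_fderiv_apply hρc v) hf x
  rw [fderiv_moll hρ hρc hf, fderiv_moll hρ hρc hf]
  have e1 : (∫ t, fderiv ℝ ρ t 1 • cgrad u (x - t)).im =
      ∫ t, (fderiv ℝ ρ t 1 • cgrad u (x - t)).im := (integral_im (hi 1)).symm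
  have e2 : (∫ t, fderiv ℝ ρ t Complex.I • cgrad u (x - t)).re =
      ∫ t, (fderiv ℝ ρ t Complex.I • cgrad u (x - t)).re := (integral_re (hi Complex.I)).symm
  have i1 : Integrable fun t => (fderiv ℝ ρ t 1 • cgrad u (x - t)).im := (hi 1).im
  have i2 : Integrable fun t => (fderiv ℝ ρ t Complex.I • cgrad u (x - t)).re := (hi Complex.I).re
  rw [e1, e2, ← sub_eq_zero, ← integral_sub i1 i2]
  have hC1 : ∀ v, ContDiffOn ℝ 1 (fun t => fderiv ℝ ρ t v) univ := fun v =>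
    ((hρ2.fderiv_right (m := 1) (by norm_num)).clm_apply contDiff_const).contDiffOn
  have hψ : ContDiff ℝ 1 fun t => u (x - t) := hu.comp (contDiff_const.sub contDiff_id)
  have hψc : HasCompactSupport fun t => u (x - t) := huc.comp_homeomorph (Homeomorph.subLeft x)
  have := integral_wedge_eq_zero isOpen_univ (hC1 1) (hC1 Complex.I)
    (fun z _ => fderiv_fderiv_comm hρ2.contDiffAt _ _) hψ hψc (subset_univ _)
  rw [← this]
  congr 1
  funext t
  have hd : ∀ v, fderiv ℝ (fun t => u (x - t)) t v = - fderiv ℝ u (x - t) v := fun v => by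
    have h1 : HasFDerivAt (fun t => u (x - t)) _ t :=
      ((hu.differentiable (by norm_num) (x - t)).hasFDerivAt).comp t
        ((hasFDerivAt_id t).const_sub x)
    rw [h1.fderiv]
    simp
  rw [hd, hd]
  simp [cgrad]
  ring

theorem sq_integral_mul_le {k q : ℂ → ℝ} {T : Set ℂ} {κ : ℝ} (hκ : 0 < κ)
    (hk : IntegrableOn (fun t => k t) T) (hk0 : ∀ t, 0 ≤ k t)
    (hkq : IntegrableOn (fun t => k t * q t) T) (hkq2 : IntegrableOn (fun t => k t * q t ^ 2) T)
    (hle : ∫ t in T, k t ≤ κ) :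
    (∫ t in T, k t * q t) ^ 2 ≤ κ * ∫ t in T, k t * q t ^ 2 := by
  set m := ∫ t in T, k t * q t with hm
  have h : ∫ t in T, (2 * (m / κ)) * (k t * q t) ≤
      ∫ t in T, ((m / κ) ^ 2 * k t + k t * q t ^ 2) := by
    refine integral_mono (hkq.const_mul _) ((hk.const_mul _).add hkq2) fun t => ?_
    have := mul_nonneg (hk0 t) (sq_nonneg (m / κ - q t))
    simp only
    nlinarith
  rw [integral_add (hk.const_mul _) hkq2, integral_const_mul, integral_const_mul, ← hm] at h
  have h2 : (m / κ) ^ 2 * ∫ t in T, k t ≤ (m / κ) ^ 2 * κ := by gcongr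
  have h3 : (m / κ) ^ 2 * κ = m ^ 2 / κ := by field_simp
  have h4 : 2 * (m / κ) * m = 2 * (m ^ 2 / κ) := by ring
  have h5 : m ^ 2 / κ ≤ ∫ t in T, k t * q t ^ 2 := by linarith
  rwa [div_le_iff₀' hκ] at h5

/-- A Minkowski-type bound for averaging in a parameter. -/
theorem integral_sq_integral_mul_le {k : ℂ → ℝ} {q : ℂ → ℂ → ℝ} {K T : Set ℂ} {κ B : ℝ}
    (hκ : 0 < κ) (hB : 0 ≤ B) (hK : IsCompact K) (hT : IsCompact T)
    (hk : Continuous k) (hk0 : ∀ t, 0 ≤ k t) (hq : Continuous (Function.uncurry q))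
    (hle : ∫ t in T, k t ≤ κ) (hqB : ∀ t ∈ T, ∫ x in K, q x t ^ 2 ≤ B) :
    ∫ x in K, (∫ t in T, k t * q x t) ^ 2 ≤ κ ^ 2 * B := by
  have hqx : ∀ x, Continuous (q x) := fun x => hq.comp (Continuous.prodMk_right x)
  have hqt : ∀ t, Continuous fun x => q x t := fun t => hq.comp (Continuous.prodMk_left t)
  have c1 : Continuous (Function.uncurry fun x t => k t * q x t) :=
    (hk.comp continuous_snd).mul hq
  have c2 : Continuous (Function.uncurry fun x t => k t * q x t ^ 2) :=
    (hk.comp continuous_snd).mul (hq.pow 2)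
  have i1 : IntegrableOn (fun x => (∫ t in T, k t * q x t) ^ 2) K :=
    ((continuous_parametric_integral_of_continuous c1 hT).pow 2).continuousOn.integrableOn_compact hK
  have i2 : IntegrableOn (fun x => κ * ∫ t in T, k t * q x t ^ 2) K :=
    (continuous_const.mul
      (continuous_parametric_integral_of_continuous c2 hT)).continuousOn.integrableOn_compact hK
  have s1 : ∫ x in K, (∫ t in T, k t * q x t) ^ 2 ≤ ∫ x in K, κ * ∫ t in T, k t * q x t ^ 2 := by
    refine integral_mono i1 i2 fun x => ?_
    exact sq_integral_mul_le hκ (hk.continuousOn.integrableOn_compact hT) hk0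
      ((hk.mul (hqx x)).continuousOn.integrableOn_compact hT)
      ((hk.mul ((hqx x).pow 2)).continuousOn.integrableOn_compact hT) hle
  have hprod : Integrable (Function.uncurry fun x t => k t * q x t ^ 2)
      ((volume.restrict K).prod (volume.restrict T)) := by
    rw [Measure.prod_restrict]
    exact c2.continuousOn.integrableOn_compact (hK.prod hT)
  rw [integral_const_mul, integral_integral_swap hprod] at s1
  have s2 : ∫ t in T, ∫ x in K, k t * q x t ^ 2 ≤ ∫ t in T, B * k t := by
    have c3 : Continuous (Function.uncurry fun t x => k t * q x t ^ 2) :=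
      (hk.comp continuous_fst).mul ((hq.comp continuous_swap).pow 2)
    refine setIntegral_mono_on
      ((continuous_parametric_integral_of_continuous c3 hK).continuousOn.integrableOn_compact hT)
      ((continuous_const.mul hk).continuousOn.integrableOn_compact hT) hT.measurableSet
      fun t ht => ?_
    rw [integral_const_mul, mul_comm]
    exact mul_le_mul_of_nonneg_right (hqB t ht) (hk0 t)
  rw [integral_const_mul] at s2
  have s3 : B * ∫ t in T, k t ≤ B * κ := by gcongr
  calc _ ≤ κ * ∫ t in T, ∫ x in K, k t * q x t ^ 2 := s1
    _ ≤ κ * (B * κ) := by gcongr; linarith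
    _ = κ ^ 2 * B := by ring

/-- Smooth mollifiers at scale `ε`. -/
theorem exists_mollifier : ∃ κ > 0, ∀ ε > 0, ∃ ρ : ℂ → ℝ, ContDiff ℝ ∞ ρ ∧
    tsupport ρ ⊆ Metric.closedBall 0 ε ∧ (∀ t, 0 ≤ ρ t) ∧ ∫ t, ρ t = 1 ∧
    ∫ t, ‖cgrad ρ t‖ ≤ κ / ε := by
  set φ : ContDiffBump (0 : ℂ) := ⟨1 / 2, 1, by norm_num, by norm_num⟩ with hφ
  set ρ₀ := φ.normed volume with hρ₀
  have hρ₀s : ContDiff ℝ ∞ ρ₀ := φ.contDiff_normed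
  have hρ₀1 : ContDiff ℝ 1 ρ₀ := hρ₀s.of_le (by simp)
  refine ⟨(∫ t, ‖cgrad ρ₀ t‖) + 1,
    by have : 0 ≤ ∫ t, ‖cgrad ρ₀ t‖ := integral_nonneg fun t => norm_nonneg _
       linarith, fun ε hε => ?_⟩
  have hscale : ∀ g : ℂ → ℝ, ∫ t, (ε⁻¹) ^ 2 * g (ε⁻¹ • t) = ∫ t, g t := fun g => by
    rw [integral_const_mul, Measure.integral_comp_smul, Complex.finrank_real_complex,
      abs_of_nonneg (by positivity), smul_eq_mul, ← mul_assoc, mul_inv_cancel₀ (by positivity),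
      one_mul]
  have hgrad : ∀ t, cgrad (fun t => (ε⁻¹) ^ 2 * ρ₀ (ε⁻¹ • t)) t =
      (ε⁻¹) ^ 2 • ε⁻¹ • cgrad ρ₀ (ε⁻¹ • t) := fun t => by
    refine eq_cgrad_of_forall_inner fun w => ?_
    have h1 : HasFDerivAt (fun t : ℂ => ρ₀ (ε⁻¹ • t)) _ t :=
      ((hρ₀1.differentiable (by norm_num) (ε⁻¹ • t)).hasFDerivAt).comp t
        ((hasFDerivAt_id t).const_smul ε⁻¹)
    rw [(h1.const_mul ((ε⁻¹) ^ 2)).fderiv, real_inner_smul_left, real_inner_smul_left,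
      ← fderiv_eq_inner_cgrad]
    simp
  refine ⟨fun t => (ε⁻¹) ^ 2 * ρ₀ (ε⁻¹ • t), ?_, ?_, ?_, ?_, ?_⟩
  · exact contDiff_const.mul (hρ₀s.comp (contDiff_const_smul _))
  · refine closure_minimal (fun t ht => ?_) Metric.isClosed_closedBall
    have h1 : ρ₀ (ε⁻¹ • t) ≠ 0 := fun h => ht (by simp only [h, mul_zero])
    have h2 := subset_tsupport _ h1
    rw [hρ₀, φ.tsupport_normed_eq] at h2
    simp only [mem_closedBall_zero_iff, norm_smul, norm_inv, Real.norm_of_nonneg hε.le, hφ] at h2 ⊢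
    rwa [inv_mul_le_iff₀ hε, mul_one] at h2
  · exact fun t => mul_nonneg (by positivity) (φ.nonneg_normed _)
  · rw [hscale, hρ₀, φ.integral_normed]
  · have : ∀ t, ‖cgrad (fun t => (ε⁻¹) ^ 2 * ρ₀ (ε⁻¹ • t)) t‖ =
        ε⁻¹ * ((ε⁻¹) ^ 2 * ‖cgrad ρ₀ (ε⁻¹ • t)‖) := fun t => by
      rw [hgrad, norm_smul, norm_smul, Real.norm_of_nonneg (by positivity),
        Real.norm_of_nonneg (by positivity)]
      ring
    simp_rw [this]
    rw [integral_const_mul, hscale fun t => ‖cgrad ρ₀ t‖, div_eq_inv_mul]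
    gcongr
    linarith

/-! ### Smooth approximation of the gradient of a `p`-harmonic function -/

/-- The linearized operator applied to the pair of partial derivatives of a vector field. -/
noncomputable def divLin (p : ℝ) (b y₁ y₂ : ℂ) : ℝ := (linFlux p b y₁).re + (linFlux p b y₂).im

theorem setIntegral_mono_of_nonneg {K : Set ℂ} (hK : MeasurableSet K) {F G : ℂ → ℝ}
    (h0 : ∀ z ∈ K, 0 ≤ F z) (hG : IntegrableOn G K) (h : ∀ z ∈ K, F z ≤ G z) :
    ∫ z in K, F z ≤ ∫ z in K, G z :=
  integral_mono_of_nonneg (ae_restrict_of_forall_mem hK h0) hG (ae_restrict_of_forall_mem hK h)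

theorem norm_integral_smul_le {k : ℂ → ℝ} {T : Set ℂ} (hT : IsCompact T) {F : ℂ → ℂ} {w : ℂ → ℝ}
    (hw : Continuous w) (hF : Continuous F) (hle : ∀ t, |k t| ≤ w t) (h0 : ∀ t, t ∉ T → k t = 0) :
    ‖∫ t, k t • F t‖ ≤ ∫ t in T, w t * ‖F t‖ := by
  rw [← setIntegral_eq_integral_of_forall_compl_eq_zero (s := T) fun t ht => by simp [h0 t ht]]
  refine (norm_integral_le_integral_norm _).trans ?_
  refine setIntegral_mono_of_nonneg hT.measurableSet (fun t _ => norm_nonneg _)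
    ((hw.mul hF.norm).continuousOn.integrableOn_compact hT) fun t _ => ?_
  rw [norm_smul]
  exact mul_le_mul_of_nonneg_right (hle t) (norm_nonneg _)

theorem abs_fderiv_one_le (ρ : ℂ → ℝ) (t : ℂ) : |fderiv ℝ ρ t 1| ≤ ‖cgrad ρ t‖ :=
  Complex.abs_re_le_norm (cgrad ρ t)

theorem abs_fderiv_I_le (ρ : ℂ → ℝ) (t : ℂ) : |fderiv ℝ ρ t Complex.I| ≤ ‖cgrad ρ t‖ :=
  Complex.abs_im_le_norm (cgrad ρ t)

/-- The equation satisfied by the mollified gradient, up to a Taylor remainder. -/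
theorem PH.divLin_moll_eq {p : ℝ} (hp : 1 < p) {V : Set ℂ} {u : ℂ → ℝ} (hu : PH p V u)
    {ρ : ℂ → ℝ} (hρ : ContDiff ℝ ∞ ρ) (hρc : HasCompactSupport ρ) {x b : ℂ}
    (hx : ∀ t ∈ tsupport ρ, x - t ∈ V) (hb : b ≠ 0) :
    ‖b‖ ^ (p - 2) * divLin p b (fderiv ℝ (moll ρ (cgrad u)) x 1)
      (fderiv ℝ (moll ρ (cgrad u)) x Complex.I) =
    -∫ t, ⟪flux p (cgrad u (x - t)) - flux p b -
      fderiv ℝ (flux p) b (cgrad u (x - t) - b), cgrad ρ t⟫ := by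
  have hρ1 : ContDiff ℝ 1 ρ := hρ.of_le (by simp)
  have hf := hu.continuous_cgrad
  have hcρ := PHarmonic.continuous_cgrad hρ1
  have hA := continuous_flux hp
  obtain ⟨D, hD⟩ : ∃ D, D = fderiv ℝ (flux p) b := ⟨_, rfl⟩
  rw [← hD]
  have cs : ∀ G : ℂ → ℂ, Continuous G → Integrable fun t => ⟪G t, cgrad ρ t⟫ := fun G hG =>
    integrable_of_tsupport (hG.inner hcρ) hρc fun t ht => by
      rw [cgrad_eq_zero_of_notMem_tsupport ht, inner_zero_right]
  have i1 : ∫ t, ⟪flux p (cgrad u (x - t)), cgrad ρ t⟫ = 0 := by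
    have hψ : ContDiff ℝ 1 fun y => ρ (x - y) := hρ1.comp (contDiff_const.sub contDiff_id)
    have hs : tsupport (fun y => ρ (x - y)) ⊆ V := by
      rw [show (fun y => ρ (x - y)) = fun y => ρ (Homeomorph.subLeft x y) from rfl,
        tsupport_comp_homeomorph]
      intro y hy
      simpa using hx _ hy
    have h := hu.weak _ hψ (hρc.comp_homeomorph (Homeomorph.subLeft x)) hs
    have hg : ∀ y, cgrad (fun y => ρ (x - y)) y = - cgrad ρ (x - y) := fun y => by
      refine eq_cgrad_of_forall_inner fun w => ?_
      have h1 : HasFDerivAt (fun y => ρ (x - y)) _ y :=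
        ((hρ1.differentiable (by norm_num) (x - y)).hasFDerivAt).comp y
          ((hasFDerivAt_id y).const_sub x)
      rw [h1.fderiv, inner_neg_left, ← fderiv_eq_inner_cgrad]
      simp
    simp_rw [hg, inner_neg_right] at h
    rw [integral_neg, neg_eq_zero] at h
    rw [← h, ← integral_sub_left_eq_self _ volume x]
    simp
  have i2 : ∫ t, ⟪flux p b, cgrad ρ t⟫ = 0 := by
    simp_rw [real_inner_eq]
    rw [integral_add, integral_const_mul, integral_const_mul]
    · have h1 := integral_fderiv_eq_zero hρ1 hρc 1
      have h2 := integral_fderiv_eq_zero hρ1 hρc Complex.I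
      simp only [cgrad, h1, h2]
      simp
    · exact (((continuous_fderiv_apply_of_contDiff hρ1 1).integrable_of_hasCompactSupport
        (hasCompactSupport_fderiv_apply hρc 1))).const_mul _
    · exact (((continuous_fderiv_apply_of_contDiff hρ1
        Complex.I).integrable_of_hasCompactSupport
        (hasCompactSupport_fderiv_apply hρc Complex.I))).const_mul _
  have j : ∀ v, Integrable fun t => fderiv ℝ ρ t v • (cgrad u (x - t) - b) := fun v =>
    integrable_smul_comp_sub (f := fun y => cgrad u y - b)
      (continuous_fderiv_apply_of_contDiff hρ1 v) (hasCompactSupport_fderiv_apply hρc v)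
      (hf.sub continuous_const) x
  have i3 : ∫ t, ⟪D (cgrad u (x - t) - b), cgrad ρ t⟫ =
      (D (fderiv ℝ (moll ρ (cgrad u)) x 1)).re +
      (D (fderiv ℝ (moll ρ (cgrad u)) x Complex.I)).im := by
    rw [fderiv_moll_eq hρ hρc hf x 1 b, fderiv_moll_eq hρ hρc hf x Complex.I b]
    have e1 := (Complex.reCLM.comp D).integral_comp_comm (j 1)
    have e2 := (Complex.imCLM.comp D).integral_comp_comm (j Complex.I)
    simp only [ContinuousLinearMap.comp_apply, Complex.reCLM_apply, Complex.imCLM_apply] at e1 e2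
    have j1 : Integrable fun t => (D (fderiv ℝ ρ t 1 • (cgrad u (x - t) - b))).re :=
      (Complex.reCLM.comp D).integrable_comp (j 1)
    have j2 : Integrable fun t => (D (fderiv ℝ ρ t Complex.I • (cgrad u (x - t) - b))).im :=
      (Complex.imCLM.comp D).integrable_comp (j Complex.I)
    rw [← e1, ← e2, ← integral_add j1 j2]
    congr 1
    funext t
    rw [real_inner_eq, map_smul, map_smul]
    simp [cgrad, mul_comm]
  have hlhs : ‖b‖ ^ (p - 2) * divLin p b (fderiv ℝ (moll ρ (cgrad u)) x 1)
      (fderiv ℝ (moll ρ (cgrad u)) x Complex.I) =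
      (D (fderiv ℝ (moll ρ (cgrad u)) x 1)).re +
      (D (fderiv ℝ (moll ρ (cgrad u)) x Complex.I)).im := by
    rw [hD, fderiv_flux_apply p hb, fderiv_flux_apply p hb, divLin]
    simp
    ring
  rw [hlhs, ← i3]
  simp_rw [fun t => inner_sub_left (𝕜 := ℝ) (flux p (cgrad u (x - t)) - flux p b)
    (D (cgrad u (x - t) - b)) (cgrad ρ t),
    fun t => inner_sub_left (𝕜 := ℝ) (flux p (cgrad u (x - t))) (flux p b) (cgrad ρ t)]
  rw [integral_sub, integral_sub, i1, i2]
  · simp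
  · exact cs _ (hA.comp (hf.comp (continuous_const.sub continuous_id)))
  · exact cs _ continuous_const
  · exact (cs _ (hA.comp (hf.comp (continuous_const.sub continuous_id)))).sub (cs _ continuous_const)
  · exact cs _ (D.continuous.comp ((hf.comp (continuous_const.sub continuous_id)).sub continuous_const))

theorem exists_smooth_approx {p : ℝ} (hp : 1 < p) {V : Set ℂ} (hV : IsOpen V) {u : ℂ → ℝ}
    (hu : PH p V u) (hne : ∀ z ∈ V, cgrad u z ≠ 0) {K : Set ℂ} (hK : IsCompact K) (hKV : K ⊆ V) :
    ∃ C > 0, ∀ ε > 0, ∃ g : ℂ → ℂ, ContDiff ℝ 2 g ∧ (∀ z ∈ K, ‖g z - cgrad u z‖ ≤ ε) ∧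
      (∀ z, (fderiv ℝ g z 1).im = (fderiv ℝ g z Complex.I).re) ∧
      ∫ z in K, (‖fderiv ℝ g z 1‖ ^ 2 + ‖fderiv ℝ g z Complex.I‖ ^ 2) ≤ C ∧
      ∫ z in K, divLin p (g z) (fderiv ℝ g z 1) (fderiv ℝ g z Complex.I) ^ 2 ≤ ε := by
  have hf := hu.continuous_cgrad
  obtain ⟨f, hfdef⟩ : ∃ f, f = cgrad u := ⟨_, rfl⟩
  obtain ⟨C₀, hC₀, r₀, hr₀, hdq⟩ := exists_integral_sq_sub_le hp hV hu hne hK hKV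
  obtain ⟨κ, hκ, hmol⟩ := exists_mollifier
  obtain ⟨r₁, hr₁, hS⟩ := (hK.image hf).exists_cthickening_subset_open
    (isOpen_compl_singleton (x := (0 : ℂ))) (by
      rintro _ ⟨z, hz, rfl⟩
      exact hne z (hKV hz))
  have hScomp : IsCompact (Metric.cthickening r₁ (cgrad u '' K)) :=
    (hK.image hf).cthickening
  set S := Metric.cthickening r₁ (cgrad u '' K) with hSdef
  have hS0 : ∀ b ∈ S, b ≠ 0 := fun b hb => hS hb
  obtain ⟨m, hm, hmle⟩ : ∃ m > 0, ∀ b ∈ S, m ≤ ‖b‖ ^ (p - 2) := by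
    have hcont : ContinuousOn (fun b : ℂ => ‖b‖ ^ (p - 2)) S := fun b hb =>
      (continuous_norm.continuousAt.rpow_const
        (Or.inl (norm_ne_zero_iff.2 (hS0 b hb)))).continuousWithinAt
    obtain ⟨m, hm, h⟩ := hScomp.exists_forall_le' hcont (a := 0)
      (fun b hb => by have := norm_pos_iff.2 (hS0 b hb); positivity)
    exact ⟨m, hm, h⟩
  rw [← hfdef] at hf hdq hSdef
  refine ⟨2 * (κ ^ 2 * C₀), by positivity, fun ε hε => ?_⟩
  obtain ⟨θ, hθ, hθ2⟩ : ∃ θ > 0, θ ^ 2 * (4 * κ ^ 2 * C₀) ≤ m ^ 2 * ε := by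
    refine ⟨√(m ^ 2 * ε / (4 * κ ^ 2 * C₀)), by positivity, le_of_eq ?_⟩
    rw [Real.sq_sqrt (by positivity)]
    field_simp
  obtain ⟨δ, hδ, htay⟩ := exists_flux_taylor p hScomp (fun h => hS0 0 h rfl) hθ
  have huc : UniformContinuous f := by
    rw [hfdef]
    exact hu.continuous_cgrad.uniformContinuous_of_tendsto_cocompact
      (hasCompactSupport_cgrad hu.hasCompactSupport).is_zero_at_infty
  set δ' := min (min ε r₁) (δ / 4) with hδ'
  have hδ'0 : 0 < δ' := lt_min (lt_min hε hr₁) (by positivity)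
  have hδ'ε : δ' ≤ ε := (min_le_left _ _).trans (min_le_left _ _)
  have hδ'r : δ' ≤ r₁ := (min_le_left _ _).trans (min_le_right _ _)
  have hδ'δ : δ' ≤ δ / 4 := min_le_right _ _
  obtain ⟨r₂, hr₂, hr₂'⟩ := Metric.uniformContinuous_iff.1 huc δ' hδ'0
  obtain ⟨r₃, hr₃, hr₃'⟩ := hK.exists_thickening_subset_open hV hKV
  obtain ⟨σ, hσ, hσ'⟩ : ∃ σ > 0, σ < min r₀ (min r₂ r₃) :=
    exists_between (lt_min hr₀ (lt_min hr₂ hr₃))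
  have hσ0 : σ < r₀ := hσ'.trans_le (min_le_left _ _)
  have hσ2 : σ < r₂ := hσ'.trans_le ((min_le_right _ _).trans (min_le_left _ _))
  have hσ3 : σ < r₃ := hσ'.trans_le ((min_le_right _ _).trans (min_le_right _ _))
  obtain ⟨ρ, hρ, hρs, hρ0, hρ1, hρκ⟩ := hmol σ hσ
  have hρc : HasCompactSupport ρ := (isCompact_closedBall (0 : ℂ) σ).of_isClosed_subset
    (isClosed_tsupport ρ) hρs
  have hρd : ContDiff ℝ 1 ρ := hρ.of_le (by simp)
  have hcρ := continuous_cgrad hρd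
  set T := Metric.closedBall (0 : ℂ) σ with hT
  have hTc : IsCompact T := isCompact_closedBall 0 σ
  have hTn : ∀ t ∈ T, ‖t‖ ≤ σ := fun t ht => mem_closedBall_zero_iff.1 ht
  have hρT : ∀ t, t ∉ T → t ∉ tsupport ρ := fun t ht h => ht (hρs h)
  have hgT : ∀ t, t ∉ T → cgrad ρ t = 0 := fun t ht =>
    cgrad_eq_zero_of_notMem_tsupport (hρT t ht)
  have hκT : ∫ t in T, ‖cgrad ρ t‖ ≤ κ / σ := by
    rwa [setIntegral_eq_integral_of_forall_compl_eq_zero fun t ht => by simp [hgT t ht]]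
  have h1T : ∫ t in T, ρ t ≤ 1 := by
    rw [setIntegral_eq_integral_of_forall_compl_eq_zero fun t ht =>
      image_eq_zero_of_notMem_tsupport (hρT t ht), hρ1]
  have hclose : ∀ x, ∀ t ∈ T, ‖f (x - t) - f x‖ ≤ δ' := fun x t ht => by
    rw [← dist_eq_norm]
    refine (hr₂' ?_).le
    simpa [dist_eq_norm] using (hTn t ht).trans_lt hσ2
  have hdqT : ∀ t ∈ T, ∫ x in K, ‖f (x - t) - f x‖ ^ 2 ≤ C₀ * σ ^ 2 := fun t ht => by
    have h1 := hdq (-t) (by rw [norm_neg]; exact (hTn t ht).trans_lt hσ0)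
    simp only [← sub_eq_add_neg, norm_neg] at h1
    refine h1.trans ?_
    have := hTn t ht
    gcongr
  obtain ⟨g, hgdef⟩ : ∃ g, g = moll ρ f := ⟨_, rfl⟩
  have hgs : ContDiff ℝ ∞ g := hgdef ▸ contDiff_moll hρ hρc hf
  have hgc := hgs.continuous
  have hgf : ∀ x, ‖g x - f x‖ ≤ ∫ t in T, ρ t * ‖f (x - t) - f x‖ := fun x => by
    rw [hgdef, moll_sub_eq hρ hρc hf hρ1]
    exact norm_integral_smul_le hTc hρ.continuous (by fun_prop)
      (fun t => (abs_of_nonneg (hρ0 t)).le)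
      (fun t ht => image_eq_zero_of_notMem_tsupport (hρT t ht))
  have hgf' : ∀ x, ‖g x - f x‖ ≤ δ' := fun x => by
    refine (hgf x).trans ?_
    calc ∫ t in T, ρ t * ‖f (x - t) - f x‖ ≤ ∫ t in T, ρ t * δ' := by
          refine setIntegral_mono_of_nonneg hTc.measurableSet
            (fun t _ => mul_nonneg (hρ0 t) (norm_nonneg _))
            ((hρ.continuous.mul continuous_const).continuousOn.integrableOn_compact hTc)
            fun t ht => mul_le_mul_of_nonneg_left (hclose x t ht) (hρ0 t)
      _ = (∫ t in T, ρ t) * δ' := integral_mul_const _ _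
      _ ≤ 1 * δ' := by gcongr
      _ = δ' := one_mul _
  have cq1 : Continuous (Function.uncurry fun x t : ℂ => ‖f (x - t) - f x‖) := by
    unfold Function.uncurry; fun_prop
  have cq2 : Continuous (Function.uncurry fun x t : ℂ => ‖f (x - t) - g x‖) := by
    unfold Function.uncurry; fun_prop
  have hgK : ∫ x in K, ‖g x - f x‖ ^ 2 ≤ C₀ * σ ^ 2 := by
    have h1 := integral_sq_integral_mul_le (q := fun x t => ‖f (x - t) - f x‖) one_pos
      (by positivity) hK hTc hρ.continuous hρ0 cq1 h1T hdqT
    rw [one_pow, one_mul] at h1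
    refine (setIntegral_mono_of_nonneg hK.measurableSet (fun x _ => by positivity) ?_
      fun x _ => ?_).trans h1
    · exact ((continuous_parametric_integral_of_continuous
        ((hρ.continuous.comp continuous_snd).mul cq1) hTc).pow 2).continuousOn.integrableOn_compact hK
    · exact pow_le_pow_left₀ (norm_nonneg _) (hgf x) 2
  have hparam : ∀ q : ℂ → ℂ → ℝ, Continuous (Function.uncurry q) →
      IntegrableOn (fun x => (∫ t in T, ‖cgrad ρ t‖ * q x t) ^ 2) K := fun q hq =>
    ((continuous_parametric_integral_of_continuous
        ((hcρ.norm.comp continuous_snd).mul hq) hTc).pow 2).continuousOn.integrableOn_compact hK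
  have hD1 : ∫ x in K, (∫ t in T, ‖cgrad ρ t‖ * ‖f (x - t) - f x‖) ^ 2 ≤ κ ^ 2 * C₀ := by
    refine (integral_sq_integral_mul_le (q := fun x t => ‖f (x - t) - f x‖)
      (by positivity : 0 < κ / σ) (by positivity) hK hTc hcρ.norm (fun t => norm_nonneg _) cq1
      hκT hdqT).trans (le_of_eq ?_)
    field_simp
  have hder : ∀ v, (∀ t, |fderiv ℝ ρ t v| ≤ ‖cgrad ρ t‖) → ∀ x,
      ‖fderiv ℝ g x v‖ ≤ ∫ t in T, ‖cgrad ρ t‖ * ‖f (x - t) - f x‖ := fun v hv x => by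
    rw [hgdef, fderiv_moll_eq hρ hρc hf x v (f x)]
    refine norm_integral_smul_le hTc hcρ.norm (by fun_prop) hv fun t ht => ?_
    have := hv t
    rw [hgT t ht, norm_zero] at this
    exact abs_nonpos_iff.1 this
  refine ⟨g, hgs.of_le ?_, fun z _ => (hfdef ▸ hgf' z).trans hδ'ε, fun z => ?_, ?_, ?_⟩
  · have : ((2 : ℕ∞) : WithTop ℕ∞) ≤ ((⊤ : ℕ∞) : WithTop ℕ∞) := by exact_mod_cast le_top
    simpa using this
  · rw [hgdef, hfdef]
    exact fderiv_moll_cgrad_symm hρ hρc hu.contDiff hu.hasCompactSupport z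
  · calc _ ≤ ∫ x in K, 2 * (∫ t in T, ‖cgrad ρ t‖ * ‖f (x - t) - f x‖) ^ 2 := by
          refine setIntegral_mono_of_nonneg hK.measurableSet (fun x _ => by positivity)
            ((hparam _ cq1).const_mul 2) fun x _ => ?_
          have h1 := pow_le_pow_left₀ (norm_nonneg _) (hder 1 (abs_fderiv_one_le ρ) x) 2
          have h2 := pow_le_pow_left₀ (norm_nonneg _) (hder Complex.I (abs_fderiv_I_le ρ) x) 2
          linarith
      _ ≤ _ := by rw [integral_const_mul]; gcongr
  · have hq2 : ∀ t ∈ T, ∫ x in K, ‖f (x - t) - g x‖ ^ 2 ≤ 4 * C₀ * σ ^ 2 := fun t ht => by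
      have c1 : Continuous fun x => ‖f (x - t) - f x‖ ^ 2 := by fun_prop
      have c2 : Continuous fun x => ‖g x - f x‖ ^ 2 := by fun_prop
      have k1 := (c1.continuousOn.integrableOn_compact hK (μ := volume)).const_mul 2
      have k2 := (c2.continuousOn.integrableOn_compact hK (μ := volume)).const_mul 2
      calc _ ≤ ∫ x in K, (2 * ‖f (x - t) - f x‖ ^ 2 + 2 * ‖g x - f x‖ ^ 2) := by
            refine setIntegral_mono_of_nonneg hK.measurableSet (fun x _ => by positivity)
              (k1.add k2) fun x _ => ?_
            have h1 : ‖f (x - t) - g x‖ ≤ ‖f (x - t) - f x‖ + ‖g x - f x‖ := by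
              rw [← norm_neg (g x - f x), neg_sub]
              simpa using norm_add_le (f (x - t) - f x) (f x - g x)
            have h2 := pow_le_pow_left₀ (norm_nonneg _) h1 2
            nlinarith [sq_nonneg (‖f (x - t) - f x‖ - ‖g x - f x‖)]
        _ ≤ _ := by
            rw [integral_add k1 k2, integral_const_mul, integral_const_mul]
            have := hdqT t ht
            linarith
    have hD2 : ∫ x in K, (∫ t in T, ‖cgrad ρ t‖ * ‖f (x - t) - g x‖) ^ 2 ≤ 4 * κ ^ 2 * C₀ := by
      refine (integral_sq_integral_mul_le (q := fun x t => ‖f (x - t) - g x‖)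
        (by positivity : 0 < κ / σ) (by positivity) hK hTc hcρ.norm (fun t => norm_nonneg _) cq2
        hκT hq2).trans (le_of_eq ?_)
      field_simp
    have hmain : ∀ x ∈ K, m ^ 2 * divLin p (g x) (fderiv ℝ g x 1) (fderiv ℝ g x Complex.I) ^ 2 ≤
        θ ^ 2 * (∫ t in T, ‖cgrad ρ t‖ * ‖f (x - t) - g x‖) ^ 2 := fun x hx => by
      have hb : g x ∈ S := by
        refine Metric.mem_cthickening_of_dist_le (g x) (cgrad u x) r₁ _ (mem_image_of_mem _ hx) ?_
        rw [dist_eq_norm]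
        exact (hfdef ▸ hgf' x).trans hδ'r
      have hxV : ∀ t ∈ tsupport ρ, x - t ∈ V := fun t ht => by
        refine hr₃' (Metric.mem_thickening_iff.2 ⟨x, hx, ?_⟩)
        simpa [dist_eq_norm] using (hTn t (hρs ht)).trans_lt hσ3
      have h1 := hu.divLin_moll_eq hp hρ hρc hxV (hS0 _ hb)
      rw [← hfdef, ← hgdef] at h1
      have h2 : |∫ t, ⟪flux p (f (x - t)) - flux p (g x) -
          fderiv ℝ (flux p) (g x) (f (x - t) - g x), cgrad ρ t⟫| ≤
          θ * ∫ t in T, ‖cgrad ρ t‖ * ‖f (x - t) - g x‖ := by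
        have hz : ∀ t, t ∉ T → ⟪flux p (f (x - t)) - flux p (g x) -
            fderiv ℝ (flux p) (g x) (f (x - t) - g x), cgrad ρ t⟫ = 0 := fun t ht => by
          rw [hgT t ht, inner_zero_right]
        rw [← setIntegral_eq_integral_of_forall_compl_eq_zero hz, ← integral_const_mul,
          ← Real.norm_eq_abs]
        refine (norm_integral_le_integral_norm _).trans ?_
        refine setIntegral_mono_of_nonneg hTc.measurableSet (fun t _ => norm_nonneg _) ?_
          fun t ht => ?_
        · have : Continuous fun t => θ * (‖cgrad ρ t‖ * ‖f (x - t) - g x‖) := by fun_prop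
          exact this.continuousOn.integrableOn_compact hTc
        · have h3 : ‖f (x - t) - g x‖ < δ := by
            have h4 : ‖f (x - t) - g x‖ ≤ ‖f (x - t) - f x‖ + ‖g x - f x‖ := by
              rw [← norm_neg (g x - f x), neg_sub]
              simpa using norm_add_le (f (x - t) - f x) (f x - g x)
            linarith [hclose x t ht, hgf' x]
          refine (abs_real_inner_le_norm _ _).trans ?_
          calc _ ≤ (θ * ‖f (x - t) - g x‖) * ‖cgrad ρ t‖ := by
                gcongr
                exact htay _ hb _ h3
            _ = _ := by ring
      rw [← abs_neg, ← h1, abs_mul, abs_of_nonneg (by positivity)] at h2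
      have h5 : m * |divLin p (g x) (fderiv ℝ g x 1) (fderiv ℝ g x Complex.I)| ≤
          θ * ∫ t in T, ‖cgrad ρ t‖ * ‖f (x - t) - g x‖ :=
        (mul_le_mul_of_nonneg_right (hmle _ hb) (abs_nonneg _)).trans h2
      have h6 := pow_le_pow_left₀ (by positivity) h5 2
      rwa [mul_pow, mul_pow, sq_abs] at h6
    have hfin : m ^ 2 * ∫ z in K, divLin p (g z) (fderiv ℝ g z 1) (fderiv ℝ g z Complex.I) ^ 2 ≤
        m ^ 2 * ε := by
      rw [← integral_const_mul]
      calc _ ≤ ∫ x in K, θ ^ 2 * (∫ t in T, ‖cgrad ρ t‖ * ‖f (x - t) - g x‖) ^ 2 :=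
            setIntegral_mono_of_nonneg hK.measurableSet (fun x _ => by positivity)
              ((hparam _ cq2).const_mul _) hmain
        _ ≤ θ ^ 2 * (4 * κ ^ 2 * C₀) := by rw [integral_const_mul]; gcongr
        _ ≤ m ^ 2 * ε := hθ2
    exact le_of_mul_le_mul_left hfin (by positivity)

/-! ### Energy estimates -/

theorem continuous_mul_of_tsupport_subset {U : Set ℂ} (hU : IsOpen U) {η w : ℂ → ℝ}
    (hη : Continuous η) (hs : tsupport η ⊆ U) (hw : ContinuousOn w U) :
    Continuous (fun z => η z * w z) :=
  contDiff_zero.1 (contDiff_mul_of_tsupport_subset (n := 0) hU (contDiff_zero.2 hη) hs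
    (contDiffOn_zero.2 hw))

theorem integrable_sq_mul {W : Set ℂ} (hW : IsOpen W) {η w : ℂ → ℝ}
    (hη : Continuous η) (hc : HasCompactSupport η) (hs : tsupport η ⊆ W) (hw : ContinuousOn w W) :
    Integrable fun z => η z ^ 2 * w z := by
  refine integrable_of_tsupport ?_ hc fun z hz => by
    rw [image_eq_zero_of_notMem_tsupport hz]; simp
  refine (hη.mul (continuous_mul_of_tsupport_subset hW hη hs hw)).congr fun z => ?_
  rw [Pi.mul_apply]
  ring

/-- A Caccioppoli type inequality: `γ` is a nondecreasing function of a potential of the form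
`(b₁, b₂)`, tested against a closed form `(a₁, a₂)`. -/
theorem integral_energy_le {W : Set ℂ} (hW : IsOpen W) {γ γ' b₁ b₂ a₁ a₂ N R G η : ℂ → ℝ}
    {K : ℝ} (hK : 1 ≤ K) (hη : ContDiff ℝ 1 η) (hηc : HasCompactSupport η) (hηW : tsupport η ⊆ W)
    (hγ : ContDiffOn ℝ 1 γ W) (hγ' : ContinuousOn γ' W) (hγ'0 : ∀ z ∈ W, 0 ≤ γ' z)
    (hb₁ : ∀ z ∈ W, fderiv ℝ γ z 1 = γ' z * b₁ z)
    (hb₂ : ∀ z ∈ W, fderiv ℝ γ z Complex.I = γ' z * b₂ z)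
    (ha₁ : ContDiffOn ℝ 1 a₁ W) (ha₂ : ContDiffOn ℝ 1 a₂ W)
    (hcl : ∀ z ∈ W, fderiv ℝ a₂ z 1 = fderiv ℝ a₁ z Complex.I)
    (hN : ContinuousOn N W) (hR : ContinuousOn R W) (hG : Integrable G) (hG0 : ∀ z, 0 ≤ G z)
    (hNR0 : ∀ z ∈ W, 0 ≤ N z + R z)
    (hNle : ∀ z ∈ W, N z ≤ K * (b₁ z * a₂ z - b₂ z * a₁ z) + R z)
    (hale : ∀ z ∈ W, a₁ z ^ 2 + a₂ z ^ 2 ≤ K * (N z + R z))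
    (hηG : ∀ z ∈ W, (fderiv ℝ η z 1 ^ 2 + fderiv ℝ η z Complex.I ^ 2) * γ z ^ 2 ≤ γ' z * G z) :
    ∫ z, η z ^ 2 * (γ' z * N z) ≤ 4 * K ^ 3 * (∫ z, G z) + 3 * ∫ z, η z ^ 2 * (γ' z * R z) := by
  have hη2 : tsupport (fun z => η z ^ 2) ⊆ tsupport η :=
    closure_mono fun z hz h => hz (by simp [h])
  have hψ : ContDiff ℝ 1 fun z => η z ^ 2 * γ z :=
    contDiff_mul_of_tsupport_subset (n := 1) hW (hη.pow 2) (hη2.trans hηW) hγ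
  have hψs : tsupport (fun z => η z ^ 2 * γ z) ⊆ tsupport η :=
    closure_mono fun z hz h => hz (by simp [h])
  have hψc : HasCompactSupport fun z => η z ^ 2 * γ z :=
    hηc.of_isClosed_subset (isClosed_tsupport _) hψs
  have h0 := integral_wedge_eq_zero hW ha₁ ha₂ hcl hψ hψc (hψs.trans hηW)
  have hda : ∀ z ∉ tsupport η, ∀ v, fderiv ℝ (fun z => η z ^ 2 * γ z) z v = 0 := fun z hz v => by
    rw [fderiv_of_notMem_tsupport (𝕜 := ℝ) (fun h => hz (hψs h))]; rfl
  have iw : Integrable fun z => fderiv ℝ (fun z => η z ^ 2 * γ z) z 1 * a₂ z -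
      fderiv ℝ (fun z => η z ^ 2 * γ z) z Complex.I * a₁ z := by
    have hs : ∀ v, tsupport (fun z => fderiv ℝ (fun z => η z ^ 2 * γ z) z v) ⊆ tsupport η :=
      fun v => closure_minimal (fun z hz => by by_contra h; exact hz (hda z h v))
        (isClosed_tsupport _)
    refine Integrable.sub ?_ ?_
    · exact integrable_of_tsupport (continuous_mul_of_tsupport_subset hW
        (continuous_fderiv_apply_of_contDiff hψ 1) ((hs _).trans hηW) ha₂.continuousOn) hηc
        fun z hz => by rw [hda z hz, zero_mul]
    · exact integrable_of_tsupport (continuous_mul_of_tsupport_subset hW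
        (continuous_fderiv_apply_of_contDiff hψ Complex.I) ((hs _).trans hηW) ha₁.continuousOn) hηc
        fun z hz => by rw [hda z hz, zero_mul]
  have iN : Integrable fun z => η z ^ 2 * (γ' z * N z) :=
    integrable_sq_mul hW hη.continuous hηc hηW (hγ'.mul hN)
  have iR : Integrable fun z => η z ^ 2 * (γ' z * R z) :=
    integrable_sq_mul hW hη.continuous hηc hηW (hγ'.mul hR)
  have i₁ : Integrable fun z => 1 / 2 * (η z ^ 2 * (γ' z * N z)) +
      3 / 2 * (η z ^ 2 * (γ' z * R z)) := (iN.const_mul (1 / 2)).add (iR.const_mul (3 / 2))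
  have i₂ : Integrable fun z => 2 * K ^ 3 * G z + (1 / 2 * (η z ^ 2 * (γ' z * N z)) +
      3 / 2 * (η z ^ 2 * (γ' z * R z))) := (hG.const_mul (2 * K ^ 3)).add i₁
  have key : ∀ z, η z ^ 2 * (γ' z * N z) ≤
      K * (fderiv ℝ (fun z => η z ^ 2 * γ z) z 1 * a₂ z -
        fderiv ℝ (fun z => η z ^ 2 * γ z) z Complex.I * a₁ z) +
      (2 * K ^ 3 * G z + (1 / 2 * (η z ^ 2 * (γ' z * N z)) +
        3 / 2 * (η z ^ 2 * (γ' z * R z)))) := fun z => by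
    by_cases hz : z ∈ tsupport η
    · have hzW := hηW hz
      have d1 := (hη.differentiable (by norm_num) z).hasFDerivAt
      have d2 := ((hγ.contDiffAt (hW.mem_nhds hzW)).differentiableAt (by norm_num)).hasFDerivAt
      have d3 : HasFDerivAt (fun z => η z ^ 2 * γ z) _ z := (d1.pow 2).mul d2
      rw [d3.fderiv]
      simp only [_root_.add_apply, _root_.smul_apply, smul_eq_mul,
        hb₁ z hzW, hb₂ z hzW]
      have e1 := hNle z hzW
      have e2 := hale z hzW
      have e3 := hηG z hzW
      have e4 := hγ'0 z hzW
      have e5 := hNR0 z hzW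
      have e6 := hG0 z
      generalize fderiv ℝ η z 1 = η₁ at *
      generalize fderiv ℝ η z Complex.I = η₂ at *
      generalize η z = t at *
      generalize γ z = c at *
      generalize γ' z = c' at *
      generalize N z = n at *
      generalize R z = r at *
      generalize G z = q at *
      generalize a₁ z = x at *
      generalize a₂ z = y at *
      generalize b₁ z = X at *
      generalize b₂ z = Y at *
      have f1 : (2 * K * t * c * (η₁ * y - η₂ * x)) ^ 2 ≤
          (2 * K ^ 3 * q + 1 / 2 * (t ^ 2 * (c' * (n + r)))) ^ 2 := by
        have g1 : (η₁ * y - η₂ * x) ^ 2 ≤ (η₁ ^ 2 + η₂ ^ 2) * (x ^ 2 + y ^ 2) := by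
          nlinarith [sq_nonneg (η₁ * x + η₂ * y)]
        have g2 : c ^ 2 * (η₁ * y - η₂ * x) ^ 2 ≤ (c' * q) * (K * (n + r)) :=
          calc c ^ 2 * (η₁ * y - η₂ * x) ^ 2
              ≤ c ^ 2 * ((η₁ ^ 2 + η₂ ^ 2) * (x ^ 2 + y ^ 2)) := by gcongr
            _ = ((η₁ ^ 2 + η₂ ^ 2) * c ^ 2) * (x ^ 2 + y ^ 2) := by ring
            _ ≤ _ := by gcongr
        calc _ = 4 * K ^ 2 * t ^ 2 * (c ^ 2 * (η₁ * y - η₂ * x) ^ 2) := by ring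
          _ ≤ 4 * K ^ 2 * t ^ 2 * ((c' * q) * (K * (n + r))) := by gcongr
          _ ≤ _ := by
            nlinarith [sq_nonneg (2 * K ^ 3 * q - 1 / 2 * (t ^ 2 * (c' * (n + r))))]
      have f2 := (abs_le_of_sq_le_sq' f1 (by positivity)).1
      have f3 : t ^ 2 * c' * n ≤ t ^ 2 * c' * (K * (X * y - Y * x) + r) := by gcongr
      simp only [Nat.cast_ofNat, Nat.add_one_sub_one, pow_one, nsmul_eq_mul]
      nlinarith
    · rw [hda z hz, hda z hz, image_eq_zero_of_notMem_tsupport hz]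
      have := hG0 z
      have : 0 ≤ 2 * K ^ 3 * G z := by positivity
      simpa using this
  have hInt := integral_mono iN ((iw.const_mul K).add i₂) key
  have h2 : ∫ z, (K * (fderiv ℝ (fun z => η z ^ 2 * γ z) z 1 * a₂ z -
        fderiv ℝ (fun z => η z ^ 2 * γ z) z Complex.I * a₁ z) +
      (2 * K ^ 3 * G z + (1 / 2 * (η z ^ 2 * (γ' z * N z)) +
        3 / 2 * (η z ^ 2 * (γ' z * R z))))) = K * 0 + (2 * K ^ 3 * (∫ z, G z) +
        (1 / 2 * (∫ z, η z ^ 2 * (γ' z * N z)) + 3 / 2 * ∫ z, η z ^ 2 * (γ' z * R z))) := by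
    rw [integral_add (iw.const_mul K) i₂, integral_add (hG.const_mul (2 * K ^ 3)) i₁,
      integral_add (iN.const_mul (1 / 2)) (iR.const_mul (3 / 2)),
      integral_const_mul, integral_const_mul, integral_const_mul, integral_const_mul, h0]
  have h3 := hInt.trans_eq h2
  linarith

/-! ### Logarithmic derivatives of the approximate gradient -/

/-- The logarithmic derivative of `g` in the direction `v`. -/
noncomputable def lg (g : ℂ → ℂ) (v z : ℂ) : ℂ := fderiv ℝ g z v / g z

theorem contDiffOn_lg {g : ℂ → ℂ} (hg : ContDiff ℝ 2 g) {W : Set ℂ} (h0 : ∀ z ∈ W, g z ≠ 0)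
    (v : ℂ) : ContDiffOn ℝ 1 (lg g v) W :=
  ((hg.fderiv_right (m := 1) (by norm_num)).clm_apply contDiff_const).contDiffOn.mul
    ((hg.of_le one_le_two).contDiffOn.inv h0)

theorem fderiv_lg {g : ℂ → ℂ} (hg : ContDiff ℝ 2 g) {z : ℂ} (h0 : g z ≠ 0) (v w : ℂ) :
    fderiv ℝ (lg g v) z w = fderiv ℝ (fun y => fderiv ℝ g y v) z w / g z -
      fderiv ℝ g z v * fderiv ℝ g z w / g z ^ 2 := by
  have d1 : DifferentiableAt ℝ (fun y => fderiv ℝ g y v) z :=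
    (((hg.fderiv_right (m := 1) (by norm_num)).clm_apply contDiff_const).differentiable
      (by norm_num)) z
  have d2 : DifferentiableAt ℝ g z := hg.differentiable (by norm_num) z
  have : lg g v = fun y => fderiv ℝ g y v * (g y)⁻¹ := by
    funext y; rw [lg, div_eq_mul_inv]
  have h : HasFDerivAt (fun y => fderiv ℝ g y v * (g y)⁻¹) _ z :=
    d1.hasFDerivAt.mul ((hasFDerivAt_inv' (𝕜 := ℝ) h0).comp z d2.hasFDerivAt)
  rw [this, h.fderiv]
  simp
  field_simp
  ring

theorem fderiv_lg_symm {g : ℂ → ℂ} (hg : ContDiff ℝ 2 g) {z : ℂ} (h0 : g z ≠ 0) :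
    fderiv ℝ (lg g Complex.I) z 1 = fderiv ℝ (lg g 1) z Complex.I := by
  rw [fderiv_lg hg h0, fderiv_lg hg h0, fderiv_fderiv_comm hg.contDiffAt]
  ring

theorem contDiffOn_re_lg {g : ℂ → ℂ} (hg : ContDiff ℝ 2 g) {W : Set ℂ} (h0 : ∀ z ∈ W, g z ≠ 0)
    (v : ℂ) : ContDiffOn ℝ 1 (fun z => (lg g v z).re) W :=
  Complex.reCLM.contDiff.comp_contDiffOn (contDiffOn_lg hg h0 v)

theorem contDiffOn_im_lg {g : ℂ → ℂ} (hg : ContDiff ℝ 2 g) {W : Set ℂ} (h0 : ∀ z ∈ W, g z ≠ 0)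
    (v : ℂ) : ContDiffOn ℝ 1 (fun z => (lg g v z).im) W :=
  Complex.imCLM.contDiff.comp_contDiffOn (contDiffOn_lg hg h0 v)

theorem differentiableAt_lg {g : ℂ → ℂ} (hg : ContDiff ℝ 2 g) {z : ℂ} (h0 : g z ≠ 0) (v : ℂ) :
    DifferentiableAt ℝ (lg g v) z :=
  ((contDiffOn_lg hg (W := {z | g z ≠ 0}) (fun _ h => h) v).contDiffAt
    ((isOpen_compl_singleton.preimage hg.continuous).mem_nhds h0)).differentiableAt (by norm_num)

theorem fderiv_re_lg {g : ℂ → ℂ} (hg : ContDiff ℝ 2 g) {z : ℂ} (h0 : g z ≠ 0) (v w : ℂ) :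
    fderiv ℝ (fun z => (lg g v z).re) z w = (fderiv ℝ (lg g v) z w).re := by
  have h := (Complex.reCLM.hasFDerivAt (x := lg g v z)).comp z
    (differentiableAt_lg hg h0 v).hasFDerivAt
  exact congrArg (fun L : ℂ →L[ℝ] ℝ => L w) h.fderiv

theorem fderiv_im_lg {g : ℂ → ℂ} (hg : ContDiff ℝ 2 g) {z : ℂ} (h0 : g z ≠ 0) (v w : ℂ) :
    fderiv ℝ (fun z => (lg g v z).im) z w = (fderiv ℝ (lg g v) z w).im := by
  have h := (Complex.imCLM.hasFDerivAt (x := lg g v z)).comp z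
    (differentiableAt_lg hg h0 v).hasFDerivAt
  exact congrArg (fun L : ℂ →L[ℝ] ℝ => L w) h.fderiv

theorem hasFDerivAt_log_norm {g : ℂ → ℂ} {z : ℂ} (hg : DifferentiableAt ℝ g z) (h0 : g z ≠ 0) :
    HasFDerivAt (fun y => Real.log ‖g y‖)
      ((‖g z‖ ^ 2)⁻¹ • (innerSL ℝ (g z)).comp (fderiv ℝ g z)) z := by
  have hn : 0 < ‖g z‖ := norm_pos_iff.2 h0
  have h1 : HasFDerivAt (fun y => ‖g y‖ ^ 2) _ z := hg.hasFDerivAt.norm_sq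
  have h2 := (h1.log (by positivity)).const_mul (1 / 2 : ℝ)
  have e : (fun y => 1 / 2 * Real.log (‖g y‖ ^ 2)) = fun y => Real.log ‖g y‖ := by
    funext y; rw [Real.log_pow]; push_cast; ring
  rw [e] at h2
  refine h2.congr_fderiv ?_
  ext; simp; ring

theorem fderiv_log_norm {g : ℂ → ℂ} {z : ℂ} (hg : DifferentiableAt ℝ g z) (h0 : g z ≠ 0) (v : ℂ) :
    fderiv ℝ (fun y => Real.log ‖g y‖) z v = (lg g v z).re := by
  rw [(hasFDerivAt_log_norm hg h0).fderiv, lg]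
  simp only [_root_.smul_apply, ContinuousLinearMap.comp_apply, innerSL_apply_apply,
    real_inner_eq, smul_eq_mul, Complex.div_re, ← Complex.normSq_eq_norm_sq]
  ring

theorem contDiffOn_log_norm {g : ℂ → ℂ} (hg : ContDiff ℝ 2 g) {W : Set ℂ}
    (h0 : ∀ z ∈ W, g z ≠ 0) : ContDiffOn ℝ 1 (fun z => Real.log ‖g z‖) W := by
  have h1 : ContDiffOn ℝ 1 g W := (hg.of_le (by norm_num)).contDiffOn
  exact (h1.norm ℝ h0).log fun z hz => norm_ne_zero_iff.2 (h0 z hz)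

/-- The real and imaginary parts of the logarithmic derivatives, in the frame given by `b`. -/
theorem lg_relations (p : ℝ) {b y₁ y₂ : ℂ} (hb : b ≠ 0) (hy : y₁.im = y₂.re) :
    b.re / ‖b‖ * (y₂ / b).re - b.im / ‖b‖ * (y₁ / b).re =
      b.re / ‖b‖ * (y₁ / b).im + b.im / ‖b‖ * (y₂ / b).im ∧
    (p - 1) * (b.re / ‖b‖ * (y₁ / b).re + b.im / ‖b‖ * (y₂ / b).re) =
      divLin p b y₁ y₂ / ‖b‖ - (b.re / ‖b‖ * (y₂ / b).im - b.im / ‖b‖ * (y₁ / b).im) := by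
  have hn : 0 < ‖b‖ := norm_pos_iff.2 hb
  have hsq : ‖b‖ ^ 2 = b.re ^ 2 + b.im ^ 2 := by
    rw [← Complex.normSq_eq_norm_sq, Complex.normSq_apply]; ring
  have hs : b.re ^ 2 + b.im ^ 2 ≠ 0 := by rw [← hsq]; positivity
  have hs' : Complex.normSq b = b.re ^ 2 + b.im ^ 2 := by rw [Complex.normSq_apply]; ring
  constructor
  · simp only [Complex.div_re, Complex.div_im, hs']
    field_simp
    rw [hy]
    ring
  · unfold divLin linFlux
    simp only [Complex.div_re, Complex.div_im, hs', real_inner_eq, hsq, Complex.add_re,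
      Complex.add_im, Complex.smul_re, Complex.smul_im, smul_eq_mul]
    field_simp
    ring

/-! ### Energy estimates for a single approximate gradient -/

theorem exists_energy_const {p : ℝ} (hp : 1 < p) :
    ∃ K ≥ 1, ∃ K' > 0, ∀ b y₁ y₂ : ℂ, b ≠ 0 → y₁.im = y₂.re →
      (y₁ / b).re ^ 2 + (y₂ / b).re ^ 2 + (y₁ / b).im ^ 2 + (y₂ / b).im ^ 2 ≤
        K * ((y₁ / b).re * -(y₂ / b).im - (y₂ / b).re * -(y₁ / b).im) +
          K' * (divLin p b y₁ y₂ / ‖b‖) ^ 2 := by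
  have hp' : 0 < p - 1 := by linarith
  obtain ⟨κ, hκ⟩ : ∃ κ, κ = (p - 1)⁻¹ := ⟨_, rfl⟩
  have hκ0 : 0 < κ := by rw [hκ]; positivity
  refine ⟨2 + 2 / κ * (1 + 2 * κ ^ 2), ?_, (2 + 2 / κ * (1 + 2 * κ ^ 2)) * κ + 2 * κ ^ 2, ?_,
    fun b y₁ y₂ hb hy => ?_⟩
  · have : 0 ≤ 2 / κ * (1 + 2 * κ ^ 2) := by positivity
    linarith
  · positivity
  obtain ⟨h1, h2⟩ := lg_relations p hb hy
  have hn : 0 < ‖b‖ := norm_pos_iff.2 hb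
  have hcs : (b.re / ‖b‖) ^ 2 + (b.im / ‖b‖) ^ 2 = 1 := by
    rw [div_pow, div_pow, ← add_div, div_eq_one_iff_eq (by positivity),
      ← Complex.normSq_eq_norm_sq, Complex.normSq_apply]
    ring
  generalize b.re / ‖b‖ = c at *
  generalize b.im / ‖b‖ = d at *
  generalize (y₁ / b).re = s₁ at *
  generalize (y₂ / b).re = s₂ at *
  generalize (y₁ / b).im = a₁ at *
  generalize (y₂ / b).im = a₂ at *
  generalize divLin p b y₁ y₂ / ‖b‖ = e at *
  have h3 : c * s₁ + d * s₂ = κ * (e - (c * a₂ - d * a₁)) := by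
    rw [hκ, ← h2]
    field_simp
  obtain ⟨x, hx⟩ : ∃ x, x = c * a₁ + d * a₂ := ⟨_, rfl⟩
  obtain ⟨y, hy⟩ : ∃ y, y = c * a₂ - d * a₁ := ⟨_, rfl⟩
  have e1 : s₁ * -a₂ - s₂ * -a₁ = x ^ 2 + κ * y ^ 2 - κ * e * y := by
    have : s₁ * -a₂ - s₂ * -a₁ =
        (c ^ 2 + d ^ 2) * (s₁ * -a₂ - s₂ * -a₁) := by rw [hcs, one_mul]
    rw [this]
    calc _ = (c * s₂ - d * s₁) * (c * a₁ + d * a₂) - (c * s₁ + d * s₂) * (c * a₂ - d * a₁) := by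
          ring
      _ = _ := by rw [h1, h3, ← hx, ← hy]; ring
  have e2 : s₁ ^ 2 + s₂ ^ 2 = x ^ 2 + κ ^ 2 * (e - y) ^ 2 := by
    have : s₁ ^ 2 + s₂ ^ 2 = (c ^ 2 + d ^ 2) * (s₁ ^ 2 + s₂ ^ 2) := by rw [hcs, one_mul]
    rw [this]
    calc _ = (c * s₂ - d * s₁) ^ 2 + (c * s₁ + d * s₂) ^ 2 := by ring
      _ = _ := by rw [h1, h3, ← hx, ← hy]; ring
  have e3 : a₁ ^ 2 + a₂ ^ 2 = x ^ 2 + y ^ 2 := by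
    have : a₁ ^ 2 + a₂ ^ 2 = (c ^ 2 + d ^ 2) * (a₁ ^ 2 + a₂ ^ 2) := by rw [hcs, one_mul]
    rw [this, hx, hy]
    ring
  rw [e1, add_assoc, e2, e3]
  obtain ⟨q, hq⟩ : ∃ q, q = 2 / κ * (1 + 2 * κ ^ 2) := ⟨_, rfl⟩
  have hq0 : 0 < q := by rw [hq]; positivity
  have hqκ : q * κ = 2 * (1 + 2 * κ ^ 2) := by rw [hq]; field_simp
  rw [← hq]
  have k1 : 0 ≤ q * x ^ 2 := by positivity
  have k2 : 0 ≤ (2 + q) * κ * ((y - e) ^ 2 + e ^ 2) := by positivity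
  have k3 : (q * κ) * y ^ 2 = (2 * (1 + 2 * κ ^ 2)) * y ^ 2 := by rw [hqκ]
  have k4 : 0 ≤ κ ^ 2 * (e + y) ^ 2 := by positivity
  have k5 : 0 ≤ κ * y ^ 2 := by positivity
  nlinarith

theorem contDiff_of_hasDerivAt {Γ Γ' : ℝ → ℝ} (h : ∀ t, HasDerivAt Γ (Γ' t) t)
    (hc : Continuous Γ') : ContDiff ℝ 1 Γ := by
  rw [contDiff_one_iff_deriv]
  refine ⟨fun t => (h t).differentiableAt, ?_⟩
  rwa [show deriv Γ = Γ' from funext fun t => (h t).deriv]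

theorem fderiv_comp_of_hasDerivAt {Γ : ℝ → ℝ} {Γ' : ℝ} {s : ℂ → ℝ} {z : ℂ}
    (h : HasDerivAt Γ Γ' (s z)) (hs : DifferentiableAt ℝ s z) (v : ℂ) :
    fderiv ℝ (fun y => Γ (s y)) z v = Γ' * fderiv ℝ s z v := by
  have := h.comp_hasFDerivAt z hs.hasFDerivAt
  exact congrArg (fun L : ℂ →L[ℝ] ℝ => L v) this.fderiv

theorem continuousOn_divLin {p : ℝ} {g : ℂ → ℂ} (hg : ContDiff ℝ 2 g) {W : Set ℂ}
    (h0 : ∀ z ∈ W, g z ≠ 0) :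
    ContinuousOn (fun z => divLin p (g z) (fderiv ℝ g z 1) (fderiv ℝ g z Complex.I)) W := by
  have hd : ∀ v, Continuous fun z => fderiv ℝ g z v := fun v =>
    (hg.continuous_fderiv (by norm_num)).clm_apply continuous_const
  have hl : ∀ v, ContinuousOn (fun z => linFlux p (g z) (fderiv ℝ g z v)) W := fun v => by
    unfold linFlux
    have h : ContinuousOn (fun z => (p - 2) * ⟪g z, fderiv ℝ g z v⟫ / ‖g z‖ ^ 2) W :=
      (continuous_const.mul (hg.continuous.inner (hd v))).continuousOn.div
        (hg.continuous.norm.pow 2).continuousOn fun z hz => by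
          have := norm_pos_iff.2 (h0 z hz)
          positivity
    exact (hd v).continuousOn.add (h.smul hg.continuous.continuousOn)
  exact (Complex.continuous_re.comp_continuousOn (hl 1)).add
    (Complex.continuous_im.comp_continuousOn (hl Complex.I))

/-- The normalized defect of `g` in the linearized equation. -/
noncomputable def defect (p : ℝ) (g : ℂ → ℂ) (z : ℂ) : ℝ :=
  divLin p (g z) (fderiv ℝ g z 1) (fderiv ℝ g z Complex.I) / ‖g z‖

theorem continuousOn_defect {p : ℝ} {g : ℂ → ℂ} (hg : ContDiff ℝ 2 g) {W : Set ℂ}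
    (h0 : ∀ z ∈ W, g z ≠ 0) : ContinuousOn (defect p g) W :=
  (continuousOn_divLin hg h0).div hg.continuous.norm.continuousOn
    fun z hz => norm_ne_zero_iff.2 (h0 z hz)

theorem exists_energy_log_norm {p : ℝ} (hp : 1 < p) :
    ∃ C > 0, ∀ g : ℂ → ℂ, ContDiff ℝ 2 g →
      (∀ z, (fderiv ℝ g z 1).im = (fderiv ℝ g z Complex.I).re) →
      ∀ W : Set ℂ, IsOpen W → (∀ z ∈ W, g z ≠ 0) → ∀ Γ Γ' : ℝ → ℝ,
      (∀ t, HasDerivAt Γ (Γ' t) t) → Continuous Γ' → (∀ t, 0 ≤ Γ' t) →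
      ∀ η G : ℂ → ℝ, ContDiff ℝ 1 η → HasCompactSupport η → tsupport η ⊆ W →
      Integrable G → (∀ z, 0 ≤ G z) →
      (∀ z ∈ W, (fderiv ℝ η z 1 ^ 2 + fderiv ℝ η z Complex.I ^ 2) * Γ (Real.log ‖g z‖) ^ 2 ≤
        Γ' (Real.log ‖g z‖) * G z) →
      ∫ z, η z ^ 2 * (Γ' (Real.log ‖g z‖) * ((lg g 1 z).re ^ 2 + (lg g Complex.I z).re ^ 2)) ≤
        C * ((∫ z, G z) + ∫ z, η z ^ 2 * (Γ' (Real.log ‖g z‖) * defect p g z ^ 2)) := by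
  obtain ⟨K, hK, K', hK', hle⟩ := exists_energy_const hp
  refine ⟨4 * K ^ 3 + 3 * K', by positivity, fun g hg hcurl W hW h0 Γ Γ' hΓ hΓ'c hΓ'0 η G hη hηc
    hηW hG hG0 hηG => ?_⟩
  have hs := contDiffOn_log_norm hg h0
  have hre : ∀ v, ContinuousOn (fun z => (lg g v z).re) W := fun v =>
    (contDiffOn_re_lg hg h0 v).continuousOn
  have him : ∀ v, ContinuousOn (fun z => (lg g v z).im) W := fun v =>
    (contDiffOn_im_lg hg h0 v).continuousOn
  have hd : ∀ z, DifferentiableAt ℝ g z := hg.differentiable (by norm_num)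
  have hγ' : ContinuousOn (fun z => Γ' (Real.log ‖g z‖)) W :=
    hΓ'c.comp_continuousOn hs.continuousOn
  have hfd : ∀ z ∈ W, ∀ v, fderiv ℝ (fun y => Γ (Real.log ‖g y‖)) z v =
      Γ' (Real.log ‖g z‖) * (lg g v z).re := fun z hz v => by
    rw [fderiv_comp_of_hasDerivAt (s := fun y => Real.log ‖g y‖) (hΓ _)
      (hasFDerivAt_log_norm (hd z) (h0 z hz)).differentiableAt, fderiv_log_norm (hd z) (h0 z hz)]
  have hR : ContinuousOn (fun z => K' * defect p g z ^ 2) W :=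
    continuousOn_const.mul ((continuousOn_defect hg h0).pow 2)
  have hN : ContinuousOn (fun z => (lg g 1 z).re ^ 2 + (lg g Complex.I z).re ^ 2 +
      (lg g 1 z).im ^ 2 + (lg g Complex.I z).im ^ 2) W :=
    ((((hre 1).pow 2).add ((hre Complex.I).pow 2)).add ((him 1).pow 2)).add
      ((him Complex.I).pow 2)
  have hfneg : ∀ z ∈ W, ∀ v w, fderiv ℝ (fun y => -(lg g v y).im) z w =
      -(fderiv ℝ (lg g v) z w).im := fun z hz v w => by
    rw [fderiv_fun_neg, _root_.neg_apply, fderiv_im_lg hg (h0 z hz)]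
  have main := integral_energy_le hW (γ := fun z => Γ (Real.log ‖g z‖))
    (γ' := fun z => Γ' (Real.log ‖g z‖)) (b₁ := fun z => (lg g 1 z).re)
    (b₂ := fun z => (lg g Complex.I z).re) (a₁ := fun z => -(lg g 1 z).im)
    (a₂ := fun z => -(lg g Complex.I z).im)
    (N := fun z => (lg g 1 z).re ^ 2 + (lg g Complex.I z).re ^ 2 +
      (lg g 1 z).im ^ 2 + (lg g Complex.I z).im ^ 2) (R := fun z => K' * defect p g z ^ 2)
    (G := G) (η := η) hK hη hηc hηW
    ((contDiff_of_hasDerivAt hΓ hΓ'c).comp_contDiffOn hs) hγ' (fun z _ => hΓ'0 _)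
    (fun z hz => hfd z hz 1) (fun z hz => hfd z hz Complex.I)
    (contDiffOn_im_lg hg h0 1).neg (contDiffOn_im_lg hg h0 Complex.I).neg
    (fun z hz => by rw [hfneg z hz, hfneg z hz, fderiv_lg_symm hg (h0 z hz)])
    hN hR hG hG0 (fun z _ => by positivity)
    (fun z hz => hle _ _ _ (h0 z hz) (hcurl z))
    (fun z _ => by
      have : 0 ≤ K' * defect p g z ^ 2 := by positivity
      nlinarith [sq_nonneg (lg g 1 z).re, sq_nonneg (lg g Complex.I z).re,
        sq_nonneg (lg g 1 z).im, sq_nonneg (lg g Complex.I z).im])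
    hηG
  have hmono : ∫ z, η z ^ 2 * (Γ' (Real.log ‖g z‖) *
        ((lg g 1 z).re ^ 2 + (lg g Complex.I z).re ^ 2)) ≤
      ∫ z, η z ^ 2 * (Γ' (Real.log ‖g z‖) * ((lg g 1 z).re ^ 2 + (lg g Complex.I z).re ^ 2 +
      (lg g 1 z).im ^ 2 + (lg g Complex.I z).im ^ 2)) := by
    refine integral_mono_of_nonneg (Eventually.of_forall fun z => ?_)
      (integrable_sq_mul hW hη.continuous hηc hηW (hγ'.mul hN)) (Eventually.of_forall fun z => ?_)
    · have := hΓ'0 (Real.log ‖g z‖)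
      simp only [Pi.zero_apply]
      positivity
    · have := hΓ'0 (Real.log ‖g z‖)
      have h1 := sq_nonneg (lg g 1 z).im
      have h2 := sq_nonneg (lg g Complex.I z).im
      exact mul_le_mul_of_nonneg_left (mul_le_mul_of_nonneg_left (by linarith) this)
        (sq_nonneg _)
  have e : ∀ z, η z ^ 2 * (Γ' (Real.log ‖g z‖) * (K' * defect p g z ^ 2)) =
      K' * (η z ^ 2 * (Γ' (Real.log ‖g z‖) * defect p g z ^ 2)) := fun z => by ring
  simp_rw [e, integral_const_mul] at main
  refine (hmono.trans main).trans ?_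
  have j1 : 0 ≤ ∫ z, G z := integral_nonneg hG0
  have j2 : 0 ≤ ∫ z, η z ^ 2 * (Γ' (Real.log ‖g z‖) * defect p g z ^ 2) :=
    integral_nonneg fun z => by
      have := hΓ'0 (Real.log ‖g z‖)
      simp only [Pi.zero_apply]
      positivity
  have hK3 : 0 < K ^ 3 := by positivity
  nlinarith [mul_nonneg hK'.le j1, mul_nonneg hK3.le j2]

theorem integral_defect_le {p : ℝ} {g : ℂ → ℂ} (hg : ContDiff ℝ 2 g) {D : Set ℂ}
    (hD : IsCompact D) {m B : ℝ} (hm : 0 < m) (hB : 0 ≤ B) (hmg : ∀ z ∈ D, m ≤ ‖g z‖)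
    {η γ' : ℂ → ℝ} (hη : ∀ z, 0 ≤ η z ∧ η z ≤ 1) (hηD : tsupport η ⊆ D)
    (hγ' : ∀ z ∈ D, 0 ≤ γ' z ∧ γ' z ≤ B) :
    ∫ z, η z ^ 2 * (γ' z * defect p g z ^ 2) ≤
      B / m ^ 2 * ∫ z in D, divLin p (g z) (fderiv ℝ g z 1) (fderiv ℝ g z Complex.I) ^ 2 := by
  have h0 : ∀ z ∈ D, g z ≠ 0 := fun z hz => norm_pos_iff.1 (hm.trans_le (hmg z hz))
  rw [← setIntegral_eq_integral_of_forall_compl_eq_zero (s := D) fun z hz => by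
    rw [image_eq_zero_of_notMem_tsupport (fun h => hz (hηD h))]; simp, ← integral_const_mul]
  refine setIntegral_mono_of_nonneg hD.measurableSet (fun z hz => ?_) ?_ fun z hz => ?_
  · have := (hγ' z hz).1
    positivity
  · exact (continuousOn_const.mul ((continuousOn_divLin hg h0).pow 2)).integrableOn_compact hD
  · have h1 : η z ^ 2 ≤ 1 := pow_le_one₀ (hη z).1 (hη z).2
    have h2 := (hγ' z hz).1
    calc _ ≤ 1 * (B * defect p g z ^ 2) := by
          gcongr
          exact (hγ' z hz).2
      _ ≤ _ := by
          rw [one_mul, defect, div_pow, div_mul_eq_mul_div, mul_div_assoc]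
          have := hmg z hz
          gcongr

/-! ### The minimum principle for the modulus of the gradient -/

theorem hasDerivAt_comp_max {k k' : ℝ → ℝ} (hk : ∀ x, 0 ≤ x → HasDerivAt k (k' x) x)
    (h0 : k' 0 = 0) (t : ℝ) : HasDerivAt (fun t => k (max t 0)) (k' (max t 0)) t := by
  rcases lt_trichotomy t 0 with ht | rfl | ht
  · rw [max_eq_right ht.le, h0]
    refine (hasDerivAt_const t (k 0)).congr_of_eventuallyEq ?_
    filter_upwards [gt_mem_nhds ht] with y hy
    rw [max_eq_right hy.le]
  · rw [max_self]
    have h1 : HasDerivWithinAt (fun t => k (max t 0)) (k' 0) (Ici 0) 0 :=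
      (hk 0 le_rfl).hasDerivWithinAt.congr (fun y hy => by rw [max_eq_left hy]) (by simp)
    have h2 : HasDerivWithinAt (fun t => k (max t 0)) (k' 0) (Iic 0) 0 := by
      rw [h0]
      exact (hasDerivWithinAt_const (0 : ℝ) (Iic 0) (k 0)).congr
        (fun y hy => by rw [max_eq_right hy]) (by simp)
    have h3 := h2.union h1
    rwa [Iic_union_Ici, hasDerivWithinAt_univ] at h3
  · rw [max_eq_left ht.le]
    refine (hk t ht.le).congr_of_eventuallyEq ?_
    filter_upwards [lt_mem_nhds ht] with y hy
    rw [max_eq_left hy.le]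

theorem integral_sq_cutoff_le {O : Set ℂ} (hO : IsOpen O) {η h : ℂ → ℝ} (hη : ContDiff ℝ 1 η)
    (hηc : HasCompactSupport η) (hηO : tsupport η ⊆ O) (hh : ContDiffOn ℝ 1 h O)
    (h0 : ∀ z ∈ O, fderiv ℝ η z 1 * h z = 0) {r : ℝ} (hr : ∀ z ∈ tsupport η, |z.re| ≤ r) :
    ∫ z, (η z * h z) ^ 2 ≤ 4 * r ^ 2 * ∫ z, η z ^ 2 * fderiv ℝ h z 1 ^ 2 := by
  have hs : tsupport (fun z => η z * h z) ⊆ tsupport η := tsupport_mul_subset_of_left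
  have h1 := integral_sq_le_of_hasCompactSupport
    (contDiff_mul_of_tsupport_subset (n := 1) hO hη hηO hh) hηc.mul_right
    (fun z hz => hr z (hs hz))
  convert h1 using 5 with z
  by_cases hz : z ∈ tsupport η
  · have d : HasFDerivAt (fun z => η z * h z) _ z :=
      (hη.differentiable (by norm_num) z).hasFDerivAt.mul
        ((hh.contDiffAt (hO.mem_nhds (hηO hz))).differentiableAt (by norm_num)).hasFDerivAt
    rw [d.fderiv]
    simp only [_root_.add_apply, _root_.smul_apply, smul_eq_mul]
    rw [mul_comm (h z), h0 z (hηO hz), add_zero, mul_pow]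
  · rw [fderiv_of_notMem_tsupport (𝕜 := ℝ) (fun h => hz (hs h)),
      image_eq_zero_of_notMem_tsupport hz]
    simp

set_option maxHeartbeats 1000000 in
/-- The minimum principle: the modulus of a nonvanishing gradient is bounded below by its
boundary values. -/
theorem le_norm_cgrad_of_le_frontier {p : ℝ} (hp : 1 < p) {V : Set ℂ} (hV : IsOpen V)
    {u : ℂ → ℝ} (hu : PH p V u) (hne : ∀ z ∈ V, cgrad u z ≠ 0) {D O : Set ℂ} (hD : IsCompact D)
    (hDV : D ⊆ V) (hO : IsOpen O) (hOD : O ⊆ D) {δ : ℝ}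
    (hδ : ∀ z ∈ D \ O, δ ≤ ‖cgrad u z‖) {z : ℂ} (hz : z ∈ D) : δ ≤ ‖cgrad u z‖ := by
  by_contra! hlt
  have hf := hu.continuous_cgrad
  obtain ⟨f, hfdef⟩ : ∃ f, f = cgrad u := ⟨_, rfl⟩
  obtain ⟨C, hC, henergy⟩ := exists_energy_log_norm hp
  obtain ⟨C₁, -, happ⟩ := exists_smooth_approx hp hV hu hne hD hDV
  rw [← hfdef] at hf happ hlt hδ
  have hne' : ∀ z ∈ D, f z ≠ 0 := fun z hz => hfdef ▸ hne z (hDV hz)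
  have hfz : 0 < ‖f z‖ := norm_pos_iff.2 (hne' z hz)
  obtain ⟨δ₂, h2a, h2b⟩ := exists_between hlt
  obtain ⟨δ₁, h1a, h1b⟩ := exists_between h2a
  obtain ⟨δ₀, h0a, h0b⟩ := exists_between h1a
  obtain ⟨δ₃, h3a, h3b⟩ := exists_between h0a
  have hδ₀ : 0 < δ₀ := hfz.trans h0a
  have hδ₁ : 0 < δ₁ := hδ₀.trans h0b
  obtain ⟨m, hm, hmle⟩ : ∃ m > 0, ∀ z ∈ D, m ≤ ‖f z‖ :=
    hD.exists_forall_le' hf.norm.continuousOn (a := 0) (fun z hz => norm_pos_iff.2 (hne' z hz))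
  have hA : IsCompact (D ∩ {z | ‖f z‖ ≤ δ₂}) :=
    hD.inter_right (isClosed_le hf.norm continuous_const)
  have hAO : D ∩ {z | ‖f z‖ ≤ δ₂} ⊆ O := fun y hy => by
    by_contra h
    have h1 := hδ y ⟨hy.1, h⟩
    have h2 : ‖f y‖ ≤ δ₂ := hy.2
    linarith
  obtain ⟨η, hη, hηc, hηO, hη01, O', hO', hAO', hη1⟩ := exists_bump hA hO hAO
  have hη' : ContDiff ℝ 1 η := hη.of_le (by simp)
  have hzA : z ∈ D ∩ {z | ‖f z‖ ≤ δ₂} := ⟨hz, (h1a.trans h1b).le⟩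
  obtain ⟨r, hr, hball⟩ := Metric.isOpen_iff.1 ((hO.inter hO').inter
    (isOpen_lt hf.norm (continuous_const (y := δ₃)))) z ⟨⟨hAO hzA, hAO' hzA⟩, h3a⟩
  obtain ⟨ρ, hρ⟩ := hD.isBounded.exists_norm_le
  have hμ : 0 < volume.real (Metric.ball z r) :=
    ENNReal.toReal_pos (Metric.measure_ball_pos volume z hr).ne' measure_ball_lt_top.ne
  obtain ⟨c, hc⟩ : ∃ c, c = Real.log (δ₁ / δ₀) := ⟨_, rfl⟩
  have hc0 : 0 < c := hc ▸ Real.log_pos (by rwa [one_lt_div hδ₀])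
  obtain ⟨X, hX⟩ : ∃ X, X = |Real.log δ₁ - Real.log (m / 2)| := ⟨_, rfl⟩
  have hX0 : 0 ≤ X := hX ▸ abs_nonneg _
  obtain ⟨A, hAdef⟩ : ∃ A, A = 4 * ρ ^ 2 * (2 * X * (C * (2 * X / (m / 2) ^ 2))) := ⟨_, rfl⟩
  have hA0 : 0 ≤ A := by rw [hAdef]; positivity
  obtain ⟨ε, hε0, hε⟩ : ∃ ε > 0, ε < min (min (m / 2) (δ₂ - δ₁)) (min (δ₀ - δ₃)
      (c ^ 4 * volume.real (Metric.ball z r) / (2 * (A + 1)))) :=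
    exists_between
      (lt_min (lt_min (by positivity) (by linarith)) (lt_min (by linarith) (by positivity)))
  obtain ⟨g, hg, hgf, hcurl, -, hdiv⟩ := happ ε hε0
  simp only [lt_min_iff] at hε
  obtain ⟨⟨hε1, hε2⟩, hε3, hε4⟩ := hε
  have hgm : ∀ y ∈ D, m / 2 ≤ ‖g y‖ := fun y hy => by
    have h1 := hgf y hy
    have h2 := hmle y hy
    have h3 := norm_sub_norm_le (f y) (g y)
    rw [norm_sub_rev] at h3
    linarith
  have hg0 : ∀ y ∈ D, g y ≠ 0 := fun y hy =>
    norm_pos_iff.1 ((by positivity : 0 < m / 2).trans_le (hgm y hy))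
  have hg0' : ∀ y ∈ O, g y ≠ 0 := fun y hy => hg0 y (hOD hy)
  have hmax : ∀ t : ℝ, HasDerivAt (fun t => (max t 0) ^ 2) (2 * max t 0) t :=
    hasDerivAt_comp_max (k := fun x => x ^ 2) (k' := fun x => 2 * x)
      (fun x _ => by simpa using hasDerivAt_pow 2 x) (by simp)
  have hΓ : ∀ t, HasDerivAt (fun t => -(max (Real.log δ₁ - t) 0) ^ 2)
      (2 * max (Real.log δ₁ - t) 0) t := fun t => by
    have := ((hmax (Real.log δ₁ - t)).comp t ((hasDerivAt_id t).const_sub (Real.log δ₁))).neg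
    exact this.congr_deriv (by simp)
  have hΓ'c : Continuous fun t => 2 * max (Real.log δ₁ - t) 0 := by fun_prop
  have hoff : ∀ y ∈ O, ∀ v, fderiv ℝ η y v ≠ 0 → max (Real.log δ₁ - Real.log ‖g y‖) 0 = 0 := by
    intro y hy v hv
    have hyA : y ∉ O' := fun h => hv (by
      rw [(eventuallyEq_of_mem (hO'.mem_nhds h) fun x hx => hη1 x hx :
        η =ᶠ[𝓝 y] fun _ => 1).fderiv_eq]
      simp)
    have h1 : δ₂ < ‖f y‖ := by
      by_contra! h
      exact hyA (hAO' ⟨hOD hy, h⟩)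
    have h2 := hgf y (hOD hy)
    have h3 := norm_sub_norm_le (f y) (g y)
    rw [norm_sub_rev] at h3
    rw [max_eq_right]
    have := Real.log_le_log hδ₁ (by linarith : δ₁ ≤ ‖g y‖)
    linarith
  have hen := henergy g hg hcurl O hO hg0' _ _ hΓ hΓ'c (fun t => by positivity) η (fun _ => 0)
    hη' hηc hηO (by simp) (fun _ => le_rfl) (fun y hy => by
      rcases eq_or_ne (max (Real.log δ₁ - Real.log ‖g y‖) 0) 0 with h | h
      · rw [h]; simp
      · have h1 : ∀ v, fderiv ℝ η y v = 0 := fun v => by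
          by_contra hv
          exact h (hoff y hy v hv)
        simp [h1])
  rw [integral_zero, zero_add] at hen
  have hXle : ∀ y ∈ D, max (Real.log δ₁ - Real.log ‖g y‖) 0 ≤ X := fun y hy => by
    refine max_le ?_ hX0
    have := Real.log_le_log (by positivity) (hgm y hy)
    rw [hX]
    refine le_trans ?_ (le_abs_self _)
    linarith
  have hdef := integral_defect_le (p := p) hg hD (m := m / 2) (B := 2 * X) (by positivity)
    (by positivity) hgm hη01 (hηO.trans hOD)
    (γ' := fun y => 2 * max (Real.log δ₁ - Real.log ‖g y‖) 0)
    (fun y hy => ⟨by positivity, by have := hXle y hy; linarith⟩)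
  have hs := contDiffOn_log_norm hg hg0'
  obtain ⟨h, hh⟩ : ∃ h : ℂ → ℝ, h = fun y => -(max (Real.log δ₁ - Real.log ‖g y‖) 0) ^ 2 :=
    ⟨_, rfl⟩
  have hhC : ContDiffOn ℝ 1 h O := hh ▸ (contDiff_of_hasDerivAt hΓ hΓ'c).comp_contDiffOn hs
  have hfr := integral_sq_cutoff_le hO hη' hηc hηO hhC (fun y hy => by
    rcases eq_or_ne (fderiv ℝ η y 1) 0 with h1 | h1
    · rw [h1, zero_mul]
    · rw [hh]
      simp [hoff y hy 1 h1]) (r := ρ) fun y hy =>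
        (Complex.abs_re_le_norm y).trans (hρ y (hOD (hηO hy)))
  have hre : ∀ v, ContinuousOn (fun z => (lg g v z).re) O := fun v =>
    (contDiffOn_re_lg hg hg0' v).continuousOn
  have hdh : ∫ y, η y ^ 2 * fderiv ℝ h y 1 ^ 2 ≤ 2 * X * ∫ y, η y ^ 2 *
      (2 * max (Real.log δ₁ - Real.log ‖g y‖) 0 *
        ((lg g 1 y).re ^ 2 + (lg g Complex.I y).re ^ 2)) := by
    rw [← integral_const_mul]
    refine integral_mono_of_nonneg (Eventually.of_forall fun y => ?_) (Integrable.const_mul ?_ _)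
      (Eventually.of_forall fun y => ?_)
    · simp only [Pi.zero_apply]
      positivity
    · exact integrable_sq_mul hO hη'.continuous hηc hηO
        ((hΓ'c.comp_continuousOn hs.continuousOn).mul
          (((hre 1).pow 2).add ((hre Complex.I).pow 2)))
    · by_cases hy : y ∈ tsupport η
      · have hyO := hηO hy
        have hdg : DifferentiableAt ℝ g y := hg.differentiable (by norm_num) y
        dsimp only
        rw [hh, fderiv_comp_of_hasDerivAt (s := fun y => Real.log ‖g y‖) (hΓ _)
          (hasFDerivAt_log_norm hdg (hg0' y hyO)).differentiableAt,
          fderiv_log_norm hdg (hg0' y hyO)]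
        have h1 := hXle y (hOD hyO)
        have h2 : 0 ≤ max (Real.log δ₁ - Real.log ‖g y‖) 0 := le_max_right _ _
        generalize max (Real.log δ₁ - Real.log ‖g y‖) 0 = M at *
        have h3 : M ^ 2 * (lg g 1 y).re ^ 2 ≤
            X * M * ((lg g 1 y).re ^ 2 + (lg g Complex.I y).re ^ 2) := by
          have h4 : M ^ 2 ≤ X * M := by nlinarith
          have h5 : (lg g 1 y).re ^ 2 ≤ (lg g 1 y).re ^ 2 + (lg g Complex.I y).re ^ 2 := by
            nlinarith [sq_nonneg (lg g Complex.I y).re]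
          gcongr
        have h6 := mul_le_mul_of_nonneg_left h3 (sq_nonneg (η y))
        nlinarith
      · simp [image_eq_zero_of_notMem_tsupport hy]
  have hlow : c ^ 4 * volume.real (Metric.ball z r) ≤ ∫ y, (η y * h y) ^ 2 := by
    have i : Integrable fun y => (η y * h y) ^ 2 := by
      simp_rw [mul_pow]
      exact integrable_sq_mul hO hη'.continuous hηc hηO (hhC.continuousOn.pow 2)
    calc c ^ 4 * volume.real (Metric.ball z r) = ∫ y in Metric.ball z r, c ^ 4 := by
          rw [setIntegral_const, smul_eq_mul, mul_comm]
      _ ≤ ∫ y in Metric.ball z r, (η y * h y) ^ 2 := by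
          refine setIntegral_mono_on (integrableOn_const measure_ball_lt_top.ne enorm_ne_top) i.integrableOn
            Metric.isOpen_ball.measurableSet fun y hy => ?_
          obtain ⟨⟨hyO, hyO'⟩, hy3⟩ := hball hy
          have hy3' : ‖f y‖ < δ₃ := hy3
          have h1 := hgf y (hOD hyO)
          have h2 := norm_sub_norm_le (g y) (f y)
          have h3 : ‖g y‖ ≤ δ₀ := by linarith
          have h4 := Real.log_le_log (norm_pos_iff.2 (hg0' y hyO)) h3
          have h5 : c ≤ max (Real.log δ₁ - Real.log ‖g y‖) 0 := by
            refine le_trans ?_ (le_max_left _ _)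
            rw [hc, Real.log_div hδ₁.ne' hδ₀.ne']
            linarith
          rw [hη1 y hyO', one_mul, hh]
          have h6 := pow_le_pow_left₀ hc0.le h5 4
          linarith [h6, (by ring : (-(max (Real.log δ₁ - Real.log ‖g y‖) 0) ^ 2) ^ 2 =
            (max (Real.log δ₁ - Real.log ‖g y‖) 0) ^ 4)]
      _ ≤ ∫ y, (η y * h y) ^ 2 := setIntegral_le_integral i (Eventually.of_forall fun y => by
          simp only [Pi.zero_apply]
          positivity)
  have hup : ∫ y, (η y * h y) ^ 2 ≤ A * ε := by
    refine hfr.trans ?_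
    rw [hAdef, mul_assoc (4 * ρ ^ 2), mul_assoc (2 * X), mul_assoc C]
    gcongr
    refine hdh.trans ?_
    gcongr
    refine hen.trans ?_
    gcongr
    refine hdef.trans ?_
    gcongr
  have hpos : 0 < c ^ 4 * volume.real (Metric.ball z r) := by positivity
  rw [lt_div_iff₀ (by positivity)] at hε4
  nlinarith

/-! ### A Harnack type estimate for the gradient -/

/-- The concave weight `t ↦ log (1 + e⁻ᵗ)`. -/
noncomputable def ell (t : ℝ) : ℝ := Real.log (1 + Real.exp (-t))

theorem ell_pos (t : ℝ) : 0 < ell t :=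
  Real.log_pos (by linarith [Real.exp_pos (-t)])

theorem hasDerivAt_ell (t : ℝ) : HasDerivAt ell (-(1 + Real.exp t)⁻¹) t := by
  have h1 : HasDerivAt (fun t => 1 + Real.exp (-t)) (Real.exp (-t) * -1) t :=
    ((hasDerivAt_neg t).exp).const_add 1
  have h2 := h1.log (by positivity)
  refine h2.congr_deriv ?_
  rw [Real.exp_neg]
  field_simp
  ring

theorem continuous_ell : Continuous ell :=
  continuous_iff_continuousAt.2 fun t => (hasDerivAt_ell t).continuousAt

theorem exists_harnack {p : ℝ} (hp : 1 < p) {K O K' : Set ℂ} (hK : IsCompact K) (hO : IsOpen O)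
    (hKO : K ⊆ O) (hOK' : O ⊆ K') (hK' : IsCompact K') :
    ∃ C > 0, ∀ (V : Set ℂ) (u : ℂ → ℝ), IsOpen V → PH p V u → (∀ z ∈ V, cgrad u z ≠ 0) →
      K' ⊆ V → ∀ ε > 0, ∃ g : ℂ → ℂ, ContDiff ℝ 2 g ∧ (∀ z ∈ K', ‖g z - cgrad u z‖ ≤ ε) ∧
      (∀ z ∈ K', g z ≠ 0) ∧ ContDiffOn ℝ 1 (fun z => Real.log (ell (Real.log ‖g z‖))) O ∧
      ∫ z in K, (fderiv ℝ (fun z => Real.log (ell (Real.log ‖g z‖))) z 1 ^ 2 +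
        fderiv ℝ (fun z => Real.log (ell (Real.log ‖g z‖))) z Complex.I ^ 2) ≤
        C * (1 + ∫ z in K', ‖cgrad u z‖) := by
  obtain ⟨C, hC, henergy⟩ := exists_energy_log_norm hp
  obtain ⟨η, hη, hηc, hηO, hη01, O', hO', hKO', hη1⟩ := exists_bump hK hO hKO
  have hη' : ContDiff ℝ 1 η := hη.of_le (by simp)
  have hcη : Continuous fun z => fderiv ℝ η z 1 ^ 2 + fderiv ℝ η z Complex.I ^ 2 :=
    ((continuous_fderiv_apply_of_contDiff hη' 1).pow 2).add
      ((continuous_fderiv_apply_of_contDiff hη' Complex.I).pow 2)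
  obtain ⟨M, hM⟩ := hK'.bddAbove_image hcη.continuousOn
  have hdη : ∀ z ∉ tsupport η, ∀ v, fderiv ℝ η z v = 0 := fun z hz v => by
    rw [fderiv_of_notMem_tsupport (𝕜 := ℝ) hz]; rfl
  obtain ⟨μ, hμ⟩ : ∃ μ, μ = volume.real K' := ⟨_, rfl⟩
  have hμ0 : 0 ≤ μ := hμ ▸ measureReal_nonneg
  refine ⟨C * (|M| * (2 * μ) + |M| + 1), by positivity, fun V u hV hu hne hKV ε hε => ?_⟩
  obtain ⟨C₁, -, happ⟩ := exists_smooth_approx hp hV hu hne hK' hKV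
  have hf := hu.continuous_cgrad
  obtain ⟨f, hfdef⟩ : ∃ f, f = cgrad u := ⟨_, rfl⟩
  rw [← hfdef] at hf happ
  rw [← hfdef]
  have hne' : ∀ z ∈ K', f z ≠ 0 := fun z hz => hfdef ▸ hne z (hKV hz)
  obtain ⟨m, hm, hmle⟩ : ∃ m > 0, ∀ z ∈ K', m ≤ ‖f z‖ :=
    hK'.exists_forall_le' hf.norm.continuousOn (a := 0) (fun z hz => norm_pos_iff.2 (hne' z hz))
  obtain ⟨A, hA⟩ := hK'.bddAbove_image hf.norm.continuousOn
  obtain ⟨Γ', hΓ'⟩ : ∃ Γ' : ℝ → ℝ, Γ' = fun t => (1 + Real.exp t)⁻¹ / ell t ^ 2 := ⟨_, rfl⟩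
  have hΓ'0 : ∀ t, 0 ≤ Γ' t := fun t => by rw [hΓ']; positivity
  have hΓ'c : Continuous Γ' := by
    rw [hΓ']
    refine Continuous.div ((continuous_const.add Real.continuous_exp).inv₀ fun t => ?_)
      (continuous_ell.pow 2) fun t => ?_
    · exact (add_pos one_pos (Real.exp_pos t)).ne'
    · have := ell_pos t
      positivity
  have hΓ : ∀ t, HasDerivAt (fun t => (ell t)⁻¹) (Γ' t) t := fun t =>
    ((hasDerivAt_ell t).inv (ell_pos t).ne').congr_deriv (by rw [hΓ', neg_neg])
  obtain ⟨B, hB⟩ := (isCompact_Icc (a := Real.log (m / 2)) (b := Real.log (A + 1))).bddAbove_image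
    hΓ'c.continuousOn
  obtain ⟨E, hE⟩ : ∃ E, E = |B| / (m / 2) ^ 2 := ⟨_, rfl⟩
  have hE0 : 0 ≤ E := by rw [hE]; positivity
  obtain ⟨ε', hε'0, hε'⟩ : ∃ ε' > 0, ε' < min (min (m / 2) 1) (min ε (1 / (E + 1))) :=
    exists_between (lt_min (lt_min (by positivity) one_pos) (lt_min hε (by positivity)))
  simp only [lt_min_iff] at hε'
  obtain ⟨⟨hε1, hε2⟩, hε3, hε4⟩ := hε'
  obtain ⟨g, hg, hgf, hcurl, -, hdiv⟩ := happ ε' hε'0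
  have hgm : ∀ y ∈ K', m / 2 ≤ ‖g y‖ := fun y hy => by
    have h1 := hgf y hy
    have h2 := hmle y hy
    have h3 := norm_sub_norm_le (f y) (g y)
    rw [norm_sub_rev] at h3
    linarith
  have hgM : ∀ y ∈ K', ‖g y‖ ≤ ‖f y‖ + 1 := fun y hy => by
    have h1 := hgf y hy
    have h3 := norm_sub_norm_le (g y) (f y)
    linarith
  have hg0 : ∀ y ∈ K', g y ≠ 0 := fun y hy =>
    norm_pos_iff.1 ((by positivity : 0 < m / 2).trans_le (hgm y hy))
  have hg0' : ∀ y ∈ O, g y ≠ 0 := fun y hy => hg0 y (hOK' hy)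
  have hs := contDiffOn_log_norm hg hg0'
  have hΛ : ∀ t, HasDerivAt (fun t => Real.log (ell t)) (-(1 + Real.exp t)⁻¹ / ell t) t :=
    fun t => (hasDerivAt_ell t).log (ell_pos t).ne'
  have hΛ'c : Continuous fun t => -(1 + Real.exp t)⁻¹ / ell t := by
    refine Continuous.div ((continuous_const.add Real.continuous_exp).inv₀ fun t => ?_).neg
      continuous_ell fun t => (ell_pos t).ne'
    exact (add_pos one_pos (Real.exp_pos t)).ne'
  refine ⟨g, hg, fun z hz => (hgf z hz).trans hε3.le, hg0,
    (contDiff_of_hasDerivAt hΛ hΛ'c).comp_contDiffOn hs, ?_⟩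
  obtain ⟨G, hG⟩ : ∃ G : ℂ → ℝ, G = fun z =>
    (fderiv ℝ η z 1 ^ 2 + fderiv ℝ η z Complex.I ^ 2) * (1 + ‖g z‖) := ⟨_, rfl⟩
  have hG0 : ∀ z, 0 ≤ G z := fun z => by rw [hG]; positivity
  have hGc : Continuous G := hG ▸ hcη.mul (continuous_const.add hg.continuous.norm)
  have hGs : ∀ z ∉ tsupport η, G z = 0 := fun z hz => by
    rw [hG]
    simp [hdη z hz]
  have hGi : Integrable G := integrable_of_tsupport hGc hηc hGs
  have hen := henergy g hg hcurl O hO hg0' _ _ hΓ hΓ'c hΓ'0 η G hη' hηc hηO hGi hG0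
    (fun y hy => by
      have hn : 0 < ‖g y‖ := norm_pos_iff.2 (hg0' y hy)
      have := ell_pos (Real.log ‖g y‖)
      rw [hΓ', hG]
      simp only [Real.exp_log hn]
      refine le_of_eq ?_
      field_simp)
  have hdef := integral_defect_le (p := p) hg hK' (m := m / 2) (B := |B|) (by positivity)
    (abs_nonneg B) hgm hη01 (hηO.trans hOK') (γ' := fun y => Γ' (Real.log ‖g y‖))
    (fun y hy => ⟨hΓ'0 _, (hB (mem_image_of_mem _ ⟨Real.log_le_log (by positivity) (hgm y hy),
      Real.log_le_log (norm_pos_iff.2 (hg0 y hy)) ((hgM y hy).trans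
        (add_le_add_left (hA (mem_image_of_mem _ hy)) 1))⟩)).trans (le_abs_self B)⟩)
  have hGle : ∫ z, G z ≤ |M| * (2 * μ + ∫ z in K', ‖f z‖) := by
    have i2 : IntegrableOn (fun z => (2 : ℝ)) K' := integrableOn_const hK'.measure_lt_top.ne
    have i3 : IntegrableOn (fun z => ‖f z‖) K' := hf.norm.continuousOn.integrableOn_compact hK'
    have e : ∫ z in K', |M| * (2 + ‖f z‖) = |M| * (2 * μ + ∫ z in K', ‖f z‖) := by
      rw [integral_const_mul, integral_add i2 i3, setIntegral_const, smul_eq_mul, hμ, mul_comm 2]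
    rw [← e, ← setIntegral_eq_integral_of_forall_compl_eq_zero
      fun z hz => hGs z fun h => hz (hOK' (hηO h))]
    refine setIntegral_mono_of_nonneg hK'.measurableSet (fun z _ => hG0 z)
      ((i2.add i3).const_mul _) fun z hz => ?_
    rw [hG]
    have h1 := (hM (mem_image_of_mem _ hz)).trans (le_abs_self M)
    have h2 := hgM z hz
    exact mul_le_mul h1 (by linarith) (by positivity) (abs_nonneg M)
  have hdiv1 : |B| / (m / 2) ^ 2 *
      ∫ z in K', divLin p (g z) (fderiv ℝ g z 1) (fderiv ℝ g z Complex.I) ^ 2 ≤ 1 := by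
    rw [← hE]
    rw [lt_div_iff₀ (by positivity)] at hε4
    nlinarith
  have hre : ∀ v, ContinuousOn (fun z => (lg g v z).re) O := fun v =>
    (contDiffOn_re_lg hg hg0' v).continuousOn
  have hi : Integrable fun z => η z ^ 2 * (Γ' (Real.log ‖g z‖) *
      ((lg g 1 z).re ^ 2 + (lg g Complex.I z).re ^ 2)) :=
    integrable_sq_mul hO hη'.continuous hηc hηO
      ((hΓ'c.comp_continuousOn hs.continuousOn).mul
        (((hre 1).pow 2).add ((hre Complex.I).pow 2)))
  calc _ ≤ ∫ z in K, η z ^ 2 * (Γ' (Real.log ‖g z‖) *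
        ((lg g 1 z).re ^ 2 + (lg g Complex.I z).re ^ 2)) := by
        refine setIntegral_mono_of_nonneg hK.measurableSet (fun z _ => by positivity)
          hi.integrableOn fun z hz => ?_
        have hdg : DifferentiableAt ℝ g z := hg.differentiable (by norm_num) z
        have hn := hg0' z (hKO hz)
        have hd : ∀ v, fderiv ℝ (fun z => Real.log (ell (Real.log ‖g z‖))) z v =
            -(1 + Real.exp (Real.log ‖g z‖))⁻¹ / ell (Real.log ‖g z‖) * (lg g v z).re :=
          fun v => by
            rw [fderiv_comp_of_hasDerivAt (s := fun y => Real.log ‖g y‖) (hΛ _)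
              (hasFDerivAt_log_norm hdg hn).differentiableAt, fderiv_log_norm hdg hn]
        rw [hd, hd, hη1 z (hKO' hz), one_pow, one_mul, mul_pow, mul_pow, ← mul_add, hΓ']
        refine mul_le_mul_of_nonneg_right ?_ (by positivity)
        have h1 : (1 + Real.exp (Real.log ‖g z‖))⁻¹ ≤ 1 :=
          inv_le_one_of_one_le₀ (by linarith [Real.exp_pos (Real.log ‖g z‖)])
        have h2 : 0 ≤ (1 + Real.exp (Real.log ‖g z‖))⁻¹ := by positivity
        rw [div_pow, neg_sq]
        dsimp only
        gcongr
        nlinarith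
    _ ≤ ∫ z, η z ^ 2 * (Γ' (Real.log ‖g z‖) *
        ((lg g 1 z).re ^ 2 + (lg g Complex.I z).re ^ 2)) :=
        setIntegral_le_integral hi (Eventually.of_forall fun z => by
          have := hΓ'0 (Real.log ‖g z‖)
          simp only [Pi.zero_apply]
          positivity)
    _ ≤ C * (|M| * (2 * μ + ∫ z in K', ‖f z‖) + 1) := by
        refine hen.trans ?_
        gcongr
        exact hdef.trans hdiv1
    _ ≤ _ := by
        have hI : 0 ≤ ∫ z in K', ‖f z‖ := integral_nonneg fun z => norm_nonneg _
        rw [mul_assoc]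
        refine mul_le_mul_of_nonneg_left ?_ hC.le
        have h1 : 0 ≤ |M| * (2 * μ) * ∫ z in K', ‖f z‖ := by positivity
        have h2 : 0 ≤ |M| := abs_nonneg M
        nlinarith

/-! ### Rectangles with controlled oscillation on the boundary -/

theorem setIntegral_reProdIm {s t : Set ℝ} (G : ℂ → ℝ) :
    ∫ z in s ×ℂ t, G z = ∫ q in s ×ˢ t, G ⟨q.1, q.2⟩ :=
  Complex.volume_preserving_equiv_real_prod.setIntegral_preimage_emb
    Complex.measurableEquivRealProd.measurableEmbedding (fun q : ℝ × ℝ => G ⟨q.1, q.2⟩) (s ×ˢ t)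

theorem exists_mul_setIntegral_le {G : ℝ × ℝ → ℝ} {x₀ x₁ y₀ y₁ a b : ℝ}
    (hG : ContinuousOn G (Icc x₀ x₁ ×ˢ Icc y₀ y₁)) (h0 : ∀ q ∈ Icc x₀ x₁ ×ˢ Icc y₀ y₁, 0 ≤ G q)
    (ha : x₀ ≤ a) (hab : a < b) (hb : b ≤ x₁) :
    ∃ x ∈ Icc a b, (b - a) * ∫ y in Icc y₀ y₁, G (x, y) ≤ ∫ q in Icc x₀ x₁ ×ˢ Icc y₀ y₁, G q := by
  have hi : IntegrableOn G (Icc x₀ x₁ ×ˢ Icc y₀ y₁) :=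
    hG.integrableOn_compact (isCompact_Icc.prod isCompact_Icc)
  have hi' : Integrable G ((volume.restrict (Icc x₀ x₁)).prod (volume.restrict (Icc y₀ y₁))) := by
    rw [Measure.prod_restrict]
    exact hi
  have hF : IntegrableOn (fun x => ∫ y in Icc y₀ y₁, G (x, y)) (Icc x₀ x₁) :=
    hi'.integral_prod_left
  have hsub : Icc a b ⊆ Icc x₀ x₁ := Icc_subset_Icc ha hb
  have hvol : volume.real (Icc a b) = b - a := by
    rw [Real.volume_real_Icc_of_le hab.le]
  have hpos : 0 < b - a := by linarith
  obtain ⟨x, hx, hle⟩ := exists_le_setAverage (μ := volume) (s := Icc a b)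
    (by simp [hab]) (by simp) (hF.mono_set hsub)
  refine ⟨x, hx, ?_⟩
  rw [setAverage_eq, hvol, smul_eq_mul] at hle
  calc _ ≤ (b - a) * ((b - a)⁻¹ * ∫ x in Icc a b, ∫ y in Icc y₀ y₁, G (x, y)) := by gcongr
    _ = ∫ x in Icc a b, ∫ y in Icc y₀ y₁, G (x, y) := by field_simp
    _ ≤ ∫ x in Icc x₀ x₁, ∫ y in Icc y₀ y₁, G (x, y) := by
        refine setIntegral_mono_set hF (ae_restrict_of_forall_mem measurableSet_Icc fun x hx => ?_)
          hsub.eventuallyLE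
        exact setIntegral_nonneg measurableSet_Icc fun y hy => h0 _ ⟨hx, hy⟩
    _ = ∫ q in Icc x₀ x₁ ×ˢ Icc y₀ y₁, G q := (setIntegral_prod G hi).symm

theorem exists_vertical_line {G : ℂ → ℝ} {x₀ x₁ y₀ y₁ a b : ℝ}
    (hG : ContinuousOn G (Icc x₀ x₁ ×ℂ Icc y₀ y₁)) (h0 : ∀ z ∈ Icc x₀ x₁ ×ℂ Icc y₀ y₁, 0 ≤ G z)
    (ha : x₀ ≤ a) (hab : a < b) (hb : b ≤ x₁) :
    ∃ x ∈ Icc a b, (b - a) * ∫ y in Icc y₀ y₁, G ⟨x, y⟩ ≤ ∫ z in Icc x₀ x₁ ×ℂ Icc y₀ y₁, G z := by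
  rw [setIntegral_reProdIm]
  refine exists_mul_setIntegral_le (G := fun q : ℝ × ℝ => G ⟨q.1, q.2⟩) ?_
    (fun q hq => h0 _ hq) ha hab hb
  exact hG.comp Complex.equivRealProdCLM.symm.continuous.continuousOn fun q hq => hq

theorem exists_horizontal_line {G : ℂ → ℝ} {x₀ x₁ y₀ y₁ a b : ℝ}
    (hG : ContinuousOn G (Icc x₀ x₁ ×ℂ Icc y₀ y₁)) (h0 : ∀ z ∈ Icc x₀ x₁ ×ℂ Icc y₀ y₁, 0 ≤ G z)
    (ha : y₀ ≤ a) (hab : a < b) (hb : b ≤ y₁) :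
    ∃ y ∈ Icc a b, (b - a) * ∫ x in Icc x₀ x₁, G ⟨x, y⟩ ≤ ∫ z in Icc x₀ x₁ ×ℂ Icc y₀ y₁, G z := by
  rw [setIntegral_reProdIm]
  have hsw : ∫ q in Icc x₀ x₁ ×ˢ Icc y₀ y₁, G ⟨q.1, q.2⟩ =
      ∫ q in Icc y₀ y₁ ×ˢ Icc x₀ x₁, G ⟨q.2, q.1⟩ := by
    exact (setIntegral_prod_swap (Icc x₀ x₁) (Icc y₀ y₁) fun q : ℝ × ℝ => G ⟨q.1, q.2⟩).symm
  rw [hsw]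
  refine exists_mul_setIntegral_le (G := fun q : ℝ × ℝ => G ⟨q.2, q.1⟩) ?_
    (fun q hq => h0 _ ⟨hq.2, hq.1⟩) ha hab hb
  exact hG.comp (Complex.equivRealProdCLM.symm.continuous.comp continuous_swap).continuousOn
    fun q hq => ⟨hq.2, hq.1⟩

theorem abs_sub_le_setIntegral {H : ℂ → ℝ} {O : Set ℂ} (hO : IsOpen O) (hH : ContDiffOn ℝ 1 H O)
    {z v : ℂ} {a b : ℝ} {k : ℝ → ℝ} (hk : ContinuousOn k (Icc a b))
    (hmem : ∀ t ∈ Icc a b, z + t * v ∈ O)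
    (hle : ∀ t ∈ Icc a b, |fderiv ℝ H (z + t * v) v| ≤ k t) {t₁ t₂ : ℝ} (h₁ : t₁ ∈ Icc a b)
    (h₂ : t₂ ∈ Icc a b) :
    |H (z + t₁ * v) - H (z + t₂ * v)| ≤ ∫ t in Icc a b, k t := by
  wlog h : t₂ ≤ t₁ generalizing t₁ t₂
  · rw [abs_sub_comm]
    exact this h₂ h₁ (le_of_not_ge h)
  have hsub : Icc t₂ t₁ ⊆ Icc a b := Icc_subset_Icc h₂.1 h₁.2
  have hd : ∀ t ∈ uIcc t₂ t₁, HasDerivAt (fun t : ℝ => H (z + t * v))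
      (fderiv ℝ H (z + t * v) v) t := fun t ht => by
    rw [uIcc_of_le h] at ht
    have h1 := ((hH.contDiffAt (hO.mem_nhds (hmem t (hsub ht)))).differentiableAt
      (by norm_num)).hasFDerivAt
    have h2 : HasDerivAt (fun t : ℝ => z + t * v) v t := by
      have := ((Complex.ofRealCLM.hasDerivAt (x := t)).mul_const v).const_add z
      simpa using this
    exact h1.comp_hasDerivAt t h2
  have hline : Continuous fun t : ℝ => z + t * v := by fun_prop
  have hc : ContinuousOn (fun t : ℝ => fderiv ℝ H (z + t * v) v) (Icc a b) :=
    ((hH.continuousOn_fderiv_of_isOpen hO le_rfl).comp hline.continuousOn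
      fun t ht => hmem t ht).clm_apply continuousOn_const
  have hi : IntervalIntegrable (fun t : ℝ => fderiv ℝ H (z + t * v) v) volume t₂ t₁ :=
    ContinuousOn.intervalIntegrable (by rw [uIcc_of_le h]; exact hc.mono hsub)
  rw [← intervalIntegral.integral_eq_sub_of_hasDerivAt hd hi, intervalIntegral.integral_of_le h,
    ← integral_Icc_eq_integral_Ioc, ← Real.norm_eq_abs]
  refine (norm_integral_le_integral_norm _).trans ?_
  have hki : IntegrableOn k (Icc a b) := hk.integrableOn_Icc
  calc _ ≤ ∫ t in Icc t₂ t₁, k t :=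
        setIntegral_mono_on ((hc.mono hsub).norm.integrableOn_Icc) (hki.mono_set hsub)
          measurableSet_Icc fun t ht => hle t (hsub ht)
    _ ≤ _ := setIntegral_mono_set hki (ae_restrict_of_forall_mem measurableSet_Icc fun t ht =>
        (abs_nonneg _).trans (hle t ht)) hsub.eventuallyLE

/-- Any rectangle family carrying an integral bound for the gradient of `H` contains a rectangle
on whose boundary `H` has controlled oscillation. -/
theorem exists_frame {β a C : ℝ} (hβ : 0 < β) (ha : 2 * β ≤ a) {O : Set ℂ} (hO : IsOpen O)
    (hQO : Icc (-(2 * β)) (a + β) ×ℂ Icc (-(2 * β)) (2 * β) ⊆ O) {H G : ℂ → ℝ}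
    (hH : ContDiffOn ℝ 1 H O)
    (hG : ContinuousOn G (Icc (-(2 * β)) (a + β) ×ℂ Icc (-(2 * β)) (2 * β)))
    (h1 : ∀ z ∈ Icc (-(2 * β)) (a + β) ×ℂ Icc (-(2 * β)) (2 * β), |fderiv ℝ H z 1| ≤ G z)
    (h2 : ∀ z ∈ Icc (-(2 * β)) (a + β) ×ℂ Icc (-(2 * β)) (2 * β), |fderiv ℝ H z Complex.I| ≤ G z)
    (hC : ∫ z in Icc (-(2 * β)) (a + β) ×ℂ Icc (-(2 * β)) (2 * β), G z ≤ C) :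
    ∃ a₁ ∈ Icc (-(2 * β)) (-β), ∃ a₂ ∈ Icc (a - β) (a + β), ∃ b₁ ∈ Icc (-(2 * β)) (-β),
      ∃ b₂ ∈ Icc β (2 * β),
      (∀ z ∈ (Icc a₁ a₂ ×ℂ Icc b₁ b₂) \ (Ioo a₁ a₂ ×ℂ Ioo b₁ b₂),
        ∀ w ∈ (Icc a₁ a₂ ×ℂ Icc b₁ b₂) \ (Ioo a₁ a₂ ×ℂ Ioo b₁ b₂), |H z - H w| ≤ 4 * (C / β)) ∧
      ∫ y in Icc (-(2 * β)) (2 * β), G ⟨a₂, y⟩ ≤ C / β := by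
  have hG0 : ∀ z ∈ Icc (-(2 * β)) (a + β) ×ℂ Icc (-(2 * β)) (2 * β), 0 ≤ G z :=
    fun z hz => (abs_nonneg _).trans (h1 z hz)
  have hCβ : ∀ I L, 0 ≤ I → β ≤ L → L * I ≤ C → I ≤ C / β := fun I L hI hL h => by
    rw [le_div_iff₀ hβ]
    nlinarith
  obtain ⟨a₁, ha₁, e₁⟩ := exists_vertical_line hG hG0 (a := -(2 * β)) (b := -β) le_rfl
    (by linarith) (by linarith)
  obtain ⟨a₂, ha₂, e₂⟩ := exists_vertical_line hG hG0 (a := a - β) (b := a + β) (by linarith)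
    (by linarith) le_rfl
  obtain ⟨b₁, hb₁, e₃⟩ := exists_horizontal_line hG hG0 (a := -(2 * β)) (b := -β) le_rfl
    (by linarith) (by linarith)
  obtain ⟨b₂, hb₂, e₄⟩ := exists_horizontal_line hG hG0 (a := β) (b := 2 * β) (by linarith)
    (by linarith) le_rfl
  have hxa₁ : a₁ ∈ Icc (-(2 * β)) (a + β) := ⟨ha₁.1, by linarith [ha₁.2]⟩
  have hxa₂ : a₂ ∈ Icc (-(2 * β)) (a + β) := ⟨by linarith [ha₂.1], ha₂.2⟩
  have hyb₁ : b₁ ∈ Icc (-(2 * β)) (2 * β) := ⟨hb₁.1, by linarith [hb₁.2]⟩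
  have hyb₂ : b₂ ∈ Icc (-(2 * β)) (2 * β) := ⟨by linarith [hb₂.1], hb₂.2⟩
  have hV0 : ∀ x ∈ Icc (-(2 * β)) (a + β), 0 ≤ ∫ y in Icc (-(2 * β)) (2 * β), G ⟨x, y⟩ :=
    fun x hx => setIntegral_nonneg measurableSet_Icc fun y hy => hG0 _ ⟨hx, hy⟩
  have hH0 : ∀ y ∈ Icc (-(2 * β)) (2 * β), 0 ≤ ∫ x in Icc (-(2 * β)) (a + β), G ⟨x, y⟩ :=
    fun y hy => setIntegral_nonneg measurableSet_Icc fun x hx => hG0 _ ⟨hx, hy⟩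
  have k₁ := hCβ _ _ (hV0 a₁ hxa₁) (by linarith) (e₁.trans hC)
  have k₂ := hCβ _ _ (hV0 a₂ hxa₂) (by linarith) (e₂.trans hC)
  have k₃ := hCβ _ _ (hH0 b₁ hyb₁) (by linarith) (e₃.trans hC)
  have k₄ := hCβ _ _ (hH0 b₂ hyb₂) (by linarith) (e₄.trans hC)
  have hv : ∀ x ∈ Icc (-(2 * β)) (a + β), ∀ y ∈ Icc (-(2 * β)) (2 * β),
      ∀ y' ∈ Icc (-(2 * β)) (2 * β),
      |H ⟨x, y⟩ - H ⟨x, y'⟩| ≤ ∫ y in Icc (-(2 * β)) (2 * β), G ⟨x, y⟩ := by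
    intro x hx y hy y' hy'
    have e : ∀ t : ℝ, (x : ℂ) + t * Complex.I = ⟨x, t⟩ := fun t => by
      apply Complex.ext <;> simp
    have hline : Continuous fun t : ℝ => (⟨x, t⟩ : ℂ) := by
      simp_rw [← e]
      fun_prop
    have := abs_sub_le_setIntegral hO hH (z := x) (v := Complex.I)
      (k := fun t => G ⟨x, t⟩) (hG.comp hline.continuousOn fun t ht => ⟨hx, ht⟩)
      (fun t ht => by rw [e]; exact hQO ⟨hx, ht⟩) (fun t ht => by rw [e]; exact h2 _ ⟨hx, ht⟩)
      hy hy'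
    rwa [e, e] at this
  have hh : ∀ y ∈ Icc (-(2 * β)) (2 * β), ∀ x ∈ Icc (-(2 * β)) (a + β),
      ∀ x' ∈ Icc (-(2 * β)) (a + β),
      |H ⟨x, y⟩ - H ⟨x', y⟩| ≤ ∫ x in Icc (-(2 * β)) (a + β), G ⟨x, y⟩ := by
    intro y hy x hx x' hx'
    have e : ∀ t : ℝ, (y : ℂ) * Complex.I + t * 1 = ⟨t, y⟩ := fun t => by
      apply Complex.ext <;> simp
    have hline : Continuous fun t : ℝ => (⟨t, y⟩ : ℂ) := by
      simp_rw [← e]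
      fun_prop
    have := abs_sub_le_setIntegral hO hH (z := y * Complex.I) (v := 1)
      (k := fun t => G ⟨t, y⟩) (hG.comp hline.continuousOn fun t ht => ⟨ht, hy⟩)
      (fun t ht => by rw [e]; exact hQO ⟨ht, hy⟩) (fun t ht => by rw [e]; exact h1 _ ⟨ht, hy⟩)
      hx hx'
    rwa [e, e] at this
  refine ⟨a₁, ha₁, a₂, ha₂, b₁, hb₁, b₂, hb₂, ?_, k₂⟩
  have hcorner : ∀ z ∈ (Icc a₁ a₂ ×ℂ Icc b₁ b₂) \ (Ioo a₁ a₂ ×ℂ Ioo b₁ b₂),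
      |H z - H ⟨a₁, b₁⟩| ≤ 2 * (C / β) := by
    rintro ⟨x, y⟩ ⟨⟨hx, hy⟩, hn⟩
    simp only [mem_preimage] at hx hy
    have hx' : x ∈ Icc (-(2 * β)) (a + β) := ⟨ha₁.1.trans hx.1, hx.2.trans ha₂.2⟩
    have hy' : y ∈ Icc (-(2 * β)) (2 * β) := ⟨hb₁.1.trans hy.1, hy.2.trans hb₂.2⟩
    have hpos : 0 ≤ C / β := (hV0 a₁ hxa₁).trans k₁
    have hcases : x = a₁ ∨ x = a₂ ∨ y = b₁ ∨ y = b₂ := by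
      by_contra! h
      exact hn ⟨⟨lt_of_le_of_ne hx.1 h.1.symm, lt_of_le_of_ne hx.2 h.2.1⟩,
        ⟨lt_of_le_of_ne hy.1 h.2.2.1.symm, lt_of_le_of_ne hy.2 h.2.2.2⟩⟩
    rcases hcases with rfl | rfl | rfl | rfl
    · linarith [hv x hx' y hy' b₁ hyb₁]
    · have g1 := hv x hx' y hy' b₁ hyb₁
      have g2 := hh b₁ hyb₁ x hx' a₁ hxa₁
      linarith [abs_sub_le (H ⟨x, y⟩) (H ⟨x, b₁⟩) (H ⟨a₁, b₁⟩)]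
    · linarith [hh y hy' x hx' a₁ hxa₁]
    · have g1 := hh y hy' x hx' a₁ hxa₁
      have g2 := hv a₁ hxa₁ y hy' b₁ hyb₁
      linarith [abs_sub_le (H ⟨x, y⟩) (H ⟨a₁, y⟩) (H ⟨a₁, b₁⟩)]
  intro z hz w hw
  have g1 := hcorner z hz
  have g2 := hcorner w hw
  rw [abs_sub_comm] at g2
  linarith [abs_sub_le (H z) (H ⟨a₁, b₁⟩) (H w)]

/-! ### Zeros of the gradient of a limit -/

theorem ell_antitone : Antitone ell := fun s t hst => by
  unfold ell
  have := Real.exp_pos (-t)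
  gcongr

theorem neg_le_ell (t : ℝ) : -t ≤ ell t := by
  unfold ell
  rw [Real.le_log_iff_exp_le (by positivity)]
  linarith

/-- The frames produced by `exists_frame` lie in a ball. -/
theorem reProdIm_subset_ball {β a r : ℝ} (hβ : 0 < β) (ha : 2 * β ≤ a) (hr : 3 * a < r) :
    Icc (-(2 * β)) (a + β) ×ℂ Icc (-(2 * β)) (2 * β) ⊆ Metric.ball 0 r := by
  rintro z ⟨⟨h1, h2⟩, h3, h4⟩
  rw [mem_ball_zero_iff]
  have h5 : |z.re| ≤ a + β := abs_le.2 ⟨by linarith, h2⟩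
  have h6 : |z.im| ≤ 2 * β := abs_le.2 ⟨h3, h4⟩
  linarith [Complex.norm_le_abs_re_add_abs_im z]

set_option maxHeartbeats 1000000 in
theorem cgrad_zero_ne_zero_of_tendstoUniformlyOn {p : ℝ} (hp : 1 < p) {R : ℝ} {u : ℂ → ℝ}
    (hu : PH p (Metric.ball 0 R) u) {w : ℕ → ℂ → ℝ} (hw : ∀ n, PH p (Metric.ball 0 R) (w n))
    (hlim : TendstoUniformlyOn w u atTop (Metric.ball 0 R))
    (hne : ∀ n, ∀ z ∈ Metric.ball (0 : ℂ) R, cgrad (w n) z ≠ 0) {a : ℝ} (ha : 0 < a)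
    (haR : 6 * a < R) (hfa : cgrad u a ≠ 0) : cgrad u 0 ≠ 0 := by
  intro hf0
  have hV : IsOpen (Metric.ball (0 : ℂ) R) := Metric.isOpen_ball
  have hf := hu.continuous_cgrad
  obtain ⟨f, hfdef⟩ : ∃ f, f = cgrad u := ⟨_, rfl⟩
  rw [← hfdef] at hf0 hf hfa
  have hK' : IsCompact (Metric.closedBall (0 : ℂ) (R / 2)) := isCompact_closedBall _ _
  have hK'V : Metric.closedBall (0 : ℂ) (R / 2) ⊆ Metric.ball 0 R :=
    Metric.closedBall_subset_ball (by linarith)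
  have hL := tendsto_integral_norm_cgrad_sub hp hV hu hw hlim hK' hK'V
  rw [← hfdef] at hL
  -- the region where `f` is bounded below
  obtain ⟨δ, hδ⟩ : ∃ δ, δ = ‖f a‖ / 4 := ⟨_, rfl⟩
  have hδ0 : 0 < δ := by have := norm_pos_iff.2 hfa; rw [hδ]; positivity
  obtain ⟨ρ, hρ, hfρ⟩ : ∃ ρ > 0, ∀ z : ℂ, ‖z - a‖ < ρ → 3 * δ ≤ ‖f z‖ := by
    obtain ⟨ρ, hρ, h⟩ := Metric.continuous_iff.1 hf a δ hδ0
    refine ⟨ρ, hρ, fun z hz => ?_⟩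
    have h1 := h z (by rwa [dist_eq_norm])
    rw [dist_eq_norm] at h1
    have h2 := norm_sub_norm_le (f a) (f z)
    rw [norm_sub_rev] at h2
    linarith
  obtain ⟨β, hβdef⟩ : ∃ β, β = min (a / 2) (ρ / 4) := ⟨_, rfl⟩
  have hβ : 0 < β := hβdef ▸ lt_min (by positivity) (by positivity)
  have hβa : 2 * β ≤ a := by have := hβdef.trans_le (min_le_left _ _); linarith
  have hβρ : 2 * β < ρ := by have := hβdef.trans_le (min_le_right _ _); linarith
  obtain ⟨Q, hQ⟩ : ∃ Q, Q = Icc (-(2 * β)) (a + β) ×ℂ Icc (-(2 * β)) (2 * β) := ⟨_, rfl⟩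
  have hQc : IsCompact Q := hQ ▸ isCompact_Icc.reProdIm isCompact_Icc
  have hQO : Q ⊆ Metric.ball 0 (R / 2) := hQ ▸ reProdIm_subset_ball hβ hβa (by linarith)
  obtain ⟨C₀, hC₀, hH⟩ := exists_harnack hp hQc Metric.isOpen_ball hQO
    Metric.ball_subset_closedBall hK'
  obtain ⟨M, hM⟩ : ∃ M, M = ∫ z in Metric.closedBall (0 : ℂ) (R / 2), ‖f z‖ := ⟨_, rfl⟩
  have hM0 : 0 ≤ M := hM ▸ integral_nonneg fun z => norm_nonneg _
  obtain ⟨C, hC⟩ : ∃ C, C = volume.real Q + C₀ * (2 + M) + 1 := ⟨_, rfl⟩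
  have hC0 : 0 < C := by
    have : 0 ≤ volume.real Q := measureReal_nonneg
    rw [hC]; positivity
  obtain ⟨Λ, hΛ⟩ : ∃ Λ, Λ = C / (β ^ 2 * δ) := ⟨_, rfl⟩
  have hΛ0 : 0 < Λ := by rw [hΛ]; positivity
  obtain ⟨δ', hδ'⟩ : ∃ δ', δ' = Real.exp (-(ell (Real.log δ) * Real.exp (4 * (C / β)))) :=
    ⟨_, rfl⟩
  have hδ'0 : 0 < δ' := hδ' ▸ Real.exp_pos _
  obtain ⟨r, hr, hfr⟩ : ∃ r > 0, ∀ z, ‖z‖ < r → ‖f z‖ < δ' / 4 := by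
    obtain ⟨r, hr, h⟩ := Metric.continuous_iff.1 hf 0 (δ' / 4) (by positivity)
    refine ⟨r, hr, fun z hz => ?_⟩
    have := h z (by rwa [dist_zero_right])
    rwa [hf0, dist_zero_right] at this
  obtain ⟨r', hr'⟩ : ∃ r', r' = min r β := ⟨_, rfl⟩
  have hr'0 : 0 < r' := hr' ▸ lt_min hr hβ
  have hr'r : r' ≤ r := hr' ▸ min_le_left _ _
  have hr'β : r' ≤ β := hr' ▸ min_le_right _ _
  have hvol : 0 < volume.real (Metric.ball (0 : ℂ) r') :=
    ENNReal.toReal_pos (Metric.measure_ball_pos volume _ hr'0).ne' measure_ball_lt_top.ne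
  -- an index for which the gradients are close in mean
  obtain ⟨τ, hτ0, hτ⟩ : ∃ τ > 0, τ < min (min 1 (1 / Λ))
      (volume.real (Metric.ball (0 : ℂ) r') * (δ' / 4)) :=
    exists_between (lt_min (lt_min one_pos (by positivity)) (by positivity))
  simp only [lt_min_iff] at hτ
  obtain ⟨⟨hτ1, hτΛ⟩, hτv⟩ := hτ
  obtain ⟨n, hn⟩ := (hL.eventually_lt_const hτ0).exists
  have hfn := (hw n).continuous_cgrad
  have hcd : Continuous fun z => ‖cgrad (w n) z - f z‖ := (hfn.sub hf).norm
  have hid : IntegrableOn (fun z => ‖cgrad (w n) z - f z‖) (Metric.closedBall 0 (R / 2)) :=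
    hcd.continuousOn.integrableOn_compact hK'
  obtain ⟨ε, hε0, hε⟩ : ∃ ε > 0, ε < min δ (δ' / 2) :=
    exists_between (lt_min hδ0 (by positivity))
  rw [lt_min_iff] at hε
  obtain ⟨g, hg, hgf, hg0, hHc, hHi⟩ := hH _ (w n) hV (hw n) (hne n) hK'V ε hε0
  obtain ⟨H, hHdef⟩ : ∃ H : ℂ → ℝ, H = fun z => Real.log (ell (Real.log ‖g z‖)) := ⟨_, rfl⟩
  rw [← hHdef] at hHc hHi
  have hMn : ∫ z in Metric.closedBall (0 : ℂ) (R / 2), ‖cgrad (w n) z‖ ≤ 1 + M := by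
    have i1 : IntegrableOn (fun z => ‖f z‖) (Metric.closedBall 0 (R / 2)) :=
      hf.norm.continuousOn.integrableOn_compact hK'
    calc _ ≤ ∫ z in Metric.closedBall (0 : ℂ) (R / 2), (‖cgrad (w n) z - f z‖ + ‖f z‖) :=
          setIntegral_mono_of_nonneg hK'.measurableSet (fun z _ => norm_nonneg _) (hid.add i1)
            fun z _ => norm_le_norm_sub_add _ _
      _ ≤ _ := by
          rw [integral_add hid i1, ← hM]
          linarith
  obtain ⟨G, hG⟩ : ∃ G : ℂ → ℝ, G = fun z => 1 + ((fderiv ℝ H z 1) ^ 2 +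
    (fderiv ℝ H z Complex.I) ^ 2) + Λ * ‖cgrad (w n) z - f z‖ := ⟨_, rfl⟩
  have hHd : ∀ v, ContinuousOn (fun z => fderiv ℝ H z v) Q := fun v =>
    ((hHc.continuousOn_fderiv_of_isOpen Metric.isOpen_ball le_rfl).mono hQO).clm_apply
      continuousOn_const
  have hHs : ContinuousOn (fun z => (fderiv ℝ H z 1) ^ 2 + (fderiv ℝ H z Complex.I) ^ 2) Q :=
    ((hHd 1).pow 2).add ((hHd Complex.I).pow 2)
  have hGc : ContinuousOn G Q := by
    rw [hG]
    exact (continuousOn_const.add hHs).add (continuousOn_const.mul hcd.continuousOn)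
  have hG1 : ∀ z ∈ Q, |fderiv ℝ H z 1| ≤ G z := fun z _ => by
    have h1 : 0 ≤ Λ * ‖cgrad (w n) z - f z‖ := by positivity
    rw [hG]
    dsimp only
    rw [← sq_abs (fderiv ℝ H z 1)]
    nlinarith [sq_nonneg (|fderiv ℝ H z 1| - 1), sq_nonneg (fderiv ℝ H z Complex.I)]
  have hG2 : ∀ z ∈ Q, |fderiv ℝ H z Complex.I| ≤ G z := fun z _ => by
    have h1 : 0 ≤ Λ * ‖cgrad (w n) z - f z‖ := by positivity
    rw [hG]
    dsimp only
    rw [← sq_abs (fderiv ℝ H z Complex.I)]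
    nlinarith [sq_nonneg (|fderiv ℝ H z Complex.I| - 1), sq_nonneg (fderiv ℝ H z 1)]
  have hGI : ∫ z in Q, G z ≤ C := by
    have i1 : IntegrableOn (fun z : ℂ => (1 : ℝ)) Q := integrableOn_const hQc.measure_lt_top.ne
    have i2 := hHs.integrableOn_compact (μ := volume) hQc
    have i3 : IntegrableOn (fun z => Λ * ‖cgrad (w n) z - f z‖) Q :=
      (hcd.const_mul Λ).continuousOn.integrableOn_compact hQc
    have i12 : IntegrableOn (fun z => 1 + ((fderiv ℝ H z 1) ^ 2 +
      (fderiv ℝ H z Complex.I) ^ 2)) Q := i1.add i2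
    have h3 : ∫ z in Q, ‖cgrad (w n) z - f z‖ ≤ τ :=
      (setIntegral_mono_set hid (Eventually.of_forall fun z => norm_nonneg _)
        (hQO.trans Metric.ball_subset_closedBall).eventuallyLE).trans hn.le
    have h4 : Λ * τ ≤ 1 := by
      rw [lt_div_iff₀ hΛ0] at hτΛ
      linarith
    have h5 := mul_le_mul_of_nonneg_left h3 hΛ0.le
    have h6 : C₀ * (1 + ∫ z in Metric.closedBall (0 : ℂ) (R / 2), ‖cgrad (w n) z‖) ≤
        C₀ * (2 + M) := mul_le_mul_of_nonneg_left (by linarith) hC₀.le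
    rw [hG, integral_add i12 i3, integral_add i1 i2, integral_const_mul, setIntegral_const, hC,
      smul_eq_mul, mul_one]
    linarith
  rw [hQ] at hGc hG1 hG2 hGI
  obtain ⟨a₁, ha₁, a₂, ha₂, b₁, hb₁, b₂, hb₂, hosc, hline⟩ := exists_frame hβ hβa
    Metric.isOpen_ball (hQ ▸ hQO) hHc hGc hG1 hG2 hGI
  have hQsub : Icc a₁ a₂ ×ℂ Icc b₁ b₂ ⊆ Q := by
    rw [hQ]
    rintro z ⟨⟨h1, h2⟩, h3, h4⟩
    exact ⟨⟨ha₁.1.trans h1, h2.trans ha₂.2⟩, hb₁.1.trans h3, h4.trans hb₂.2⟩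
  -- a point of the frame at which `g` is bounded below
  obtain ⟨y, hy, hyle⟩ : ∃ y ∈ Icc (-β) β, ‖cgrad (w n) ⟨a₂, y⟩ - f ⟨a₂, y⟩‖ ≤ δ := by
    by_contra! hcon
    have hmem : ∀ y ∈ Icc (-(2 * β)) (2 * β),
        (⟨a₂, y⟩ : ℂ) ∈ Icc (-(2 * β)) (a + β) ×ℂ Icc (-(2 * β)) (2 * β) := fun y hy =>
      ⟨⟨by simp only; linarith [ha₂.1], ha₂.2⟩, hy⟩
    have hln : Continuous fun y : ℝ => (⟨a₂, y⟩ : ℂ) := by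
      have e : (fun y : ℝ => (⟨a₂, y⟩ : ℂ)) = fun y : ℝ => (a₂ : ℂ) + y * Complex.I := by
        funext t; apply Complex.ext <;> simp
      rw [e]; fun_prop
    have hGl : IntegrableOn (fun y => G ⟨a₂, y⟩) (Icc (-(2 * β)) (2 * β)) :=
      (hGc.comp hln.continuousOn hmem).integrableOn_Icc
    have hsub : Icc (-β) β ⊆ Icc (-(2 * β)) (2 * β) :=
      Icc_subset_Icc (by linarith) (by linarith)
    have h1 : ∫ y in Icc (-β) β, Λ * δ ≤ ∫ y in Icc (-(2 * β)) (2 * β), G ⟨a₂, y⟩ := by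
      refine le_trans (setIntegral_mono_on (integrableOn_const (by simp) )
        (hGl.mono_set hsub) measurableSet_Icc fun y hy => ?_)
        (setIntegral_mono_set hGl (ae_restrict_of_forall_mem measurableSet_Icc fun y hy =>
          (abs_nonneg _).trans (hG1 _ (hmem y hy))) hsub.eventuallyLE)
      have := mul_le_mul_of_nonneg_left (hcon y hy).le hΛ0.le
      rw [hG]
      simp only
      nlinarith [sq_nonneg (fderiv ℝ H ⟨a₂, y⟩ 1), sq_nonneg (fderiv ℝ H ⟨a₂, y⟩ Complex.I)]
    rw [setIntegral_const, Real.volume_real_Icc_of_le (by linarith), smul_eq_mul] at h1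
    have h2 : (β - -β) * (Λ * δ) = 2 * (C / β) := by
      rw [hΛ]; field_simp; ring
    have : 0 < C / β := by positivity
    linarith
  have ha₂' : β ≤ a₂ := by linarith [ha₂.1]
  have hframe : (⟨a₂, y⟩ : ℂ) ∈ (Icc a₁ a₂ ×ℂ Icc b₁ b₂) \ (Ioo a₁ a₂ ×ℂ Ioo b₁ b₂) :=
    ⟨⟨⟨by simp only; linarith [ha₁.2], le_rfl⟩, hb₁.2.trans hy.1, hy.2.trans hb₂.1⟩,
      fun h => lt_irrefl _ h.1.2⟩
  have hgδ : δ ≤ ‖g ⟨a₂, y⟩‖ := by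
    have h1 : 3 * δ ≤ ‖f ⟨a₂, y⟩‖ := hfρ _ <| lt_of_le_of_lt
      ((Complex.norm_le_abs_re_add_abs_im _).trans (add_le_add
        (abs_le.2 ⟨?_, ?_⟩ : _ ≤ β) (abs_le.2 ⟨?_, ?_⟩ : _ ≤ β))) (by linarith)
    · have h2 := hgf _ (Metric.ball_subset_closedBall (hQO (hQsub hframe.1)))
      have h3 := norm_sub_norm_le (f ⟨a₂, y⟩) (cgrad (w n) ⟨a₂, y⟩)
      have h4 := norm_sub_norm_le (cgrad (w n) ⟨a₂, y⟩) (g ⟨a₂, y⟩)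
      rw [norm_sub_rev] at h3 h4
      linarith
    · simp; linarith [ha₂.1]
    · simp; linarith [ha₂.2]
    · simpa using hy.1
    · simpa using hy.2
  have hlow : ∀ z ∈ (Icc a₁ a₂ ×ℂ Icc b₁ b₂) \ (Ioo a₁ a₂ ×ℂ Ioo b₁ b₂),
      δ' / 2 ≤ ‖cgrad (w n) z‖ := fun z hz => by
    have hzK := Metric.ball_subset_closedBall (hQO (hQsub hz.1))
    have h1 := (abs_le.1 (hosc z hz _ hframe)).2
    have hgz : 0 < ‖g z‖ := norm_pos_iff.2 (hg0 z hzK)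
    have h2 : δ' ≤ ‖g z‖ := by
      rw [hHdef] at h1
      simp only at h1
      have h3 : ell (Real.log ‖g ⟨a₂, y⟩‖) ≤ ell (Real.log δ) :=
        ell_antitone (Real.log_le_log hδ0 hgδ)
      have h4 : Real.log (ell (Real.log ‖g z‖)) ≤ Real.log (ell (Real.log δ)) + 4 * (C / β) := by
        linarith [Real.log_le_log (ell_pos _) h3]
      have h5 : ell (Real.log ‖g z‖) ≤ ell (Real.log δ) * Real.exp (4 * (C / β)) := by
        rw [Real.log_le_iff_le_exp (ell_pos _), Real.exp_add, Real.exp_log (ell_pos _)] at h4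
        exact h4
      rw [hδ', ← Real.le_log_iff_exp_le hgz]
      linarith [neg_le_ell (Real.log ‖g z‖)]
    have h3 := hgf z hzK
    have h4 := norm_sub_norm_le (g z) (cgrad (w n) z)
    linarith
  have hin : ∀ z ∈ Icc a₁ a₂ ×ℂ Icc b₁ b₂, δ' / 2 ≤ ‖cgrad (w n) z‖ := fun z hz =>
    le_norm_cgrad_of_le_frontier hp hV (hw n) (hne n) (isCompact_Icc.reProdIm isCompact_Icc)
      (hQsub.trans (hQO.trans (Metric.ball_subset_closedBall.trans hK'V)))
      (isOpen_Ioo.reProdIm isOpen_Ioo)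
      (fun z hz => ⟨Ioo_subset_Icc_self hz.1, Ioo_subset_Icc_self hz.2⟩) hlow hz
  have hball : Metric.ball (0 : ℂ) r' ⊆ Icc a₁ a₂ ×ℂ Icc b₁ b₂ := fun z hz => by
    rw [mem_ball_zero_iff] at hz
    have h1 := abs_le.1 ((Complex.abs_re_le_norm z).trans (hz.le.trans hr'β))
    have h2 := abs_le.1 ((Complex.abs_im_le_norm z).trans (hz.le.trans hr'β))
    exact ⟨⟨ha₁.2.trans h1.1, h1.2.trans ha₂'⟩, hb₁.2.trans h2.1, h2.2.trans hb₂.1⟩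
  have hfin : ∫ z in Metric.ball (0 : ℂ) r', δ' / 4 ≤
      ∫ z in Metric.closedBall (0 : ℂ) (R / 2), ‖cgrad (w n) z - f z‖ := by
    have hsub : Metric.ball (0 : ℂ) r' ⊆ Metric.closedBall (0 : ℂ) (R / 2) :=
      hball.trans (hQsub.trans (hQO.trans Metric.ball_subset_closedBall))
    refine le_trans (setIntegral_mono_on (integrableOn_const measure_ball_lt_top.ne)
      (hid.mono_set hsub) measurableSet_ball fun z hz => ?_)
      (setIntegral_mono_set hid (Eventually.of_forall fun z => norm_nonneg _) hsub.eventuallyLE)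
    have h1 := hin z (hball hz)
    have h2 := hfr z ((mem_ball_zero_iff.1 hz).trans_le hr'r)
    have h3 := norm_sub_norm_le (cgrad (w n) z) (f z)
    linarith
  rw [setIntegral_const, smul_eq_mul] at hfin
  linarith

/-- A limit of functions without critical points has no critical point at the centre of a ball,
unless it is constant nearby. -/
theorem cgrad_eq_zero_of_tendstoUniformlyOn {p : ℝ} (hp : 1 < p) {R : ℝ} {u : ℂ → ℝ}
    (hu : PH p (Metric.ball 0 R) u) {w : ℕ → ℂ → ℝ} (hw : ∀ n, PH p (Metric.ball 0 R) (w n))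
    (hlim : TendstoUniformlyOn w u atTop (Metric.ball 0 R))
    (hne : ∀ n, ∀ z ∈ Metric.ball (0 : ℂ) R, cgrad (w n) z ≠ 0) (h0 : cgrad u 0 = 0) {x : ℂ}
    (hx : 6 * ‖x‖ < R) : cgrad u x = 0 := by
  by_contra hfx
  have hx0 : x ≠ 0 := fun h => hfx (h ▸ h0)
  have hxn : 0 < ‖x‖ := norm_pos_iff.2 hx0
  obtain ⟨c, hc⟩ : ∃ c : Circle, (c : ℂ) * (‖x‖ : ℝ) = x := by
    refine ⟨Circle.exp x.arg, ?_⟩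
    rw [Circle.coe_exp, mul_comm]
    exact Complex.norm_mul_exp_arg_mul_I x
  have hpre : rigid c 0 ⁻¹' Metric.ball (0 : ℂ) R = Metric.ball 0 R := by
    ext z
    simp only [mem_preimage, mem_ball_zero_iff, rigid_apply, add_zero, norm_mul, Circle.norm_coe,
      one_mul]
  have hzero : rigid c 0 0 = 0 := by simp [rigid_apply]
  have hmap : ∀ z ∈ Metric.ball (0 : ℂ) R, rigid c 0 z ∈ Metric.ball (0 : ℂ) R := fun z hz => by
    rw [← hpre] at hz
    exact hz
  have hub := hu.comp_rigid c 0
  rw [hpre] at hub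
  refine cgrad_zero_ne_zero_of_tendstoUniformlyOn hp hub (w := fun n z => w n (rigid c 0 z))
    (fun n => by simpa only [hpre] using (hw n).comp_rigid c 0) ?_ ?_ hxn hx ?_ ?_
  · have := hlim.comp (rigid c 0)
    rwa [hpre] at this
  · intro n z hz
    rw [cgrad_comp_rigid (hw n).differentiable]
    exact mul_ne_zero (Circle.coe_ne_zero _) (hne n _ (hmap z hz))
  · rw [cgrad_comp_rigid hu.differentiable, rigid_apply, add_zero, hc]
    exact mul_ne_zero (Circle.coe_ne_zero _) hfx
  · rw [cgrad_comp_rigid hu.differentiable, hzero, h0, mul_zero]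

/-! ### An energy estimate for the angle between two gradients -/

/-- The linear map sending the differential of the argument of a gradient with direction `S` to the
differential of the logarithm of its modulus. -/
noncomputable def turn (κ : ℝ) (S x : ℂ) : ℂ :=
  Complex.I / 2 * ((1 + κ) * x + (1 - κ) * S ^ 2 * conj x)

set_option maxHeartbeats 1000000 in
theorem exists_turn_const {κ : ℝ} (hκ : 0 < κ) :
    ∃ K ≥ 1, ∃ K' > 0, ∀ S T A A' : ℂ, ∀ e e' : ℝ, ‖S‖ = 1 → ‖T‖ = 1 → ∀ q : ℂ,
      q = turn κ S A' + κ * e' * S - (turn κ T A + κ * e * T) →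
      ‖A' - A‖ ^ 2 ≤ K * (conj (A' - A) * q).im +
        K' * (‖S - T‖ ^ 2 * ‖A‖ ^ 2 + e ^ 2 + e' ^ 2) ∧
      ‖q‖ ^ 2 ≤ K * (‖A' - A‖ ^ 2 + K' * (‖S - T‖ ^ 2 * ‖A‖ ^ 2 + e ^ 2 + e' ^ 2)) := by
  obtain ⟨κ₀, hκ₀⟩ : ∃ κ₀, κ₀ = min 1 κ := ⟨_, rfl⟩
  have h0 : 0 < κ₀ := hκ₀ ▸ lt_min one_pos hκ
  have h01 : κ₀ ≤ 1 := hκ₀ ▸ min_le_left _ _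
  have h0κ : κ₀ ≤ κ := hκ₀ ▸ min_le_right _ _
  have habs : |1 - κ| ≤ 1 + κ - 2 * κ₀ := abs_le.2 ⟨by linarith, by linarith⟩
  obtain ⟨K, hK⟩ : ∃ K, K = 2 / κ₀ + 2 * (1 + κ) ^ 2 := ⟨_, rfl⟩
  obtain ⟨K', hK'⟩ : ∃ K', K' = 3 + K * (3 * (1 + κ) ^ 2 / (2 * κ₀)) := ⟨_, rfl⟩
  have hK2 : 2 ≤ K * κ₀ := by
    have : 2 / κ₀ * κ₀ = 2 := by field_simp
    rw [hK, add_mul, this]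
    have : 0 ≤ 2 * (1 + κ) ^ 2 * κ₀ := by positivity
    linarith
  have hK1 : 1 ≤ K := by nlinarith
  have hK0 : 0 ≤ K := by linarith
  have hKκ : 2 * (1 + κ) ^ 2 ≤ K := by
    have : 0 < 2 / κ₀ := by positivity
    linarith
  have hK'3 : 3 ≤ K' := by
    have : 0 ≤ K * (3 * (1 + κ) ^ 2 / (2 * κ₀)) := by positivity
    linarith
  refine ⟨K, hK1, K', by linarith, fun S T A A' e e' hS hT q hq => ?_⟩
  obtain ⟨D, hD⟩ : ∃ D, D = A' - A := ⟨_, rfl⟩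
  obtain ⟨X, hX⟩ : ∃ X, X = ‖S - T‖ ^ 2 * ‖A‖ ^ 2 + e ^ 2 + e' ^ 2 := ⟨_, rfl⟩
  have hX0 : 0 ≤ X := by rw [hX]; positivity
  obtain ⟨r, hr⟩ : ∃ r : ℂ, r = Complex.I / 2 * ((1 - κ) * (S - T) * (S + T) * conj A) +
    κ * (e' * S - e * T) := ⟨_, rfl⟩
  have hqr : q = turn κ S D + r := by
    rw [hq, hr, hD]
    simp only [turn, map_sub]
    ring
  rw [← hD, ← hX]
  have hrn : ‖r‖ ≤ (1 + κ) * (‖S - T‖ * ‖A‖ + |e| + |e'|) := by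
    have h1 : ‖Complex.I / 2 * ((1 - κ) * (S - T) * (S + T) * conj A)‖ ≤
        (1 + κ) * (‖S - T‖ * ‖A‖) := by
      have e1 : ‖(1 - κ : ℂ)‖ = |1 - κ| := by
        rw [← Real.norm_eq_abs, ← Complex.norm_real]; norm_cast
      rw [norm_mul, norm_mul, norm_mul, norm_mul, RCLike.norm_conj, e1, norm_div, Complex.norm_I,
        Complex.norm_ofNat]
      have h2 : ‖S + T‖ ≤ 2 := (norm_add_le _ _).trans (by linarith)
      have h3 : |1 - κ| ≤ 1 + κ := by linarith
      calc _ ≤ 1 / 2 * ((1 + κ) * ‖S - T‖ * 2 * ‖A‖) := by gcongr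
        _ = _ := by ring
    have h2 : ‖(κ : ℂ) * (e' * S - e * T)‖ ≤ (1 + κ) * (|e| + |e'|) := by
      rw [norm_mul, Complex.norm_real, Real.norm_of_nonneg hκ.le]
      have h3 : ‖(e' : ℂ) * S - e * T‖ ≤ |e| + |e'| := by
        refine (norm_sub_le _ _).trans (le_of_eq ?_)
        rw [norm_mul, norm_mul, hS, hT, Complex.norm_real, Complex.norm_real]
        simp only [Real.norm_eq_abs]
        ring
      have : 0 ≤ |e| + |e'| := by positivity
      nlinarith [norm_nonneg ((e' : ℂ) * S - e * T)]
    rw [hr]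
    refine (norm_add_le _ _).trans ?_
    linarith
  have hr2 : ‖r‖ ^ 2 ≤ 3 * (1 + κ) ^ 2 * X := by
    calc ‖r‖ ^ 2 ≤ ((1 + κ) * (‖S - T‖ * ‖A‖ + |e| + |e'|)) ^ 2 := by gcongr
      _ = (1 + κ) ^ 2 * (‖S - T‖ * ‖A‖ + |e| + |e'|) ^ 2 := by ring
      _ ≤ (1 + κ) ^ 2 * (3 * X) := by
          refine mul_le_mul_of_nonneg_left ?_ (by positivity)
          rw [hX, ← mul_pow, ← sq_abs e, ← sq_abs e']
          nlinarith [sq_nonneg (‖S - T‖ * ‖A‖ - |e|), sq_nonneg (‖S - T‖ * ‖A‖ - |e'|),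
            sq_nonneg (|e| - |e'|)]
      _ = _ := by ring
  have hnorm : ‖D‖ ^ 2 = D.re ^ 2 + D.im ^ 2 := by
    rw [← Complex.normSq_eq_norm_sq, Complex.normSq_apply]; ring
  constructor
  · have hw : κ₀ * ‖D‖ ^ 2 - ‖D‖ * ‖r‖ ≤ (conj D * q).im := by
      have h1 : (conj D * turn κ S D).im =
          ((1 + κ) * ‖D‖ ^ 2 + (1 - κ) * (S ^ 2 * conj D ^ 2).re) / 2 := by
        have h2 : conj D * turn κ S D = Complex.I / 2 * (((1 + κ : ℝ) : ℂ) * (conj D * D) +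
            ((1 - κ : ℝ) : ℂ) * (S ^ 2 * conj D ^ 2)) := by
          simp only [turn]; push_cast; ring
        have h3 : conj D * D = ((‖D‖ ^ 2 : ℝ) : ℂ) := by
          rw [← Complex.normSq_eq_norm_sq, Complex.normSq_eq_conj_mul_self]
        have h4 : ∀ x : ℂ, (Complex.I / 2 * x).im = x.re / 2 := fun x => by
          have : Complex.I / 2 * x = ((1 / 2 : ℝ) : ℂ) * (Complex.I * x) := by push_cast; ring
          rw [this, Complex.im_ofReal_mul]
          simp
          ring
        rw [h2, h3, h4, Complex.add_re, ← Complex.ofReal_mul, Complex.ofReal_re,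
          Complex.re_ofReal_mul]
      have h2 : |(S ^ 2 * conj D ^ 2).re| ≤ ‖D‖ ^ 2 := by
        refine (Complex.abs_re_le_norm _).trans (le_of_eq ?_)
        rw [norm_mul, norm_pow, norm_pow, hS, RCLike.norm_conj]
        ring
      have h3 : |(conj D * r).im| ≤ ‖D‖ * ‖r‖ := by
        refine (Complex.abs_im_le_norm _).trans (le_of_eq ?_)
        rw [norm_mul, RCLike.norm_conj]
      have h4 : |(1 - κ) * (S ^ 2 * conj D ^ 2).re| ≤ (1 + κ - 2 * κ₀) * ‖D‖ ^ 2 := by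
        rw [abs_mul]
        exact mul_le_mul habs h2 (abs_nonneg _) ((abs_nonneg _).trans habs)
      rw [hqr, mul_add, Complex.add_im, h1]
      nlinarith [(abs_le.1 h3).1, (abs_le.1 h4).1]
    have h1 : κ₀ * ‖D‖ ^ 2 ≤ 2 * (conj D * q).im + 3 * (1 + κ) ^ 2 * X / κ₀ := by
      have h2 : ‖r‖ ^ 2 / κ₀ ≤ 3 * (1 + κ) ^ 2 * X / κ₀ := by gcongr
      have h3 : 2 * (‖D‖ * ‖r‖) ≤ κ₀ * ‖D‖ ^ 2 + ‖r‖ ^ 2 / κ₀ := by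
        have h4 : 0 ≤ (κ₀ * ‖D‖ - ‖r‖) ^ 2 / κ₀ := by positivity
        have h5 : (κ₀ * ‖D‖ - ‖r‖) ^ 2 / κ₀ =
          κ₀ * ‖D‖ ^ 2 + ‖r‖ ^ 2 / κ₀ - 2 * (‖D‖ * ‖r‖) := by field_simp; ring
        linarith
      linarith
    have h2 : 2 * ‖D‖ ^ 2 ≤ K * (2 * (conj D * q).im + 3 * (1 + κ) ^ 2 * X / κ₀) :=
      calc 2 * ‖D‖ ^ 2 ≤ K * κ₀ * ‖D‖ ^ 2 := by gcongr
        _ = K * (κ₀ * ‖D‖ ^ 2) := by ring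
        _ ≤ _ := by gcongr
    have h3 : K * (3 * (1 + κ) ^ 2 * X / κ₀) = 2 * ((K' - 3) * X) := by
      rw [hK']; field_simp; ring
    nlinarith
  · have h1 : ‖turn κ S D‖ ≤ (1 + κ) * ‖D‖ := by
      have e1 : ‖(1 - κ : ℂ)‖ = |1 - κ| := by
        rw [← Real.norm_eq_abs, ← Complex.norm_real]; norm_cast
      have e2 : ‖(1 + κ : ℂ)‖ = 1 + κ := by
        rw [← Real.norm_of_nonneg (by positivity : 0 ≤ 1 + κ), ← Complex.norm_real]; norm_cast
      have h3 : |1 - κ| ≤ 1 + κ := by linarith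
      rw [turn, norm_mul, norm_div, Complex.norm_I, Complex.norm_ofNat]
      have h4 : ‖(1 + κ : ℂ) * D + (1 - κ) * S ^ 2 * conj D‖ ≤ 2 * ((1 + κ) * ‖D‖) := by
        refine (norm_add_le _ _).trans ?_
        rw [norm_mul, norm_mul, norm_mul, norm_pow, hS, e1, e2, RCLike.norm_conj]
        have := mul_le_mul_of_nonneg_right h3 (norm_nonneg D)
        rw [one_pow, mul_one]
        linarith
      linarith
    have h2 : ‖q‖ ≤ (1 + κ) * ‖D‖ + ‖r‖ := by
      rw [hqr]
      exact (norm_add_le _ _).trans (by linarith)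
    calc ‖q‖ ^ 2 ≤ ((1 + κ) * ‖D‖ + ‖r‖) ^ 2 := by gcongr
      _ ≤ 2 * (1 + κ) ^ 2 * ‖D‖ ^ 2 + 2 * ‖r‖ ^ 2 := by
          nlinarith [sq_nonneg ((1 + κ) * ‖D‖ - ‖r‖)]
      _ ≤ 2 * (1 + κ) ^ 2 * ‖D‖ ^ 2 + 2 * (1 + κ) ^ 2 * (3 * X) := by linarith
      _ ≤ K * ‖D‖ ^ 2 + K * (K' * X) := by gcongr
      _ = _ := by ring

/-- The relation between the differentials of the modulus and of the argument. -/
theorem re_div_eq_turn {p : ℝ} (hp : 1 < p) {b y₁ y₂ : ℂ} (hb : b ≠ 0) (hy : y₁.im = y₂.re) :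
    (⟨(y₁ / b).re, (y₂ / b).re⟩ : ℂ) = turn (p - 1)⁻¹ (b / ‖b‖) ⟨(y₁ / b).im, (y₂ / b).im⟩ +
      ((p - 1)⁻¹ : ℝ) * (divLin p b y₁ y₂ / ‖b‖ : ℝ) * (b / ‖b‖) := by
  obtain ⟨h1, h2⟩ := lg_relations p hb hy
  have hn : 0 < ‖b‖ := norm_pos_iff.2 hb
  have hq : 0 < p - 1 := by linarith
  obtain ⟨c, hc⟩ : ∃ c, c = b.re / ‖b‖ := ⟨_, rfl⟩
  obtain ⟨d, hd⟩ : ∃ d, d = b.im / ‖b‖ := ⟨_, rfl⟩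
  obtain ⟨κ, hκ⟩ : ∃ κ, κ = (p - 1)⁻¹ := ⟨_, rfl⟩
  have hS : b / (‖b‖ : ℂ) = ⟨c, d⟩ := by
    rw [hc, hd]
    apply Complex.ext <;> simp [Complex.div_ofReal_re, Complex.div_ofReal_im]
  have hcd : c ^ 2 + d ^ 2 = 1 := by
    have : ‖b‖ ^ 2 = b.re ^ 2 + b.im ^ 2 := by
      rw [← Complex.normSq_eq_norm_sq, Complex.normSq_apply]; ring
    rw [hc, hd, div_pow, div_pow, ← add_div, ← this]
    field_simp
  rw [← hc, ← hd] at h1 h2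
  rw [hS, ← hκ]
  generalize (y₁ / b).re = s₁ at *
  generalize (y₂ / b).re = s₂ at *
  generalize (y₁ / b).im = a₁ at *
  generalize (y₂ / b).im = a₂ at *
  generalize divLin p b y₁ y₂ / ‖b‖ = e at *
  have h2' : c * s₁ + d * s₂ = κ * (e - (c * a₂ - d * a₁)) := by
    rw [← h2, hκ]; field_simp
  have e1 : s₁ = c * (κ * (e - (c * a₂ - d * a₁))) - d * (c * a₁ + d * a₂) := by
    rw [← h2', ← h1]
    linear_combination -s₁ * hcd
  have e2 : s₂ = d * (κ * (e - (c * a₂ - d * a₁))) + c * (c * a₁ + d * a₂) := by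
    rw [← h2', ← h1]
    linear_combination -s₂ * hcd
  have ht : turn κ ⟨c, d⟩ ⟨a₁, a₂⟩ = ⟨-(((1 + κ) * a₂ + (1 - κ) * (2 * c * d * a₁ -
      (c ^ 2 - d ^ 2) * a₂)) / 2), ((1 + κ) * a₁ + (1 - κ) * ((c ^ 2 - d ^ 2) * a₁ +
      2 * c * d * a₂)) / 2⟩ := by
    have hI : Complex.I / 2 = ⟨0, 1 / 2⟩ := by apply Complex.ext <;> simp
    have hk1 : (1 + κ : ℂ) = ⟨1 + κ, 0⟩ := by apply Complex.ext <;> simp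
    have hk2 : (1 - κ : ℂ) = ⟨1 - κ, 0⟩ := by apply Complex.ext <;> simp
    rw [turn, hI, hk1, hk2]
    apply Complex.ext <;> simp [pow_two] <;> ring
  rw [ht]
  apply Complex.ext
  · simp
    rw [e1]
    linear_combination (-(1 + κ) * a₂ / 2) * hcd
  · simp
    rw [e2]
    linear_combination ((1 + κ) * a₁ / 2) * hcd

/-- The source term in the energy estimate for the angle `φ` between `f` and `g`. -/
noncomputable def source (p : ℝ) (f g : ℂ → ℂ) (φ : ℂ → ℝ) (z : ℂ) : ℝ :=
  φ z ^ 2 * ((lg f 1 z).im ^ 2 + (lg f Complex.I z).im ^ 2) + defect p f z ^ 2 + defect p g z ^ 2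

theorem continuousOn_source {p : ℝ} {f g : ℂ → ℂ} (hf : ContDiff ℝ 2 f) (hg : ContDiff ℝ 2 g)
    {W : Set ℂ} (hf0 : ∀ z ∈ W, f z ≠ 0) (hg0 : ∀ z ∈ W, g z ≠ 0) {φ : ℂ → ℝ}
    (hφ : ContinuousOn φ W) : ContinuousOn (source p f g φ) W :=
  (((hφ.pow 2).mul (((contDiffOn_im_lg hf hf0 1).continuousOn.pow 2).add
    ((contDiffOn_im_lg hf hf0 Complex.I).continuousOn.pow 2))).add
      ((continuousOn_defect hf hf0).pow 2)).add ((continuousOn_defect hg hg0).pow 2)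

set_option maxHeartbeats 1000000 in
theorem exists_energy_angle {p : ℝ} (hp : 1 < p) :
    ∃ C > 0, ∀ f g : ℂ → ℂ, ContDiff ℝ 2 f → ContDiff ℝ 2 g →
      (∀ z, (fderiv ℝ f z 1).im = (fderiv ℝ f z Complex.I).re) →
      (∀ z, (fderiv ℝ g z 1).im = (fderiv ℝ g z Complex.I).re) →
      ∀ W : Set ℂ, IsOpen W → (∀ z ∈ W, f z ≠ 0) → (∀ z ∈ W, g z ≠ 0) →
      ∀ φ : ℂ → ℝ, ContinuousOn φ W → (∀ z ∈ W, ‖g z / ‖g z‖ - f z / ‖f z‖‖ ≤ |φ z|) →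
      ∀ γ γ' : ℂ → ℝ, ContDiffOn ℝ 1 γ W → ContinuousOn γ' W → (∀ z ∈ W, 0 ≤ γ' z) →
      (∀ z ∈ W, ∀ v, fderiv ℝ γ z v = γ' z * ((lg g v z).im - (lg f v z).im)) →
      ∀ η E : ℂ → ℝ, ContDiff ℝ 1 η → HasCompactSupport η → tsupport η ⊆ W →
      Integrable E → (∀ z, 0 ≤ E z) →
      (∀ z ∈ W, (fderiv ℝ η z 1 ^ 2 + fderiv ℝ η z Complex.I ^ 2) * γ z ^ 2 ≤ γ' z * E z) →
      ∫ z, η z ^ 2 * (γ' z * (((lg g 1 z).im - (lg f 1 z).im) ^ 2 +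
        ((lg g Complex.I z).im - (lg f Complex.I z).im) ^ 2)) ≤
        C * ((∫ z, E z) + ∫ z, η z ^ 2 * (γ' z * source p f g φ z)) := by
  have hκ : 0 < (p - 1)⁻¹ := inv_pos.2 (by linarith)
  obtain ⟨K, hK, K', hK', hle⟩ := exists_turn_const hκ
  refine ⟨4 * K ^ 3 + 3 * K', by positivity, fun f g hf hg hcf hcg W hW hf0 hg0 φ hφ hφle γ γ' hγ
    hγ' hγ'0 hdγ η E hη hηc hηW hE hE0 hηE => ?_⟩
  have hre := fun v => (contDiffOn_re_lg hg hg0 v).sub (contDiffOn_re_lg hf hf0 v)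
  have him : ∀ v, ContinuousOn (fun z => (lg g v z).im - (lg f v z).im) W := fun v =>
    ((contDiffOn_im_lg hg hg0 v).sub (contDiffOn_im_lg hf hf0 v)).continuousOn
  have hfd : ∀ z ∈ W, ∀ v w, fderiv ℝ (fun y => (lg g v y).re - (lg f v y).re) z w =
      (fderiv ℝ (lg g v) z w).re - (fderiv ℝ (lg f v) z w).re := fun z hz v w => by
    have d1 : DifferentiableAt ℝ (fun y => (lg g v y).re) z :=
      Complex.reCLM.differentiableAt.comp z (differentiableAt_lg hg (hg0 z hz) v)
    have d2 : DifferentiableAt ℝ (fun y => (lg f v y).re) z :=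
      Complex.reCLM.differentiableAt.comp z (differentiableAt_lg hf (hf0 z hz) v)
    rw [fderiv_fun_sub d1 d2, _root_.sub_apply, fderiv_re_lg hg (hg0 z hz),
      fderiv_re_lg hf (hf0 z hz)]
  have hunit : ∀ b : ℂ, b ≠ 0 → ‖b / (‖b‖ : ℂ)‖ = 1 := fun b hb => by
    rw [norm_div, Complex.norm_real, norm_norm, div_self (norm_ne_zero_iff.2 hb)]
  have hsq : ∀ x y : ℝ, ‖(⟨x, y⟩ : ℂ)‖ ^ 2 = x ^ 2 + y ^ 2 := fun x y => by
    rw [← Complex.normSq_eq_norm_sq, Complex.normSq_apply]; ring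
  have hsc : ContinuousOn (source p f g φ) W := continuousOn_source hf hg hf0 hg0 hφ
  have hs0 : ∀ z, 0 ≤ source p f g φ z := fun z => by unfold source; positivity
  have key : ∀ z ∈ W,
      ((lg g 1 z).im - (lg f 1 z).im) ^ 2 + ((lg g Complex.I z).im - (lg f Complex.I z).im) ^ 2 ≤
        K * (((lg g 1 z).im - (lg f 1 z).im) * ((lg g Complex.I z).re - (lg f Complex.I z).re) -
          ((lg g Complex.I z).im - (lg f Complex.I z).im) * ((lg g 1 z).re - (lg f 1 z).re)) +
          K' * source p f g φ z ∧
      ((lg g 1 z).re - (lg f 1 z).re) ^ 2 + ((lg g Complex.I z).re - (lg f Complex.I z).re) ^ 2 ≤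
        K * (((lg g 1 z).im - (lg f 1 z).im) ^ 2 +
          ((lg g Complex.I z).im - (lg f Complex.I z).im) ^ 2 + K' * source p f g φ z) := by
    intro z hz
    have tf := re_div_eq_turn hp (hf0 z hz) (hcf z)
    have tg := re_div_eq_turn hp (hg0 z hz) (hcg z)
    have h := hle (g z / ‖g z‖) (f z / ‖f z‖) ⟨(lg f 1 z).im, (lg f Complex.I z).im⟩
      ⟨(lg g 1 z).im, (lg g Complex.I z).im⟩ (defect p f z) (defect p g z)
      (hunit _ (hg0 z hz)) (hunit _ (hf0 z hz))
      (⟨(lg g 1 z).re, (lg g Complex.I z).re⟩ - ⟨(lg f 1 z).re, (lg f Complex.I z).re⟩)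
      (congrArg₂ (· - ·) tg tf)
    have hX : ‖g z / ‖g z‖ - f z / ‖f z‖‖ ^ 2 * ‖(⟨(lg f 1 z).im, (lg f Complex.I z).im⟩ : ℂ)‖ ^ 2 +
        defect p f z ^ 2 + defect p g z ^ 2 ≤ source p f g φ z := by
      have : ‖g z / ‖g z‖ - f z / ‖f z‖‖ ^ 2 ≤ φ z ^ 2 := by
        rw [← sq_abs (φ z)]
        exact pow_le_pow_left₀ (norm_nonneg _) (hφle z hz) 2
      rw [source, hsq (lg f 1 z).im (lg f Complex.I z).im]
      gcongr
    have hX' := mul_le_mul_of_nonneg_left hX hK'.le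
    have hX'' := mul_le_mul_of_nonneg_left hX' (by linarith : 0 ≤ K)
    have e1 : (⟨(lg g 1 z).im, (lg g Complex.I z).im⟩ - ⟨(lg f 1 z).im, (lg f Complex.I z).im⟩ : ℂ)
      = ⟨(lg g 1 z).im - (lg f 1 z).im, (lg g Complex.I z).im - (lg f Complex.I z).im⟩ := rfl
    have e2 : (⟨(lg g 1 z).re, (lg g Complex.I z).re⟩ - ⟨(lg f 1 z).re, (lg f Complex.I z).re⟩ : ℂ)
      = ⟨(lg g 1 z).re - (lg f 1 z).re, (lg g Complex.I z).re - (lg f Complex.I z).re⟩ := rfl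
    rw [e1, e2, hsq ((lg g 1 z).im - (lg f 1 z).im), hsq ((lg g 1 z).re - (lg f 1 z).re)] at h
    simp only [Complex.mul_im, Complex.conj_re, Complex.conj_im] at h
    obtain ⟨h1, h2⟩ := h
    constructor
    · linarith
    · linarith
  have main := integral_energy_le hW (γ := γ) (γ' := γ')
    (b₁ := fun z => (lg g 1 z).im - (lg f 1 z).im)
    (b₂ := fun z => (lg g Complex.I z).im - (lg f Complex.I z).im)
    (a₁ := fun z => (lg g 1 z).re - (lg f 1 z).re)
    (a₂ := fun z => (lg g Complex.I z).re - (lg f Complex.I z).re)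
    (N := fun z => ((lg g 1 z).im - (lg f 1 z).im) ^ 2 +
      ((lg g Complex.I z).im - (lg f Complex.I z).im) ^ 2)
    (R := fun z => K' * source p f g φ z) (G := E) (η := η) hK hη hηc hηW hγ hγ' hγ'0
    (fun z hz => hdγ z hz 1) (fun z hz => hdγ z hz Complex.I) (hre 1) (hre Complex.I)
    (fun z hz => by
      rw [hfd z hz, hfd z hz, fderiv_lg_symm hg (hg0 z hz), fderiv_lg_symm hf (hf0 z hz)])
    (((him 1).pow 2).add ((him Complex.I).pow 2)) (continuousOn_const.mul hsc) hE hE0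
    (fun z _ => by have := hs0 z; positivity) (fun z hz => (key z hz).1)
    (fun z hz => (key z hz).2) hηE
  have e : ∫ z, η z ^ 2 * (γ' z * (K' * source p f g φ z)) =
      K' * ∫ z, η z ^ 2 * (γ' z * source p f g φ z) := by
    rw [← integral_const_mul]
    congr 1
    funext z
    ring
  rw [e] at main
  have i1 : 0 ≤ ∫ z, E z := integral_nonneg hE0
  have i2 : 0 ≤ ∫ z, η z ^ 2 * (γ' z * source p f g φ z) := integral_nonneg fun z => by
    by_cases hz : z ∈ W
    · have := hγ'0 z hz
      have := hs0 z
      simp only [Pi.zero_apply]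
      positivity
    · simp [image_eq_zero_of_notMem_tsupport fun h => hz (hηW h)]
  refine main.trans ?_
  have j1 : 0 ≤ K' * ∫ z, E z := by positivity
  have j2 : 0 ≤ K ^ 3 * ∫ z, η z ^ 2 * (γ' z * source p f g φ z) := by positivity
  nlinarith

/-- The argument of `c * f`, in a form adapted to differentiation. -/
noncomputable def ang (c : ℂ) (f : ℂ → ℂ) (z : ℂ) : ℝ := Complex.arg (c * f z)

theorem ang_eq (c : ℂ) (f : ℂ → ℂ) :
    ang c f = fun y => Complex.imCLM (Complex.log (c * f y)) :=
  funext fun y => by rw [Complex.imCLM_apply, Complex.log_im, ang]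

theorem hasFDerivAt_ang {c : ℂ} {f : ℂ → ℂ} {z : ℂ} (hf : DifferentiableAt ℝ f z)
    (h : c * f z ∈ Complex.slitPlane) : DifferentiableAt ℝ (ang c f) z ∧
      ∀ v, fderiv ℝ (ang c f) z v = (lg f v z).im := by
  have h0 : c * f z ≠ 0 := Complex.slitPlane_ne_zero h
  have h1 : HasFDerivAt (fun y => c * f y) (c • fderiv ℝ f z) z := hf.hasFDerivAt.const_mul c
  have h2 : HasFDerivAt Complex.log _ (c * f z) :=
    ((Complex.hasStrictDerivAt_log h).hasDerivAt.hasFDerivAt).restrictScalars ℝ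
  have h3 : HasFDerivAt (fun y => Complex.imCLM (Complex.log (c * f y))) _ z :=
    Complex.imCLM.hasFDerivAt.comp z (HasFDerivAt.comp (g := Complex.log) z h2 h1)
  rw [← ang_eq] at h3
  refine ⟨h3.differentiableAt, fun v => ?_⟩
  rw [h3.fderiv]
  have h4 : c * fderiv ℝ f z v * (c * f z)⁻¹ = fderiv ℝ f z v / f z := by
    have hc := left_ne_zero_of_mul h0
    have hfz := right_ne_zero_of_mul h0
    field_simp
  simp [lg, ← h4, mul_assoc]

theorem continuousOn_ang {c : ℂ} {f : ℂ → ℂ} {W : Set ℂ} (hf : ContinuousOn f W)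
    (h : ∀ z ∈ W, c * f z ∈ Complex.slitPlane) : ContinuousOn (ang c f) W := fun z hz =>
  (Complex.continuousAt_arg (h z hz)).comp_continuousWithinAt (f := fun y => c * f y)
    (continuousWithinAt_const.mul (hf z hz))

theorem contDiffOn_ang {c : ℂ} {f : ℂ → ℂ} (hf : ContDiff ℝ 2 f) {W : Set ℂ}
    (h : ∀ z ∈ W, c * f z ∈ Complex.slitPlane) : ContDiffOn ℝ 1 (ang c f) W := by
  have h1 : ContDiffOn ℝ 1 (fun y => c * f y) W :=
    (contDiff_const.mul (hf.of_le one_le_two)).contDiffOn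
  rw [ang_eq]
  intro z hz
  have h2 : ContDiffAt ℝ 1 Complex.log (c * f z) :=
    (Complex.contDiffAt_log (n := 1) (h z hz)).restrict_scalars ℝ
  exact Complex.imCLM.contDiff.contDiffAt.comp_contDiffWithinAt z
    (ContDiffAt.comp_contDiffWithinAt (g := Complex.log) z h2 (h1 z hz))

/-- The distance of two directions is at most the angle between them. -/
theorem norm_div_norm_sub_le {c a b : ℂ} (hc : c ≠ 0) (ha : a ≠ 0) (hb : b ≠ 0) :
    ‖b / ‖b‖ - a / ‖a‖‖ ≤ |Complex.arg (c * b) - Complex.arg (c * a)| := by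
  have key : ∀ x : ℂ, x ≠ 0 → c / ‖c‖ * (x / ‖x‖) = Complex.exp (Complex.arg (c * x) * Complex.I) :=
    fun x hx => by
      have h1 := Complex.norm_mul_exp_arg_mul_I (c * x)
      have h2 : (‖c‖ : ℂ) ≠ 0 := by exact_mod_cast norm_ne_zero_iff.2 hc
      have h3 : (‖x‖ : ℂ) ≠ 0 := by exact_mod_cast norm_ne_zero_iff.2 hx
      rw [norm_mul] at h1
      push_cast at h1
      rw [div_mul_div_comm, div_eq_iff (mul_ne_zero h2 h3), mul_comm (Complex.exp _), h1]
  have h1 : ‖c / (‖c‖ : ℂ)‖ = 1 := by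
    rw [norm_div, Complex.norm_real, norm_norm, div_self (norm_ne_zero_iff.2 hc)]
  have h2 : ‖b / ‖b‖ - a / ‖a‖‖ = ‖c / ‖c‖ * (b / ‖b‖ - a / ‖a‖)‖ := by
    rw [norm_mul, h1, one_mul]
  rw [h2, mul_sub, key a ha, key b hb]
  generalize Complex.arg (c * b) = s
  generalize Complex.arg (c * a) = t
  have h3 : Complex.exp (s * Complex.I) - Complex.exp (t * Complex.I) =
      Complex.exp (t * Complex.I) * (Complex.exp (Complex.I * ((s - t : ℝ) : ℂ)) - 1) := by
    rw [mul_sub, ← Complex.exp_add]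
    push_cast
    ring_nf
  rw [h3, norm_mul, Complex.norm_exp_ofReal_mul_I, one_mul]
  exact (Real.norm_exp_I_mul_ofReal_sub_one_le).trans_eq (Real.norm_eq_abs _)

/-- Smooth curl-free approximation of a gradient whose values stay in a slit plane, with control
of the argument. -/
theorem exists_approx_ang {p : ℝ} (hp : 1 < p) {V : Set ℂ} (hV : IsOpen V) {u : ℂ → ℝ}
    (hu : PH p V u) (hne : ∀ z ∈ V, cgrad u z ≠ 0) {D : Set ℂ} (hD : IsCompact D) (hDV : D ⊆ V)
    {c : ℂ} (hc : ∀ z ∈ D, c * cgrad u z ∈ Complex.slitPlane) :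
    ∃ m > 0, ∃ A > 0, ∀ ε > 0, ∃ g : ℂ → ℂ, ContDiff ℝ 2 g ∧
      (∀ z, (fderiv ℝ g z 1).im = (fderiv ℝ g z Complex.I).re) ∧
      (∀ z ∈ D, m ≤ ‖g z‖ ∧ c * g z ∈ Complex.slitPlane ∧
        |ang c g z - ang c (cgrad u) z| ≤ ε) ∧
      ∫ z in D, (‖fderiv ℝ g z 1‖ ^ 2 + ‖fderiv ℝ g z Complex.I‖ ^ 2) ≤ A ∧
      ∫ z in D, divLin p (g z) (fderiv ℝ g z 1) (fderiv ℝ g z Complex.I) ^ 2 ≤ ε := by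
  have hf := hu.continuous_cgrad
  obtain ⟨A, hA, happ⟩ := exists_smooth_approx hp hV hu hne hD hDV
  obtain ⟨m, hm, hmle⟩ : ∃ m > 0, ∀ z ∈ D, m ≤ ‖cgrad u z‖ :=
    hD.exists_forall_le' hf.norm.continuousOn (a := 0)
      (fun z hz => norm_pos_iff.2 (hne z (hDV hz)))
  have hK : IsCompact ((fun z => c * cgrad u z) '' D) := hD.image (by fun_prop)
  obtain ⟨r, hr, hthick⟩ := hK.exists_thickening_subset_open Complex.isOpen_slitPlane (by
    rintro _ ⟨z, hz, rfl⟩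
    exact hc z hz)
  refine ⟨m / 2, by positivity, A, hA, fun ε hε => ?_⟩
  have hunif := hK.uniformContinuousAt_of_continuousAt Complex.arg (fun x hx =>
    Complex.continuousAt_arg (by
      obtain ⟨z, hz, rfl⟩ := hx
      exact hc z hz)) (Metric.dist_mem_uniformity hε)
  obtain ⟨δ, hδ, hδarg⟩ := Metric.mem_uniformity_dist.1 hunif
  obtain ⟨e, he0, he⟩ : ∃ e > 0, e < min (min (m / 2) ε) (min r δ / (‖c‖ + 1)) :=
    exists_between (lt_min (lt_min (by positivity) hε) (by positivity))
  simp only [lt_min_iff] at he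
  obtain ⟨⟨he1, he2⟩, he3⟩ := he
  obtain ⟨g, hg, hgf, hcurl, hgA, hdiv⟩ := happ e he0
  have hdist : ∀ z ∈ D, dist (c * cgrad u z) (c * g z) < min r δ := fun z hz => by
    rw [dist_eq_norm, ← mul_sub, norm_mul, norm_sub_rev]
    rw [lt_div_iff₀ (by positivity)] at he3
    have := mul_le_mul_of_nonneg_left (hgf z hz) (norm_nonneg c)
    nlinarith
  refine ⟨g, hg, hcurl, fun z hz => ⟨?_, ?_, ?_⟩, hgA, hdiv.trans he2.le⟩
  · have h1 := hgf z hz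
    have h2 := hmle z hz
    have h3 := norm_sub_norm_le (cgrad u z) (g z)
    rw [norm_sub_rev] at h3
    linarith
  · refine hthick (Metric.mem_thickening_iff.2 ⟨_, mem_image_of_mem _ hz, ?_⟩)
    rw [dist_comm]
    exact (hdist z hz).trans_le (min_le_left _ _)
  · have : dist (Complex.arg (c * cgrad u z)) (Complex.arg (c * g z)) < ε :=
      hδarg ((hdist z hz).trans_le (min_le_right _ _)) (mem_image_of_mem _ hz)
    rw [dist_comm, Real.dist_eq] at this
    exact this.le

theorem integral_source_le {p : ℝ} {f g : ℂ → ℂ} (hf : ContDiff ℝ 2 f) (hg : ContDiff ℝ 2 g)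
    {D O : Set ℂ} (hD : IsCompact D) (hO : MeasurableSet O) (hOD : O ⊆ D) {m B B' : ℝ}
    (hm : 0 < m) (hB : 0 ≤ B) (hB' : 0 ≤ B')
    (hmf : ∀ z ∈ D, m ≤ ‖f z‖) (hmg : ∀ z ∈ D, m ≤ ‖g z‖) {φ η γ' : ℂ → ℝ}
    (hη : ∀ z, 0 ≤ η z ∧ η z ≤ 1) (hηO : tsupport η ⊆ O)
    (hγ' : ∀ z ∈ O, 0 ≤ γ' z ∧ γ' z ≤ B ∧ γ' z * φ z ^ 2 ≤ B') :
    ∫ z, η z ^ 2 * (γ' z * source p f g φ z) ≤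
      B' / m ^ 2 * (∫ z in D, (‖fderiv ℝ f z 1‖ ^ 2 + ‖fderiv ℝ f z Complex.I‖ ^ 2)) +
      B / m ^ 2 * ((∫ z in D, divLin p (f z) (fderiv ℝ f z 1) (fderiv ℝ f z Complex.I) ^ 2) +
        ∫ z in D, divLin p (g z) (fderiv ℝ g z 1) (fderiv ℝ g z Complex.I) ^ 2) := by
  have hne : ∀ {k : ℂ → ℂ}, (∀ z ∈ D, m ≤ ‖k z‖) → ∀ z ∈ D, k z ≠ 0 := fun h z hz =>
    norm_pos_iff.1 (hm.trans_le (h z hz))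
  have hdiv : ∀ {k : ℂ → ℂ}, ContDiff ℝ 2 k → (∀ z ∈ D, m ≤ ‖k z‖) → IntegrableOn
      (fun z => divLin p (k z) (fderiv ℝ k z 1) (fderiv ℝ k z Complex.I) ^ 2) D := fun hk h =>
    ((continuousOn_divLin hk (hne h)).pow 2).integrableOn_compact hD
  have hfc : ∀ v, Continuous fun z => fderiv ℝ f z v := fun v =>
    (hf.continuous_fderiv (by norm_num)).clm_apply continuous_const
  have hen : IntegrableOn (fun z => ‖fderiv ℝ f z 1‖ ^ 2 + ‖fderiv ℝ f z Complex.I‖ ^ 2) D :=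
    (((hfc 1).norm.pow 2).add ((hfc Complex.I).norm.pow 2)).continuousOn.integrableOn_compact hD
  have hs0 : ∀ z, 0 ≤ source p f g φ z := fun z => by unfold source; positivity
  have hdef : ∀ {k : ℂ → ℂ} {z : ℂ}, m ≤ ‖k z‖ → defect p k z ^ 2 ≤
      divLin p (k z) (fderiv ℝ k z 1) (fderiv ℝ k z Complex.I) ^ 2 / m ^ 2 := fun h => by
    rw [defect, div_pow]
    gcongr
  have him : ∀ (v : ℂ) {z : ℂ}, m ≤ ‖f z‖ → (lg f v z).im ^ 2 ≤ ‖fderiv ℝ f z v‖ ^ 2 / m ^ 2 :=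
    fun v z h => by
      rw [← div_pow, ← sq_abs (lg f v z).im]
      refine pow_le_pow_left₀ (abs_nonneg _) ((Complex.abs_im_le_norm _).trans ?_) 2
      rw [lg, norm_div]
      gcongr
  rw [← setIntegral_eq_integral_of_forall_compl_eq_zero (s := O) fun z hz => by
    rw [image_eq_zero_of_notMem_tsupport (fun h => hz (hηO h))]; simp]
  have hdiv2 : IntegrableOn (fun z =>
      B / m ^ 2 * (divLin p (f z) (fderiv ℝ f z 1) (fderiv ℝ f z Complex.I) ^ 2 +
        divLin p (g z) (fderiv ℝ g z 1) (fderiv ℝ g z Complex.I) ^ 2)) D :=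
    ((hdiv hf hmf).add (hdiv hg hmg)).const_mul _
  rw [← integral_add (hdiv hf hmf) (hdiv hg hmg), ← integral_const_mul, ← integral_const_mul,
    ← integral_add (hen.const_mul _) hdiv2]
  have hInt : IntegrableOn (fun z =>
      B' / m ^ 2 * (‖fderiv ℝ f z 1‖ ^ 2 + ‖fderiv ℝ f z Complex.I‖ ^ 2) +
      B / m ^ 2 * (divLin p (f z) (fderiv ℝ f z 1) (fderiv ℝ f z Complex.I) ^ 2 +
        divLin p (g z) (fderiv ℝ g z 1) (fderiv ℝ g z Complex.I) ^ 2)) D :=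
    (hen.const_mul _).add hdiv2
  refine le_trans (setIntegral_mono_of_nonneg hO (fun z hz => ?_) (hInt.mono_set hOD)
    fun z hz => ?_) (setIntegral_mono_set hInt (Eventually.of_forall fun z => ?_)
      (Eventually.of_forall hOD))
  · have := (hγ' z hz).1
    have := hs0 z
    positivity
  · obtain ⟨h0, h1, h2⟩ := hγ' z hz
    have hf' := hmf z (hOD hz)
    have hg' := hmg z (hOD hz)
    calc η z ^ 2 * (γ' z * source p f g φ z) ≤ 1 * (γ' z * source p f g φ z) := by
          have := hs0 z
          have := pow_le_one₀ (n := 2) (hη z).1 (hη z).2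
          gcongr
      _ = γ' z * φ z ^ 2 * ((lg f 1 z).im ^ 2 + (lg f Complex.I z).im ^ 2) +
          γ' z * (defect p f z ^ 2 + defect p g z ^ 2) := by
          rw [source]
          ring
      _ ≤ B' * (‖fderiv ℝ f z 1‖ ^ 2 / m ^ 2 + ‖fderiv ℝ f z Complex.I‖ ^ 2 / m ^ 2) +
          B * (divLin p (f z) (fderiv ℝ f z 1) (fderiv ℝ f z Complex.I) ^ 2 / m ^ 2 +
            divLin p (g z) (fderiv ℝ g z 1) (fderiv ℝ g z Complex.I) ^ 2 / m ^ 2) := by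
          gcongr
          · exact him 1 hf'
          · exact him Complex.I hf'
          · exact hdef hf'
          · exact hdef hg'
      _ = _ := by ring
  · simp only [Pi.zero_apply]
    positivity

/-- The angle between two nonvanishing gradients is a uniform limit of functions satisfying an
energy estimate. -/
theorem exists_approx_angle {p : ℝ} (hp : 1 < p) {V : Set ℂ} (hV : IsOpen V) {u v : ℂ → ℝ}
    (hu : PH p V u) (hv : PH p V v) (hne : ∀ z ∈ V, cgrad u z ≠ 0)
    (hne' : ∀ z ∈ V, cgrad v z ≠ 0) {D O : Set ℂ} (hD : IsCompact D) (hDV : D ⊆ V)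
    (hO : IsOpen O) (hOD : O ⊆ D) {c : ℂ} (hcu : ∀ z ∈ D, c * cgrad u z ∈ Complex.slitPlane)
    (hcv : ∀ z ∈ D, c * cgrad v z ∈ Complex.slitPlane) :
    ∃ M > 0, ∀ ε > 0, ∃ φ : ℂ → ℝ, ContDiffOn ℝ 1 φ O ∧
      (∀ z ∈ O, |φ z - (ang c (cgrad v) z - ang c (cgrad u) z)| ≤ ε) ∧
      ∀ γ γ' : ℂ → ℝ, ContDiffOn ℝ 1 γ O → ContinuousOn γ' O →
      (∀ z ∈ O, ∀ x, fderiv ℝ γ z x = γ' z * fderiv ℝ φ z x) →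
      ∀ η E : ℂ → ℝ, ContDiff ℝ 1 η → HasCompactSupport η → tsupport η ⊆ O →
      (∀ z, 0 ≤ η z ∧ η z ≤ 1) → Integrable E → (∀ z, 0 ≤ E z) →
      (∀ z ∈ O, (fderiv ℝ η z 1 ^ 2 + fderiv ℝ η z Complex.I ^ 2) * γ z ^ 2 ≤ γ' z * E z) →
      ∀ B B' : ℝ, 0 ≤ B → 0 ≤ B' →
      (∀ z ∈ O, 0 ≤ γ' z ∧ γ' z ≤ B ∧ γ' z * φ z ^ 2 ≤ B') →
      ∫ z, η z ^ 2 * (γ' z * (fderiv ℝ φ z 1 ^ 2 + fderiv ℝ φ z Complex.I ^ 2)) ≤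
        M * ((∫ z, E z) + B' + B * ε) := by
  rcases O.eq_empty_or_nonempty with rfl | ⟨z₀, hz₀⟩
  · refine ⟨1, one_pos, fun ε hε => ⟨0, by simp [ContDiffOn], by simp, ?_⟩⟩
    intro γ γ' _ _ _ η E _ _ hη _ _ hE _ B B' hB hB' _
    have : 0 ≤ ∫ z, E z := integral_nonneg hE
    have h : ∀ z, η z = 0 := fun z => image_eq_zero_of_notMem_tsupport fun h => hη h
    simp only [h]
    simp
    positivity
  have hc0 : c ≠ 0 := left_ne_zero_of_mul (Complex.slitPlane_ne_zero (hcu z₀ (hOD hz₀)))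
  obtain ⟨C, hC, hen⟩ := exists_energy_angle hp
  obtain ⟨m₁, hm₁, A, hA, hfapp⟩ := exists_approx_ang hp hV hu hne hD hDV hcu
  obtain ⟨m₂, hm₂, A₂, -, hgapp⟩ := exists_approx_ang hp hV hv hne' hD hDV hcv
  obtain ⟨m, hm⟩ : ∃ m, m = min m₁ m₂ := ⟨_, rfl⟩
  have hm0 : 0 < m := hm ▸ lt_min hm₁ hm₂
  refine ⟨C * (1 + (A + 1) / m ^ 2), by positivity, fun ε hε => ?_⟩
  obtain ⟨f, hf, hcf, hfD, hfA, hfd⟩ := hfapp (ε / 2) (by positivity)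
  obtain ⟨g, hg, hcg, hgD, -, hgd⟩ := hgapp (ε / 2) (by positivity)
  have hmf : ∀ z ∈ D, m ≤ ‖f z‖ := fun z hz => (hm ▸ min_le_left _ _ : m ≤ m₁).trans (hfD z hz).1
  have hmg : ∀ z ∈ D, m ≤ ‖g z‖ := fun z hz => (hm ▸ min_le_right _ _ : m ≤ m₂).trans (hgD z hz).1
  have hf0 : ∀ z ∈ O, f z ≠ 0 := fun z hz => norm_pos_iff.1 (hm0.trans_le (hmf z (hOD hz)))
  have hg0 : ∀ z ∈ O, g z ≠ 0 := fun z hz => norm_pos_iff.1 (hm0.trans_le (hmg z (hOD hz)))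
  have hφ : ContDiffOn ℝ 1 (fun z => ang c g z - ang c f z) O :=
    ((contDiffOn_ang hg fun z hz => (hgD z (hOD hz)).2.1).sub
      (contDiffOn_ang hf fun z hz => (hfD z (hOD hz)).2.1)).of_le (by norm_num)
  have hdφ : ∀ z ∈ O, ∀ x, fderiv ℝ (fun z => ang c g z - ang c f z) z x =
      (lg g x z).im - (lg f x z).im := fun z hz x => by
    obtain ⟨d1, e1⟩ := hasFDerivAt_ang (hf.differentiable (by norm_num) z) (hfD z (hOD hz)).2.1
    obtain ⟨d2, e2⟩ := hasFDerivAt_ang (hg.differentiable (by norm_num) z) (hgD z (hOD hz)).2.1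
    rw [fderiv_fun_sub d2 d1, _root_.sub_apply, e1, e2]
  refine ⟨fun z => ang c g z - ang c f z, hφ, fun z hz => ?_, ?_⟩
  · have h1 := abs_le.1 (hfD z (hOD hz)).2.2
    have h2 := abs_le.1 (hgD z (hOD hz)).2.2
    rw [abs_le]
    constructor <;> linarith
  intro γ γ' hγ hγ' hdγ η E hη hηc hηO hη01 hE hE0 hηE B B' hB hB' hbd
  have h1 := hen f g hf hg hcf hcg O hO hf0 hg0 _ hφ.continuousOn
    (fun z hz => norm_div_norm_sub_le hc0 (hf0 z hz) (hg0 z hz)) γ γ' hγ hγ'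
    (fun z hz => (hbd z hz).1) (fun z hz x => by rw [hdγ z hz, hdφ z hz]) η E hη hηc hηO hE hE0 hηE
  have h2 := integral_source_le (p := p) hf hg hD hO.measurableSet hOD hm0 hB hB' hmf hmg hη01 hηO
    hbd
  have e : (fun z => η z ^ 2 * (γ' z * (fderiv ℝ (fun z => ang c g z - ang c f z) z 1 ^ 2 +
      fderiv ℝ (fun z => ang c g z - ang c f z) z Complex.I ^ 2))) = fun z => η z ^ 2 * (γ' z *
        (((lg g 1 z).im - (lg f 1 z).im) ^ 2 +
        ((lg g Complex.I z).im - (lg f Complex.I z).im) ^ 2)) := funext fun z => by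
    by_cases hz : z ∈ tsupport η
    · rw [hdφ z (hηO hz), hdφ z (hηO hz)]
    · simp [image_eq_zero_of_notMem_tsupport hz]
  rw [e]
  refine h1.trans ?_
  rw [mul_assoc]
  refine mul_le_mul_of_nonneg_left ?_ hC.le
  have i1 : 0 ≤ ∫ z, E z := integral_nonneg hE0
  have h3 := mul_le_mul_of_nonneg_left hfA (by positivity : 0 ≤ B' / m ^ 2)
  have h4 := mul_le_mul_of_nonneg_left (add_le_add hfd hgd) (by positivity : 0 ≤ B / m ^ 2)
  have h5 : B' / m ^ 2 * A + B / m ^ 2 * (ε / 2 + ε / 2) ≤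
      (A + 1) / m ^ 2 * ((∫ z, E z) + B' + B * ε) := by
    have : (A + 1) / m ^ 2 * ((∫ z, E z) + B' + B * ε) -
        (B' / m ^ 2 * A + B / m ^ 2 * (ε / 2 + ε / 2)) =
        (A + 1) / m ^ 2 * (∫ z, E z) + B' / m ^ 2 + A * B * ε / m ^ 2 := by ring
    have : 0 ≤ (A + 1) / m ^ 2 * (∫ z, E z) + B' / m ^ 2 + A * B * ε / m ^ 2 := by positivity
    linarith
  have : 0 ≤ B' + B * ε := by positivity
  linarith

set_option maxHeartbeats 1000000 in
/-- The comparison principle: the angle between two nonvanishing gradients is nonpositive if it is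
negative on the boundary. -/
theorem ang_le_of_frontier {p : ℝ} (hp : 1 < p) {V : Set ℂ} (hV : IsOpen V) {u v : ℂ → ℝ}
    (hu : PH p V u) (hv : PH p V v) (hne : ∀ z ∈ V, cgrad u z ≠ 0)
    (hne' : ∀ z ∈ V, cgrad v z ≠ 0) {D O : Set ℂ} (hD : IsCompact D) (hDV : D ⊆ V)
    (hO : IsOpen O) (hOD : O ⊆ D) {c : ℂ} (hcu : ∀ z ∈ D, c * cgrad u z ∈ Complex.slitPlane)
    (hcv : ∀ z ∈ D, c * cgrad v z ∈ Complex.slitPlane)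
    (hbd : ∀ z ∈ D \ O, ang c (cgrad v) z < ang c (cgrad u) z) {z : ℂ} (hz : z ∈ D) :
    ang c (cgrad v) z ≤ ang c (cgrad u) z := by
  by_contra! hlt
  obtain ⟨w, hw⟩ : ∃ w : ℂ → ℝ, w = fun y => ang c (cgrad v) y - ang c (cgrad u) y := ⟨_, rfl⟩
  have hwc : ContinuousOn w D := hw ▸ (continuousOn_ang hv.continuous_cgrad.continuousOn hcv).sub
    (continuousOn_ang hu.continuous_cgrad.continuousOn hcu)
  have hwz : 0 < w z := by rw [hw]; exact sub_pos.2 hlt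
  obtain ⟨t, ht, htle⟩ : ∃ t > 0, ∀ y ∈ D \ O, t ≤ -w y :=
    (hD.diff hO).exists_forall_le' (hwc.mono sdiff_subset).neg (a := 0) (fun y hy => by
      have := hbd y hy
      rw [hw]
      change 0 < -(ang c (cgrad v) y - ang c (cgrad u) y)
      linarith)
  obtain ⟨M, hM, happ⟩ := exists_approx_angle hp hV hu hv hne hne' hD hDV hO hOD hcu hcv
  obtain ⟨s, hs0, hs⟩ : ∃ s > 0, s < min (t / 2) (w z / 4) :=
    exists_between (lt_min (by positivity) (by positivity))
  obtain ⟨hs1, hs2⟩ := lt_min_iff.1 hs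
  have hL : IsCompact (D ∩ w ⁻¹' Ici (-s)) :=
    hD.of_isClosed_subset (hwc.preimage_isClosed_of_isClosed hD.isClosed isClosed_Ici)
      inter_subset_left
  have hLO : D ∩ w ⁻¹' Ici (-s) ⊆ O := fun y hy => by
    by_contra h
    have h1 := htle y ⟨hy.1, h⟩
    have h2 : -s ≤ w y := hy.2
    linarith
  obtain ⟨η, hη, hηc, hηO, hη01, O', hO', hLO', hη1⟩ := exists_bump hL hO hLO
  have hη' : ContDiff ℝ 1 η := hη.of_le (by simp)
  have hzL : z ∈ D ∩ w ⁻¹' Ici (-s) := ⟨hz, by simp only [mem_preimage, mem_Ici]; linarith⟩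
  obtain ⟨r, hr, hball⟩ := Metric.isOpen_iff.1 (((hwc.mono hOD).isOpen_inter_preimage hO
    (isOpen_Ioi (a := w z / 2))).inter hO') z ⟨⟨hLO hzL, by simp only [mem_preimage, mem_Ioi]; linarith⟩, hLO' hzL⟩
  obtain ⟨ρ, hρ⟩ := hD.isBounded.exists_norm_le
  have hμ : 0 < volume.real (Metric.ball z r) :=
    ENNReal.toReal_pos (Metric.measure_ball_pos volume z hr).ne' measure_ball_lt_top.ne
  obtain ⟨A, hA⟩ : ∃ A, A = 4 * ρ ^ 2 * (M * 32) := ⟨_, rfl⟩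
  have hA0 : 0 ≤ A := by rw [hA]; positivity
  obtain ⟨N, hN⟩ : ∃ N, N = 1 + A / volume.real (Metric.ball z r) := ⟨_, rfl⟩
  have hN1 : 1 ≤ N := by
    rw [hN]
    have : 0 ≤ A / volume.real (Metric.ball z r) := by positivity
    linarith
  obtain ⟨ε, hε⟩ : ∃ ε, ε = w z / 4 * Real.exp (-(N / 2)) := ⟨_, rfl⟩
  have hε0 : 0 < ε := by rw [hε]; positivity
  obtain ⟨φ, hφ, hφw, hen⟩ := happ (min s (ε ^ 2)) (by positivity)
  have hφw' : ∀ y ∈ O, |φ y - w y| ≤ s := fun y hy => by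
    rw [hw]
    exact (hφw y hy).trans (min_le_left _ _)
  have hΓ : ∀ t, HasDerivAt (fun t => (max t 0) ^ 2 / (max t 0 + ε) ^ 2)
      (2 * max t 0 * ε / (max t 0 + ε) ^ 3) t :=
    hasDerivAt_comp_max (k := fun x => x ^ 2 / (x + ε) ^ 2)
      (k' := fun x => 2 * x * ε / (x + ε) ^ 3)
      (fun x hx => by
        have h1 : HasDerivAt (fun x : ℝ => x ^ 2) (2 * x) x := by simpa using hasDerivAt_pow 2 x
        have h2 : HasDerivAt (fun x : ℝ => (x + ε) ^ 2) (2 * (x + ε)) x := by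
          simpa using ((hasDerivAt_id x).add_const ε).fun_pow 2
        have h3 : x + ε ≠ 0 := by positivity
        exact (h1.div h2 (by positivity)).congr_deriv (by field_simp; ring)) (by simp)
  have hh : ∀ t, HasDerivAt (fun t => Real.log (1 + (max t 0) ^ 2 / ε ^ 2))
      (2 * max t 0 / ((max t 0) ^ 2 + ε ^ 2)) t :=
    hasDerivAt_comp_max (k := fun x => Real.log (1 + x ^ 2 / ε ^ 2))
      (k' := fun x => 2 * x / (x ^ 2 + ε ^ 2))
      (fun x hx => by
        have h1 : HasDerivAt (fun x : ℝ => 1 + x ^ 2 / ε ^ 2) (2 * x / ε ^ 2) x := by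
          simpa using ((hasDerivAt_pow 2 x).div_const (ε ^ 2)).const_add 1
        have h3 : 1 + x ^ 2 / ε ^ 2 ≠ 0 := by positivity
        exact (h1.log h3).congr_deriv (by field_simp; ring)) (by simp)
  have hΓ'c : Continuous fun t : ℝ => 2 * max t 0 * ε / (max t 0 + ε) ^ 3 := by
    refine Continuous.div (by fun_prop) (by fun_prop) fun t => ?_
    positivity
  have hh'c : Continuous fun t : ℝ => 2 * max t 0 / ((max t 0) ^ 2 + ε ^ 2) := by
    refine Continuous.div (by fun_prop) (by fun_prop) fun t => ?_
    positivity
  have hoff : ∀ y ∈ O, ∀ x, fderiv ℝ η y x ≠ 0 → max (φ y) 0 = 0 := by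
    intro y hy x hx
    have hyA : y ∉ O' := fun h => hx (by
      rw [(eventuallyEq_of_mem (hO'.mem_nhds h) fun x hx => hη1 x hx :
        η =ᶠ[𝓝 y] fun _ => 1).fderiv_eq]
      simp)
    have h1 : w y < -s := by
      by_contra! h
      exact hyA (hLO' ⟨hOD hy, h⟩)
    have h2 := abs_le.1 (hφw' y hy)
    exact max_eq_right (by linarith)
  have hφd : ∀ y ∈ O, DifferentiableAt ℝ φ y := fun y hy =>
    (hφ.contDiffAt (hO.mem_nhds hy)).differentiableAt (by norm_num)
  have hE := hen (fun y => (max (φ y) 0) ^ 2 / (max (φ y) 0 + ε) ^ 2)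
    (fun y => 2 * max (φ y) 0 * ε / (max (φ y) 0 + ε) ^ 3)
    ((contDiff_of_hasDerivAt hΓ hΓ'c).comp_contDiffOn hφ)
    (hΓ'c.comp_continuousOn hφ.continuousOn)
    (fun y hy x => fderiv_comp_of_hasDerivAt (hΓ (φ y)) (hφd y hy) x) η (fun _ => 0) hη' hηc hηO
    hη01 (by simp) (fun _ => le_rfl) (fun y hy => by
      rcases eq_or_ne (max (φ y) 0) 0 with h | h
      · rw [h]; simp
      · have h1 : ∀ x, fderiv ℝ η y x = 0 := fun x => by
          by_contra hx
          exact h (hoff y hy x hx)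
        simp [h1]) (2 / ε) (2 * ε) (by positivity) (by positivity) (fun y hy => by
      have h0 : 0 ≤ max (φ y) 0 := le_max_right _ _
      refine ⟨by positivity, ?_, ?_⟩
      · generalize max (φ y) 0 = x at *
        rw [div_le_div_iff₀ (by positivity) hε0]
        nlinarith [pow_nonneg h0 3, mul_nonneg h0 hε0.le, mul_nonneg (mul_nonneg h0 h0) hε0.le,
          mul_nonneg h0 (sq_nonneg ε), pow_pos hε0 3]
      · rcases le_total (φ y) 0 with h | h
        · rw [max_eq_right h]
          simp only [mul_zero, zero_mul, zero_div]
          positivity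
        · rw [max_eq_left h, div_mul_eq_mul_div, div_le_iff₀ (by positivity)]
          generalize φ y = x at *
          have : x ^ 3 ≤ (x + ε) ^ 3 := by gcongr; linarith
          nlinarith)
  have hE' : ∫ y, η y ^ 2 * (2 * max (φ y) 0 * ε / (max (φ y) 0 + ε) ^ 3 *
      (fderiv ℝ φ y 1 ^ 2 + fderiv ℝ φ y Complex.I ^ 2)) ≤ M * (4 * ε) := by
    refine hE.trans (mul_le_mul_of_nonneg_left ?_ hM.le)
    have h1 : 2 / ε * min s (ε ^ 2) ≤ 2 / ε * ε ^ 2 := by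
      gcongr
      exact min_le_right _ _
    have h2 : 2 / ε * ε ^ 2 = 2 * ε := by field_simp
    rw [integral_zero]
    linarith
  obtain ⟨h, hhdef⟩ : ∃ h : ℂ → ℝ, h = fun y => Real.log (1 + (max (φ y) 0) ^ 2 / ε ^ 2) :=
    ⟨_, rfl⟩
  have hhC : ContDiffOn ℝ 1 h O := hhdef ▸ (contDiff_of_hasDerivAt hh hh'c).comp_contDiffOn hφ
  have hfr := integral_sq_cutoff_le hO hη' hηc hηO hhC (fun y hy => by
    rcases eq_or_ne (fderiv ℝ η y 1) 0 with h1 | h1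
    · rw [h1, zero_mul]
    · rw [hhdef]
      simp [hoff y hy 1 h1]) (r := ρ) fun y hy =>
        (Complex.abs_re_le_norm y).trans (hρ y (hOD (hηO hy)))
  have hdφc : ∀ x, ContinuousOn (fun y => fderiv ℝ φ y x) O := fun x =>
    (hφ.continuousOn_fderiv_of_isOpen hO le_rfl).clm_apply continuousOn_const
  have hdh : ∫ y, η y ^ 2 * fderiv ℝ h y 1 ^ 2 ≤ 8 / ε * ∫ y, η y ^ 2 *
      (2 * max (φ y) 0 * ε / (max (φ y) 0 + ε) ^ 3 *
      (fderiv ℝ φ y 1 ^ 2 + fderiv ℝ φ y Complex.I ^ 2)) := by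
    rw [← integral_const_mul]
    refine integral_mono_of_nonneg (Eventually.of_forall fun y => ?_) (Integrable.const_mul ?_ _)
      (Eventually.of_forall fun y => ?_)
    · simp only [Pi.zero_apply]
      positivity
    · exact integrable_sq_mul hO hη'.continuous hηc hηO
        ((hΓ'c.comp_continuousOn hφ.continuousOn).mul
          (((hdφc 1).pow 2).add ((hdφc Complex.I).pow 2)))
    · by_cases hy : y ∈ tsupport η
      · have hyO := hηO hy
        dsimp only
        rw [hhdef, fderiv_comp_of_hasDerivAt (hh (φ y)) (hφd y hyO)]
        have h2 : 0 ≤ max (φ y) 0 := le_max_right _ _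
        generalize max (φ y) 0 = x at *
        have h3 : (2 * x / (x ^ 2 + ε ^ 2)) ^ 2 ≤ 8 / ε * (2 * x * ε / (x + ε) ^ 3) := by
          have e : 8 / ε * (2 * x * ε / (x + ε) ^ 3) = 16 * x / (x + ε) ^ 3 := by
            field_simp
            ring
          rw [e, div_pow, div_le_div_iff₀ (by positivity) (by positivity)]
          have h4 : x * (x + ε) ≤ 2 * (x ^ 2 + ε ^ 2) := by nlinarith [sq_nonneg (x - ε), sq_nonneg ε]
          have h5 : (x + ε) ^ 2 ≤ 2 * (x ^ 2 + ε ^ 2) := by nlinarith [sq_nonneg (x - ε)]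
          have h6 := mul_le_mul h4 h5 (by positivity) (by positivity)
          have h7 := mul_le_mul_of_nonneg_left h6 (by positivity : 0 ≤ 4 * x)
          nlinarith
        calc η y ^ 2 * (2 * x / (x ^ 2 + ε ^ 2) * fderiv ℝ φ y 1) ^ 2
            = η y ^ 2 * ((2 * x / (x ^ 2 + ε ^ 2)) ^ 2 * fderiv ℝ φ y 1 ^ 2) := by ring
          _ ≤ η y ^ 2 * (8 / ε * (2 * x * ε / (x + ε) ^ 3) *
              (fderiv ℝ φ y 1 ^ 2 + fderiv ℝ φ y Complex.I ^ 2)) := by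
              gcongr
              linarith [sq_nonneg (fderiv ℝ φ y Complex.I)]
          _ = _ := by ring
      · simp [image_eq_zero_of_notMem_tsupport hy]
  have hlow : N ^ 2 * volume.real (Metric.ball z r) ≤ ∫ y, (η y * h y) ^ 2 := by
    have i : Integrable fun y => (η y * h y) ^ 2 := by
      simp_rw [mul_pow]
      exact integrable_sq_mul hO hη'.continuous hηc hηO (hhC.continuousOn.pow 2)
    calc N ^ 2 * volume.real (Metric.ball z r) = ∫ y in Metric.ball z r, N ^ 2 := by
          rw [setIntegral_const, smul_eq_mul, mul_comm]
      _ ≤ ∫ y in Metric.ball z r, (η y * h y) ^ 2 := by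
          refine setIntegral_mono_on (integrableOn_const measure_ball_lt_top.ne enorm_ne_top)
            i.integrableOn Metric.isOpen_ball.measurableSet fun y hy => ?_
          obtain ⟨⟨hyO, hyw⟩, hyO'⟩ := hball hy
          have hyw' : w z / 2 < w y := hyw
          have h1 := abs_le.1 (hφw' y hyO)
          have h2 : w z / 4 ≤ max (φ y) 0 := le_max_of_le_left (by linarith)
          have h3 : Real.exp N ≤ 1 + (max (φ y) 0) ^ 2 / ε ^ 2 := by
            have h4 : (w z / 4) ^ 2 / ε ^ 2 = Real.exp N := by
              have h5 : Real.exp N * Real.exp (-(N / 2)) ^ 2 = 1 := by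
                rw [← Real.exp_nat_mul, ← Real.exp_add]
                norm_num
                ring
              rw [div_eq_iff (by positivity), hε, mul_pow, mul_left_comm, h5, mul_one]
            have h6 : (w z / 4) ^ 2 / ε ^ 2 ≤ (max (φ y) 0) ^ 2 / ε ^ 2 := by gcongr
            linarith
          have h7 : N ≤ Real.log (1 + (max (φ y) 0) ^ 2 / ε ^ 2) := by
            rw [← Real.log_exp N]
            exact Real.log_le_log (Real.exp_pos N) h3
          rw [hη1 y hyO', one_mul, hhdef]
          exact pow_le_pow_left₀ (by linarith) h7 2
      _ ≤ ∫ y, (η y * h y) ^ 2 := setIntegral_le_integral i (Eventually.of_forall fun y => by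
          simp only [Pi.zero_apply]
          positivity)
  have hup : ∫ y, (η y * h y) ^ 2 ≤ A := by
    refine hfr.trans ?_
    rw [hA]
    gcongr
    refine hdh.trans ((mul_le_mul_of_nonneg_left hE' (by positivity)).trans_eq ?_)
    field_simp
    ring
  have h1 : N * volume.real (Metric.ball z r) = volume.real (Metric.ball z r) + A := by
    rw [hN]
    field_simp
  nlinarith

theorem rigid_preimage_ball (c : Circle) (R : ℝ) :
    rigid c 0 ⁻¹' Metric.ball (0 : ℂ) R = Metric.ball 0 R := by
  ext z
  simp only [mem_preimage, mem_ball_zero_iff, rigid_apply, add_zero, norm_mul, Circle.norm_coe,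
    one_mul]

/-- The strict maximum principle for the angle between two gradients, by comparison with a
rotated copy. -/
theorem ang_lt_of_frontier {p : ℝ} (hp : 1 < p) {R : ℝ} {u v : ℂ → ℝ}
    (hu : PH p (Metric.ball 0 R) u) (hv : PH p (Metric.ball 0 R) v)
    (hne : ∀ z ∈ Metric.ball (0 : ℂ) R, cgrad u z ≠ 0)
    (hne' : ∀ z ∈ Metric.ball (0 : ℂ) R, cgrad v z ≠ 0) {D O : Set ℂ} (hD : IsCompact D)
    (hDR : D ⊆ Metric.ball 0 R) (hO : IsOpen O) (hOD : O ⊆ D) {c : ℂ} (hc : c * cgrad u 0 = 1)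
    (hcu : ∀ z ∈ D, c * cgrad u z ∈ Complex.slitPlane)
    (hcv : ∀ z ∈ D, c * cgrad v z ∈ Complex.slitPlane)
    (hbd : ∀ z ∈ D \ O, ang c (cgrad u) z < ang c (cgrad v) z) (h0 : 0 ∈ D) :
    0 < ang c (cgrad v) 0 := by
  have hf := hu.continuous_cgrad
  have hg := hv.continuous_cgrad
  obtain ⟨f, hfdef⟩ : ∃ f, f = cgrad u := ⟨_, rfl⟩
  have hrot : ∀ (θ : ℝ) (z : ℂ), cgrad (fun z => u (rigid (Circle.exp (-θ)) 0 z)) z =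
      Complex.exp (θ * Complex.I) * f (Complex.exp (-(θ * Complex.I)) * z) := fun θ z => by
    rw [cgrad_comp_rigid hu.differentiable, ← Circle.exp_neg, neg_neg, rigid_apply, add_zero,
      Circle.coe_exp, Circle.coe_exp, hfdef]
    push_cast
    rw [neg_mul]
  obtain ⟨F, hF⟩ : ∃ F : ℝ × ℂ → ℂ, F = fun q => c * (Complex.exp (q.1 * Complex.I) *
    f (Complex.exp (-(q.1 * Complex.I)) * q.2)) := ⟨_, rfl⟩
  have hF0 : ∀ z, F (0, z) = c * f z := fun z => by rw [hF]; simp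
  have hFc : Continuous F := by
    rw [← hfdef] at hf
    rw [hF]
    fun_prop
  have ev1 : ∀ᶠ θ : ℝ in 𝓝 0, ∀ z ∈ D, F (θ, z) ∈ Complex.slitPlane :=
    hD.eventually_forall_of_forall_eventually fun z hz =>
      hFc.continuousAt.eventually_mem (Complex.isOpen_slitPlane.mem_nhds (by
        rw [hF0, hfdef]
        exact hcu z hz))
  have ev2 : ∀ᶠ θ : ℝ in 𝓝 0, ∀ z ∈ D \ O, Complex.arg (F (θ, z)) < Complex.arg (c * cgrad v z) :=
    (hD.diff hO).eventually_forall_of_forall_eventually fun z hz => by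
      have c1 : ContinuousAt (fun q : ℝ × ℂ => Complex.arg (F q)) (0, z) :=
        ContinuousAt.comp (g := Complex.arg) (Complex.continuousAt_arg (by
          rw [hF0, hfdef]
          exact hcu z hz.1)) hFc.continuousAt
      have c2 : ContinuousAt (fun q : ℝ × ℂ => Complex.arg (c * cgrad v q.2)) (0, z) :=
        ContinuousAt.comp (g := Complex.arg) (f := fun q : ℝ × ℂ => c * cgrad v q.2)
          (Complex.continuousAt_arg (hcv z hz.1)) (by fun_prop)
      refine c1.eventually_lt c2 ?_
      rw [hF0, hfdef]
      exact hbd z hz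
  obtain ⟨θ, ⟨⟨hθ1, hθ2⟩, hθπ⟩, hθ0⟩ := (((ev1.and ev2).and (eventually_lt_nhds Real.pi_pos)).filter_mono
    nhdsWithin_le_nhds |>.and (self_mem_nhdsWithin (s := Ioi (0 : ℝ)))).exists
  have hθ0' : 0 < θ := hθ0
  have hFθ : ∀ z, c * cgrad (fun z => u (rigid (Circle.exp (-θ)) 0 z)) z = F (θ, z) := fun z => by
    rw [hrot, hF]
  have hut := hu.comp_rigid (Circle.exp (-θ)) 0
  rw [rigid_preimage_ball] at hut
  have h := ang_le_of_frontier hp Metric.isOpen_ball hv hut hne' (fun z hz => by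
      rw [cgrad_comp_rigid hu.differentiable]
      refine mul_ne_zero (Circle.coe_ne_zero _) (hne _ ?_)
      rwa [← mem_preimage, rigid_preimage_ball]) hD hDR hO hOD (c := c) hcv
    (fun z hz => by rw [hFθ]; exact hθ1 z hz)
    (fun z hz => by rw [ang, ang, hFθ]; exact hθ2 z hz) h0
  have h1 : ang c (cgrad fun z => u (rigid (Circle.exp (-θ)) 0 z)) 0 = θ := by
    rw [ang, hrot, mul_zero, mul_left_comm, hfdef, hc, mul_one, ← Circle.coe_exp]
    exact Circle.arg_exp (by linarith [Real.pi_pos]) hθπ.le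
  linarith

set_option maxHeartbeats 1000000 in
/-- Harnack's inequality for a nonnegative angle, in logarithmic form. -/
theorem exists_log_angle {p : ℝ} (hp : 1 < p) {V : Set ℂ} (hV : IsOpen V) {u v : ℂ → ℝ}
    (hu : PH p V u) (hv : PH p V v) (hne : ∀ z ∈ V, cgrad u z ≠ 0)
    (hne' : ∀ z ∈ V, cgrad v z ≠ 0) {Q D O : Set ℂ} (hQ : IsCompact Q) (hD : IsCompact D)
    (hDV : D ⊆ V) (hO : IsOpen O) (hOD : O ⊆ D) (hQO : Q ⊆ O) {c : ℂ}
    (hcu : ∀ z ∈ D, c * cgrad u z ∈ Complex.slitPlane)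
    (hcv : ∀ z ∈ D, c * cgrad v z ∈ Complex.slitPlane)
    (hle : ∀ z ∈ D, ang c (cgrad u) z ≤ ang c (cgrad v) z) :
    ∃ C, ∀ ε > 0, ∃ φ : ℂ → ℝ, ContDiffOn ℝ 1 (fun z => Real.log (φ z + ε)) O ∧
      (∀ z ∈ O, |φ z - (ang c (cgrad v) z - ang c (cgrad u) z)| ≤ ε / 2) ∧
      ∫ z in Q, (fderiv ℝ (fun z => Real.log (φ z + ε)) z 1 ^ 2 +
        fderiv ℝ (fun z => Real.log (φ z + ε)) z Complex.I ^ 2) ≤ C := by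
  obtain ⟨M, hM, happ⟩ := exists_approx_angle hp hV hu hv hne hne' hD hDV hO hOD hcu hcv
  obtain ⟨η, hη, hηc, hηO, hη01, O', hO', hQO', hη1⟩ := exists_bump hQ hO hQO
  have hη' : ContDiff ℝ 1 η := hη.of_le (by simp)
  have hEi : Integrable fun z => fderiv ℝ η z 1 ^ 2 + fderiv ℝ η z Complex.I ^ 2 := by
    refine integrable_of_tsupport (((continuous_fderiv_apply_of_contDiff hη' 1).pow 2).add
      ((continuous_fderiv_apply_of_contDiff hη' Complex.I).pow 2)) hηc fun z hz => ?_
    rw [fderiv_of_notMem_tsupport (𝕜 := ℝ) hz]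
    simp
  refine ⟨M * ((∫ z, (fderiv ℝ η z 1 ^ 2 + fderiv ℝ η z Complex.I ^ 2)) + 1 + 4),
    fun ε hε => ?_⟩
  obtain ⟨φ, hφ, hφw, hen⟩ := happ (min (ε / 2) (ε ^ 2)) (by positivity)
  have hφw' : ∀ z ∈ O, |φ z - (ang c (cgrad v) z - ang c (cgrad u) z)| ≤ ε / 2 := fun z hz =>
    (hφw z hz).trans (min_le_left _ _)
  have hφε : ∀ z ∈ O, ε / 2 ≤ φ z + ε := fun z hz => by
    have h1 := abs_le.1 (hφw' z hz)
    have h2 := hle z (hOD hz)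
    linarith
  have hφ0 : ∀ z ∈ O, φ z + ε ≠ 0 := fun z hz => by
    have := hφε z hz
    linarith
  have hφd : ∀ y ∈ O, DifferentiableAt ℝ φ y := fun y hy =>
    (hφ.contDiffAt (hO.mem_nhds hy)).differentiableAt (by norm_num)
  have hinv : ContDiffOn ℝ 1 (fun z => (φ z + ε)⁻¹) O := (hφ.add contDiffOn_const).inv hφ0
  have hlog : ContDiffOn ℝ 1 (fun z => Real.log (φ z + ε)) O := (hφ.add contDiffOn_const).log hφ0
  have hdlog : ∀ z ∈ O, ∀ x, fderiv ℝ (fun z => Real.log (φ z + ε)) z x =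
      (φ z + ε)⁻¹ * fderiv ℝ φ z x := fun z hz x =>
    fderiv_comp_of_hasDerivAt (Γ := fun t => Real.log (t + ε))
      ((((hasDerivAt_id (φ z)).add_const ε).log (hφ0 z hz)).congr_deriv (by simp)) (hφd z hz) x
  have hE := hen (fun z => -(φ z + ε)⁻¹) (fun z => ((φ z + ε)⁻¹) ^ 2) hinv.neg
    (hinv.continuousOn.pow 2) (fun z hz x =>
      fderiv_comp_of_hasDerivAt (Γ := fun t => -(t + ε)⁻¹)
        ((((hasDerivAt_id (φ z)).add_const ε).inv (hφ0 z hz)).neg.congr_deriv (by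
          have := hφ0 z hz
          simp only [id]
          field_simp)) (hφd z hz) x)
    η _ hη' hηc hηO hη01 hEi (fun z => by positivity) (fun z _ => le_of_eq (by ring)) (4 / ε ^ 2) 1
    (by positivity) zero_le_one (fun z hz => by
      have h1 := hφε z hz
      have h2 : 0 < φ z + ε := by linarith
      refine ⟨by positivity, ?_, ?_⟩
      · rw [inv_pow, ← one_div, div_le_div_iff₀ (by positivity) (by positivity)]
        nlinarith
      · rw [inv_pow, inv_mul_le_iff₀ (by positivity)]
        nlinarith)
  have hdφc : ∀ x, ContinuousOn (fun y => fderiv ℝ φ y x) O := fun x =>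
    (hφ.continuousOn_fderiv_of_isOpen hO le_rfl).clm_apply continuousOn_const
  have hInt := integrable_sq_mul hO hη'.continuous hηc hηO
    ((hinv.continuousOn.pow 2).mul (((hdφc 1).pow 2).add ((hdφc Complex.I).pow 2)))
  refine ⟨φ, hlog, hφw', ?_⟩
  calc ∫ z in Q, (fderiv ℝ (fun z => Real.log (φ z + ε)) z 1 ^ 2 +
        fderiv ℝ (fun z => Real.log (φ z + ε)) z Complex.I ^ 2)
      = ∫ z in Q, η z ^ 2 * (((φ z + ε)⁻¹) ^ 2 *
          (fderiv ℝ φ z 1 ^ 2 + fderiv ℝ φ z Complex.I ^ 2)) := by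
        refine setIntegral_congr_fun hQ.measurableSet fun z hz => ?_
        rw [hdlog z (hQO hz), hdlog z (hQO hz), hη1 z (hQO' hz)]
        ring
    _ ≤ ∫ z, η z ^ 2 * (((φ z + ε)⁻¹) ^ 2 * (fderiv ℝ φ z 1 ^ 2 + fderiv ℝ φ z Complex.I ^ 2)) :=
        setIntegral_le_integral hInt (Eventually.of_forall fun z => by
          simp only [Pi.zero_apply]
          positivity)
    _ ≤ _ := hE
    _ ≤ _ := by
        have h1 : 4 / ε ^ 2 * min (ε / 2) (ε ^ 2) ≤ 4 / ε ^ 2 * ε ^ 2 := by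
          gcongr
          exact min_le_right _ _
        rw [div_mul_cancel₀ _ (by positivity)] at h1
        gcongr

set_option maxHeartbeats 1000000 in
theorem ang_le_zero_of_real {p : ℝ} (hp : 1 < p) {R a : ℝ} {u v : ℂ → ℝ}
    (hu : PH p (Metric.ball 0 R) u) (hv : PH p (Metric.ball 0 R) v)
    (hne : ∀ z ∈ Metric.ball (0 : ℂ) R, cgrad u z ≠ 0)
    (hne' : ∀ z ∈ Metric.ball (0 : ℂ) R, cgrad v z ≠ 0) {c : ℂ} (hc : c * cgrad u 0 = 1)
    (hcu : ∀ z ∈ Metric.ball (0 : ℂ) R, c * cgrad u z ∈ Complex.slitPlane)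
    (hcv : ∀ z ∈ Metric.ball (0 : ℂ) R, c * cgrad v z ∈ Complex.slitPlane)
    (hle : ∀ z ∈ Metric.ball (0 : ℂ) R, ang c (cgrad u) z ≤ ang c (cgrad v) z)
    (h0 : ang c (cgrad v) 0 = 0) (ha : 0 < a) (haR : 6 * a < R) :
    ang c (cgrad v) a ≤ ang c (cgrad u) a := by
  by_contra! hlt
  obtain ⟨w, hw⟩ : ∃ w : ℂ → ℝ, w = fun y => ang c (cgrad v) y - ang c (cgrad u) y := ⟨_, rfl⟩
  have hwc : ContinuousOn w (Metric.ball 0 R) :=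
    hw ▸ (continuousOn_ang hv.continuous_cgrad.continuousOn hcv).sub
      (continuousOn_ang hu.continuous_cgrad.continuousOn hcu)
  have hwa : 0 < w a := by rw [hw]; exact sub_pos.2 hlt
  have haball : (a : ℂ) ∈ Metric.ball (0 : ℂ) R := by
    rw [mem_ball_zero_iff, Complex.norm_real, Real.norm_eq_abs, abs_of_pos ha]
    linarith
  obtain ⟨r, hr, hball⟩ := Metric.isOpen_iff.1 (hwc.isOpen_inter_preimage Metric.isOpen_ball
    (isOpen_Ioi (a := w a / 2))) a ⟨haball, by simp only [mem_preimage, mem_Ioi]; linarith⟩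
  obtain ⟨β, hβ, hβ'⟩ : ∃ β > 0, β < min r (a / 2) :=
    exists_between (lt_min hr (by positivity))
  obtain ⟨hβr, hβa⟩ := lt_min_iff.1 hβ'
  obtain ⟨Q, hQ⟩ : ∃ Q, Q = Icc (-(2 * β)) (a + β) ×ℂ Icc (-(2 * β)) (2 * β) := ⟨_, rfl⟩
  have hQc : IsCompact Q := hQ ▸ isCompact_Icc.reProdIm isCompact_Icc
  have hQO : Q ⊆ Metric.ball 0 (4 * a) :=
    hQ ▸ reProdIm_subset_ball hβ (by linarith) (by linarith)
  have hDR : Metric.closedBall (0 : ℂ) (4 * a) ⊆ Metric.ball 0 R :=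
    Metric.closedBall_subset_ball (by linarith)
  obtain ⟨C, hC⟩ := exists_log_angle hp Metric.isOpen_ball hu hv hne hne' hQc
    (isCompact_closedBall 0 (4 * a)) hDR Metric.isOpen_ball Metric.ball_subset_closedBall hQO
    (c := c) (fun z hz => hcu z (hDR hz)) (fun z hz => hcv z (hDR hz))
    (fun z hz => hle z (hDR hz))
  obtain ⟨N, hN⟩ : ∃ N, N = 4 * ((volume.real Q + C) / β) + 1 := ⟨_, rfl⟩
  obtain ⟨ε, hε⟩ : ∃ ε, ε = w a / 4 * Real.exp (-N) := ⟨_, rfl⟩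
  have hε0 : 0 < ε := by rw [hε]; positivity
  obtain ⟨φ, hφ, hφw, hφC⟩ := hC ε hε0
  obtain ⟨H, hH⟩ : ∃ H : ℂ → ℝ, H = fun z => Real.log (φ z + ε) := ⟨_, rfl⟩
  rw [← hH] at hφ hφC
  have hdH : ∀ x, ContinuousOn (fun y => fderiv ℝ H y x) Q := fun x =>
    ((hφ.continuousOn_fderiv_of_isOpen Metric.isOpen_ball le_rfl).clm_apply
      continuousOn_const).mono hQO
  have hsq : ContinuousOn (fun z => fderiv ℝ H z 1 ^ 2 + fderiv ℝ H z Complex.I ^ 2) Q :=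
    ((hdH 1).pow 2).add ((hdH Complex.I).pow 2)
  have hInt : ∫ z in Q, (1 + (fderiv ℝ H z 1 ^ 2 + fderiv ℝ H z Complex.I ^ 2)) ≤
      volume.real Q + C := by
    have hone : IntegrableOn (fun _ : ℂ => (1 : ℝ)) Q := integrableOn_const hQc.measure_lt_top.ne
    rw [integral_add hone (hsq.integrableOn_compact hQc), setIntegral_const, smul_eq_mul, mul_one]
    linarith
  have habs : ∀ x y : ℝ, |x| ≤ 1 + (x ^ 2 + y ^ 2) := fun x y =>
    abs_le.2 ⟨by nlinarith [sq_nonneg (x + 1), sq_nonneg y],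
      by nlinarith [sq_nonneg (x - 1), sq_nonneg y]⟩
  subst hQ
  obtain ⟨a₁, ha₁, a₂, ha₂, b₁, hb₁, b₂, hb₂, hosc, -⟩ := exists_frame hβ (by linarith)
    (G := fun z => 1 + (fderiv ℝ H z 1 ^ 2 + fderiv ℝ H z Complex.I ^ 2)) Metric.isOpen_ball hQO hφ (continuousOn_const.add hsq)
    (fun z _ => habs _ _) (fun z _ => (habs _ (fderiv ℝ H z 1)).trans_eq (by ring)) hInt
  have hsub : Icc a₁ a₂ ×ℂ Icc b₁ b₂ ⊆ Metric.ball 0 (4 * a) :=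
    fun z hz => hQO ⟨⟨ha₁.1.trans hz.1.1, hz.1.2.trans ha₂.2⟩,
      hb₁.1.trans hz.2.1, hz.2.2.trans hb₂.2⟩
  have hsubR := hsub.trans (Metric.ball_subset_closedBall.trans hDR)
  obtain ⟨z, hz, hzw⟩ : ∃ z ∈ (Icc a₁ a₂ ×ℂ Icc b₁ b₂) \ (Ioo a₁ a₂ ×ℂ Ioo b₁ b₂), w z ≤ 0 := by
    by_contra! hcon
    refine (ang_lt_of_frontier hp hu hv hne hne' (isCompact_Icc.reProdIm isCompact_Icc) hsubR
      (isOpen_Ioo.reProdIm isOpen_Ioo)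
      (fun z hz => ⟨Ioo_subset_Icc_self hz.1, Ioo_subset_Icc_self hz.2⟩) hc
      (fun z hz => hcu z (hsubR hz)) (fun z hz => hcv z (hsubR hz)) (fun z hz => ?_)
      ⟨⟨?_, ?_⟩, ?_, ?_⟩).ne' h0
    · have := hcon z hz
      rw [hw] at this
      exact sub_pos.1 this
    · exact ha₁.2.trans (by simp [hβ.le])
    · exact le_trans (by simp; linarith) ha₂.1
    · exact hb₁.2.trans (by simp [hβ.le])
    · exact le_trans (by simp [hβ.le]) hb₂.1
  have hy : (a₂ : ℂ) ∈ (Icc a₁ a₂ ×ℂ Icc b₁ b₂) \ (Ioo a₁ a₂ ×ℂ Ioo b₁ b₂) := by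
    refine ⟨⟨⟨?_, ?_⟩, ?_, ?_⟩, fun h => ?_⟩
    · have := ha₁.2
      have := ha₂.1
      simp only [Complex.ofReal_re]
      linarith
    · simp
    · exact hb₁.2.trans (by simp [hβ.le])
    · exact le_trans (by simp [hβ.le]) hb₂.1
    · have := h.1.2
      simp at this
  have hyw : w a / 2 < w a₂ := (hball (show (a₂ : ℂ) ∈ Metric.ball (a : ℂ) r by
    rw [Metric.mem_ball, dist_eq_norm, ← Complex.ofReal_sub, Complex.norm_real, Real.norm_eq_abs,
      abs_lt]
    constructor <;> linarith [ha₂.1, ha₂.2])).2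
  have e := (abs_le.1 (hosc _ hy _ hz)).2
  have h1 := abs_le.1 (hφw _ (hsub hz.1))
  have h2 := abs_le.1 (hφw _ (hsub hy.1))
  have h3 : 0 ≤ w z := by
    rw [hw]
    exact sub_nonneg.2 (hle z (hsubR hz.1))
  have h1' : ang c (cgrad v) z - ang c (cgrad u) z = w z := by rw [hw]
  have h2' : ang c (cgrad v) a₂ - ang c (cgrad u) a₂ = w a₂ := by rw [hw]
  rw [h1'] at h1
  rw [h2'] at h2
  have h4 : H z ≤ Real.log (2 * ε) := by
    rw [hH]
    exact Real.log_le_log (by linarith) (by linarith)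
  have h5 : Real.log (w a / 2) ≤ H a₂ := by
    rw [hH]
    exact Real.log_le_log (by linarith) (by linarith)
  have h6 : 2 * ε = w a / 2 * Real.exp (-N) := by rw [hε]; ring
  rw [h6, Real.log_mul (by positivity) (Real.exp_pos _).ne', Real.log_exp] at h4
  linarith

theorem ang_eq_of_norm_lt {p : ℝ} (hp : 1 < p) {R : ℝ} {u v : ℂ → ℝ}
    (hu : PH p (Metric.ball 0 R) u) (hv : PH p (Metric.ball 0 R) v)
    (hne : ∀ z ∈ Metric.ball (0 : ℂ) R, cgrad u z ≠ 0)
    (hne' : ∀ z ∈ Metric.ball (0 : ℂ) R, cgrad v z ≠ 0) {c : ℂ} (hc : c * cgrad u 0 = 1)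
    (hcu : ∀ z ∈ Metric.ball (0 : ℂ) R, c * cgrad u z ∈ Complex.slitPlane)
    (hcv : ∀ z ∈ Metric.ball (0 : ℂ) R, c * cgrad v z ∈ Complex.slitPlane)
    (hle : ∀ z ∈ Metric.ball (0 : ℂ) R, ang c (cgrad u) z ≤ ang c (cgrad v) z)
    (h0 : ang c (cgrad v) 0 = 0) {x : ℂ} (hx : 6 * ‖x‖ < R) :
    ang c (cgrad u) x = ang c (cgrad v) x := by
  have hxR : x ∈ Metric.ball (0 : ℂ) R := by
    rw [mem_ball_zero_iff]
    linarith [norm_nonneg x]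
  rcases eq_or_ne x 0 with rfl | hx0
  · rw [h0, ang, hc, Complex.arg_one]
  refine le_antisymm (hle x hxR) ?_
  obtain ⟨a, ha⟩ : ∃ a : Circle, (a : ℂ) * (‖x‖ : ℝ) = x := by
    refine ⟨Circle.exp x.arg, ?_⟩
    rw [Circle.coe_exp, mul_comm]
    exact Complex.norm_mul_exp_arg_mul_I x
  have hmap : ∀ z ∈ Metric.ball (0 : ℂ) R, rigid a 0 z ∈ Metric.ball (0 : ℂ) R := fun z hz => by
    rwa [← mem_preimage, rigid_preimage_ball]
  have hut := hu.comp_rigid a 0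
  have hvt := hv.comp_rigid a 0
  rw [rigid_preimage_ball] at hut hvt
  have hzero : rigid a 0 0 = 0 := by simp [rigid_apply]
  have hpt : rigid a 0 (‖x‖ : ℝ) = x := by rw [rigid_apply, add_zero, ha]
  have key : ∀ {k : ℂ → ℝ}, Differentiable ℝ k → ∀ z,
      c * a * cgrad (fun z => k (rigid a 0 z)) z = c * cgrad k (rigid a 0 z) := fun hk z => by
    rw [cgrad_comp_rigid hk, mul_assoc, ← mul_assoc (a : ℂ), ← Circle.coe_mul, mul_inv_cancel,
      Circle.coe_one, one_mul]
  have keyang : ∀ {k : ℂ → ℝ}, Differentiable ℝ k → ∀ z,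
      ang (c * a) (cgrad (fun z => k (rigid a 0 z))) z = ang c (cgrad k) (rigid a 0 z) :=
    fun hk z => by rw [ang, ang, key hk]
  have hdu := hu.differentiable
  have hdv := hv.differentiable
  have h := ang_le_zero_of_real hp hut hvt (fun z hz => by
      rw [cgrad_comp_rigid hdu]
      exact mul_ne_zero (Circle.coe_ne_zero _) (hne _ (hmap z hz)))
    (fun z hz => by
      rw [cgrad_comp_rigid hdv]
      exact mul_ne_zero (Circle.coe_ne_zero _) (hne' _ (hmap z hz)))
    (c := c * a) (by rw [key hdu, hzero, hc]) (fun z hz => by rw [key hdu]; exact hcu _ (hmap z hz))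
    (fun z hz => by rw [key hdv]; exact hcv _ (hmap z hz))
    (fun z hz => by rw [keyang hdu, keyang hdv]; exact hle _ (hmap z hz))
    (by rw [keyang hdv, hzero, h0]) (norm_pos_iff.2 hx0) hx
  rwa [keyang hdu, keyang hdv, hpt] at h

theorem im_conj_mul_eq_sin (a b : ℂ) :
    (conj a * b).im = ‖a‖ * ‖b‖ * Real.sin (Complex.arg b - Complex.arg a) := by
  rw [Real.sin_sub]
  have h1 := Complex.norm_mul_cos_arg a
  have h2 := Complex.norm_mul_sin_arg a
  have h3 := Complex.norm_mul_cos_arg b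
  have h4 := Complex.norm_mul_sin_arg b
  simp only [Complex.mul_im, Complex.conj_re, Complex.conj_im]
  rw [← h1, ← h2, ← h3, ← h4]
  ring

theorem im_conj_mul_smul (c a b : ℂ) :
    (conj (c * a) * (c * b)).im = ‖c‖ ^ 2 * (conj a * b).im := by
  rw [map_mul, mul_mul_mul_comm, ← Complex.normSq_eq_conj_mul_self, Complex.im_ofReal_mul,
    Complex.normSq_eq_norm_sq]

theorem exists_im_conj_mul_eq_zero_of_pos {p : ℝ} (hp : 1 < p) {R : ℝ} (hR : 0 < R) {u v : ℂ → ℝ}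
    (hu : PH p (Metric.ball 0 R) u) (hv : PH p (Metric.ball 0 R) v)
    (hne : ∀ z ∈ Metric.ball (0 : ℂ) R, cgrad u z ≠ 0)
    (hne' : ∀ z ∈ Metric.ball (0 : ℂ) R, cgrad v z ≠ 0)
    (hJ : ∀ z ∈ Metric.ball (0 : ℂ) R, 0 ≤ (conj (cgrad u z) * cgrad v z).im)
    (hJ0 : (conj (cgrad u 0) * cgrad v 0).im = 0) (hpos : 0 < (conj (cgrad u 0) * cgrad v 0).re) :
    ∃ r > 0, ∀ z ∈ Metric.ball (0 : ℂ) r, (conj (cgrad u z) * cgrad v z).im = 0 := by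
  have hu0 := hne 0 (Metric.mem_ball_self hR)
  obtain ⟨c, hc⟩ : ∃ c, c = (cgrad u 0)⁻¹ := ⟨_, rfl⟩
  have hcu0 : c * cgrad u 0 = 1 := by rw [hc, inv_mul_cancel₀ hu0]
  have hc0 : c ≠ 0 := by rw [hc]; exact inv_ne_zero hu0
  have hcv0 : 0 < (c * cgrad v 0).re ∧ (c * cgrad v 0).im = 0 := by
    have h : c * cgrad v 0 = (((Complex.normSq (cgrad u 0))⁻¹ : ℝ) : ℂ) *
        (conj (cgrad u 0) * cgrad v 0) := by
      rw [hc, Complex.inv_def]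
      ring
    have h' : 0 < (Complex.normSq (cgrad u 0))⁻¹ := inv_pos.2 (Complex.normSq_pos.2 hu0)
    rw [h, Complex.re_ofReal_mul, Complex.im_ofReal_mul, hJ0, mul_zero]
    exact ⟨by positivity, rfl⟩
  have hcont : ∀ {k : ℂ → ℝ}, PH p (Metric.ball 0 R) k →
      Continuous fun z => (c * cgrad k z).re := fun hk =>
    Complex.continuous_re.comp (continuous_const.mul hk.continuous_cgrad)
  obtain ⟨R', hR', hball⟩ := Metric.isOpen_iff.1 ((Metric.isOpen_ball (x := (0 : ℂ)) (ε := R)).inter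
    ((isOpen_lt continuous_const (hcont hu)).inter (isOpen_lt continuous_const (hcont hv)))) 0
    (show (0 : ℂ) ∈ Metric.ball (0 : ℂ) R ∩ ({z | (0 : ℝ) < (c * cgrad u z).re} ∩
      {z | (0 : ℝ) < (c * cgrad v z).re}) from
      ⟨Metric.mem_ball_self hR, show 0 < (c * cgrad u 0).re by rw [hcu0]; simp, hcv0.1⟩)
  have hsub : Metric.ball (0 : ℂ) R' ⊆ Metric.ball 0 R := fun z hz => (hball hz).1
  have hpu : ∀ z ∈ Metric.ball (0 : ℂ) R', 0 < (c * cgrad u z).re := fun z hz => (hball hz).2.1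
  have hpv : ∀ z ∈ Metric.ball (0 : ℂ) R', 0 < (c * cgrad v z).re := fun z hz => (hball hz).2.2
  have hJc := fun z => im_conj_mul_smul c (cgrad u z) (cgrad v z)
  have hcn : 0 < ‖c‖ ^ 2 := by positivity
  refine ⟨R' / 6, by positivity, fun z hz => ?_⟩
  have hz' : 6 * ‖z‖ < R' := by
    rw [mem_ball_zero_iff] at hz
    linarith
  have h := ang_eq_of_norm_lt hp (hu.mono hsub) (hv.mono hsub) (fun z hz => hne z (hsub hz))
    (fun z hz => hne' z (hsub hz)) hcu0 (fun z hz => Or.inl (hpu z hz))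
    (fun z hz => Or.inl (hpv z hz)) (fun z hz => by
      by_contra! hlt
      have h1 := hJc z
      rw [im_conj_mul_eq_sin] at h1
      have h2 := mul_nonneg hcn.le (hJ z (hsub hz))
      have h3 : Real.sin (ang c (cgrad v) z - ang c (cgrad u) z) < 0 := by
        have h4 := Complex.abs_arg_lt_pi_div_two_iff.2 (Or.inl (hpu z hz))
        have h5 := Complex.abs_arg_lt_pi_div_two_iff.2 (Or.inl (hpv z hz))
        refine Real.sin_neg_of_neg_of_neg_pi_lt (by linarith) ?_
        have := (abs_lt.1 h4).2
        have := (abs_lt.1 h5).1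
        rw [ang, ang]
        linarith
      have h6 : 0 < ‖c * cgrad u z‖ * ‖c * cgrad v z‖ :=
        mul_pos (norm_pos_iff.2 (mul_ne_zero hc0 (hne z (hsub hz))))
          (norm_pos_iff.2 (mul_ne_zero hc0 (hne' z (hsub hz))))
      have h7 := mul_neg_of_pos_of_neg h6 h3
      rw [ang, ang] at h7
      linarith)
    (by rw [ang]; exact Complex.arg_eq_zero_iff.2 ⟨hcv0.1.le, hcv0.2⟩) hz'
  have h1 := hJc z
  rw [im_conj_mul_eq_sin] at h1
  rw [ang, ang] at h
  rw [h, sub_self, Real.sin_zero, mul_zero] at h1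
  exact (mul_eq_zero.1 h1.symm).resolve_left (ne_of_gt hcn)

/-- If the Jacobian of a pair of functions without critical points is nonnegative and vanishes at
a point, then it vanishes nearby. -/
theorem exists_im_conj_mul_eq_zero {p : ℝ} (hp : 1 < p) {R : ℝ} (hR : 0 < R) {u v : ℂ → ℝ}
    (hu : PH p (Metric.ball 0 R) u) (hv : PH p (Metric.ball 0 R) v)
    (hne : ∀ z ∈ Metric.ball (0 : ℂ) R, cgrad u z ≠ 0)
    (hne' : ∀ z ∈ Metric.ball (0 : ℂ) R, cgrad v z ≠ 0)
    (hJ : ∀ z ∈ Metric.ball (0 : ℂ) R, 0 ≤ (conj (cgrad u z) * cgrad v z).im)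
    (hJ0 : (conj (cgrad u 0) * cgrad v 0).im = 0) :
    ∃ r > 0, ∀ z ∈ Metric.ball (0 : ℂ) r, (conj (cgrad u z) * cgrad v z).im = 0 := by
  have h0 : (conj (cgrad u 0) * cgrad v 0).re ≠ 0 := fun h =>
    mul_ne_zero ((map_ne_zero _).2 (hne 0 (Metric.mem_ball_self hR)))
      (hne' 0 (Metric.mem_ball_self hR)) (Complex.ext h hJ0)
  rcases h0.lt_or_gt with h | h
  · have hneg : ∀ z, cgrad (fun z => -u z) z = -cgrad u z := fun z => by
      simp [cgrad, fderiv_fun_neg, Complex.ext_iff]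
    have him : ∀ z, (conj (cgrad v z) * cgrad (fun z => -u z) z).im =
        (conj (cgrad u z) * cgrad v z).im := fun z => by
      rw [hneg]
      simp only [Complex.mul_im, Complex.conj_re, Complex.conj_im, Complex.neg_re, Complex.neg_im]
      ring
    obtain ⟨r, hr, hz⟩ := exists_im_conj_mul_eq_zero_of_pos hp hR hv hu.neg hne'
      (fun z hz => by rw [hneg]; exact neg_ne_zero.2 (hne z hz))
      (fun z hz => by rw [him]; exact hJ z hz) (by rw [him, hJ0]) (by
        rw [hneg]
        simp only [Complex.mul_re, Complex.conj_re, Complex.conj_im, Complex.neg_re,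
          Complex.neg_im] at h ⊢
        linarith)
    exact ⟨r, hr, fun z h => by rw [← him]; exact hz z h⟩
  · exact exists_im_conj_mul_eq_zero_of_pos hp hR hu hv hne hne' hJ hJ0 h

/-! ### Transfer to the complex plane -/

/-- The isometry from `ℂ` onto the Euclidean plane sending the origin to `x₀`. -/
noncomputable def chart (x₀ : EuclideanSpace ℝ (Fin 2)) : ℂ ≃ₜ EuclideanSpace ℝ (Fin 2) :=
  Complex.orthonormalBasisOneI.repr.toHomeomorph.trans (Homeomorph.addRight x₀)

theorem chart_apply (x₀ : EuclideanSpace ℝ (Fin 2)) (z : ℂ) :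
    chart x₀ z = Complex.orthonormalBasisOneI.repr z + x₀ := rfl

theorem chart_symm_apply (x₀ x : EuclideanSpace ℝ (Fin 2)) :
    (chart x₀).symm x = Complex.orthonormalBasisOneI.repr.symm (x - x₀) := by
  rw [Homeomorph.symm_apply_eq, chart_apply, LinearIsometryEquiv.apply_symm_apply, sub_add_cancel]

theorem chart_zero (x₀ : EuclideanSpace ℝ (Fin 2)) : chart x₀ 0 = x₀ := by simp [chart_apply]

theorem contDiff_chart (x₀ : EuclideanSpace ℝ (Fin 2)) : ContDiff ℝ 1 (chart x₀) :=
  Complex.orthonormalBasisOneI.repr.contDiff.add contDiff_const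

theorem contDiff_chart_symm (x₀ : EuclideanSpace ℝ (Fin 2)) :
    ContDiff ℝ 1 (chart x₀).symm := by
  have h : ⇑(chart x₀).symm = fun x => Complex.orthonormalBasisOneI.repr.symm (x - x₀) :=
    funext (chart_symm_apply x₀)
  rw [h]
  exact Complex.orthonormalBasisOneI.repr.symm.contDiff.comp (contDiff_id.sub contDiff_const)

theorem measurePreserving_chart (x₀ : EuclideanSpace ℝ (Fin 2)) :
    MeasurePreserving (chart x₀) :=
  (measurePreserving_add_right volume x₀).comp
    Complex.orthonormalBasisOneI.repr.measurePreserving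

theorem fderiv_comp_chart {φ : EuclideanSpace ℝ (Fin 2) → ℝ} {x₀ : EuclideanSpace ℝ (Fin 2)}
    {z : ℂ} (hφ : DifferentiableAt ℝ φ (chart x₀ z)) (w : ℂ) :
    fderiv ℝ (fun z => φ (chart x₀ z)) z w =
      fderiv ℝ φ (chart x₀ z) (Complex.orthonormalBasisOneI.repr w) := by
  have h : HasFDerivAt (chart x₀)
      (Complex.orthonormalBasisOneI.repr.toContinuousLinearEquiv :
        ℂ →L[ℝ] EuclideanSpace ℝ (Fin 2)) z :=
    (Complex.orthonormalBasisOneI.repr.toContinuousLinearEquiv.hasFDerivAt (x := z)).add_const x₀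
  have h2 := (hφ.hasFDerivAt.comp z h).fderiv
  have h3 := DFunLike.congr_fun h2 w
  exact h3

theorem gradient_chart {φ : EuclideanSpace ℝ (Fin 2) → ℝ} {x₀ : EuclideanSpace ℝ (Fin 2)}
    {z : ℂ} (hφ : DifferentiableAt ℝ φ (chart x₀ z)) :
    gradient φ (chart x₀ z) =
      Complex.orthonormalBasisOneI.repr (cgrad (fun z => φ (chart x₀ z)) z) := by
  refine ext_inner_right ℝ fun w => ?_
  obtain ⟨a, rfl⟩ := Complex.orthonormalBasisOneI.repr.surjective w
  rw [LinearIsometryEquiv.inner_map_map, ← fderiv_eq_inner_cgrad, fderiv_comp_chart hφ,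
    gradient, InnerProductSpace.toDual_symm_apply]

theorem ph_mul_comp_chart {p : ℝ} {Ω : Set (EuclideanSpace ℝ (Fin 2))} (hΩ : IsOpen Ω)
    {φ : EuclideanSpace ℝ (Fin 2) → ℝ} (hφ : PHarmonicOn p Ω φ) {x₀ : EuclideanSpace ℝ (Fin 2)}
    {χ : ℂ → ℝ} (hχ : ContDiff ℝ 1 χ) (hχc : HasCompactSupport χ)
    (hχs : tsupport χ ⊆ chart x₀ ⁻¹' Ω) {V : Set ℂ} (hV : IsOpen V) (hχ1 : ∀ z ∈ V, χ z = 1) :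
    PH p V fun z => χ z * φ (chart x₀ z) := by
  have hVΩ : ∀ z ∈ V, chart x₀ z ∈ Ω := fun z hz =>
    hχs (subset_tsupport _ (by simp [hχ1 z hz]))
  refine ⟨?_, hχc.mul_right, fun ψ h1 h2 h3 => ?_⟩
  · exact contDiff_mul_of_tsupport_subset (n := 1) (hΩ.preimage (chart x₀).continuous) hχ hχs
      (hφ.1.comp (contDiff_chart x₀).contDiffOn fun z hz => hz)
  · have hcont : ContDiff ℝ 1 fun x => ψ ((chart x₀).symm x) := h1.comp (contDiff_chart_symm x₀)
    have hts : tsupport (fun x => ψ ((chart x₀).symm x)) = (chart x₀).symm ⁻¹' tsupport ψ :=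
      tsupport_comp_homeomorph (chart x₀).symm ψ
    have hsub : tsupport (fun x => ψ ((chart x₀).symm x)) ⊆ Ω := by
      rw [hts]
      intro x hx
      simpa using hVΩ _ (h3 hx)
    have hw := hφ.2 _ hcont (h2.comp_homeomorph (chart x₀).symm) hsub
    have hψ : (fun z => ψ ((chart x₀).symm (chart x₀ z))) = ψ := by simp
    have hgz : ∀ z, gradient (fun x => ψ ((chart x₀).symm x)) (chart x₀ z) =
        Complex.orthonormalBasisOneI.repr (cgrad ψ z) := fun z => by
      rw [gradient_chart (hcont.differentiable (by norm_num) _), hψ]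
    rw [setIntegral_eq_integral_of_forall_compl_eq_zero, ← (measurePreserving_chart
      x₀).integral_comp (chart x₀).measurableEmbedding] at hw
    · rw [← hw]
      congr 1
      funext z
      rw [hgz]
      by_cases hz : z ∈ tsupport ψ
      · have hzV := h3 hz
        have he : (fun z => χ z * φ (chart x₀ z)) =ᶠ[𝓝 z] fun z => φ (chart x₀ z) := by
          filter_upwards [hV.mem_nhds hzV] with y hy
          rw [hχ1 y hy, one_mul]
        rw [gradient_chart ((hφ.1.differentiableOn (by norm_num)).differentiableAt
          (hΩ.mem_nhds (hVΩ z hzV))), LinearIsometryEquiv.inner_map_map,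
          LinearIsometryEquiv.norm_map, cgrad_eq_of_eventuallyEq he, flux, real_inner_smul_left]
      · rw [cgrad_eq_zero_of_notMem_tsupport hz]
        simp
    · intro x hx
      obtain ⟨z, rfl⟩ := (chart x₀).surjective x
      rw [hgz, cgrad_eq_zero_of_notMem_tsupport fun h => hx (hVΩ z (h3 h))]
      simp

theorem det_fderiv_chart {H : EuclideanSpace ℝ (Fin 2) → EuclideanSpace ℝ (Fin 2)}
    {x₀ : EuclideanSpace ℝ (Fin 2)} {z : ℂ} (hH : DifferentiableAt ℝ H (chart x₀ z)) :
    (fderiv ℝ H (chart x₀ z)).det =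
      (conj (cgrad (fun z => H (chart x₀ z) 0) z) * cgrad (fun z => H (chart x₀ z) 1) z).im := by
  have hd : ∀ i : Fin 2, HasFDerivAt (fun x => H x i)
      ((EuclideanSpace.proj i : EuclideanSpace ℝ (Fin 2) →L[ℝ] ℝ).comp
        (fderiv ℝ H (chart x₀ z))) (chart x₀ z) := fun i =>
    (EuclideanSpace.proj i : EuclideanSpace ℝ (Fin 2) →L[ℝ] ℝ).hasFDerivAt.comp _ hH.hasFDerivAt
  have hc : ∀ (i : Fin 2) (w : ℂ), fderiv ℝ (fun z => H (chart x₀ z) i) z w =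
      fderiv ℝ H (chart x₀ z) (Complex.orthonormalBasisOneI.repr w) i := fun i w => by
    rw [fderiv_comp_chart (φ := fun x => H x i) (hd i).differentiableAt, (hd i).fderiv]
    rfl
  have h1 : Complex.orthonormalBasisOneI.repr 1 = EuclideanSpace.single 0 1 := by
    rw [← Complex.orthonormalBasisOneI.repr_self]; simp
  have hI : Complex.orthonormalBasisOneI.repr Complex.I = EuclideanSpace.single 1 1 := by
    rw [← Complex.orthonormalBasisOneI.repr_self]; simp
  rw [ContinuousLinearMap.det, ← LinearMap.det_toMatrix (EuclideanSpace.basisFun (Fin 2) ℝ).toBasis,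
    Matrix.det_fin_two]
  simp only [LinearMap.toMatrix_apply, cgrad, hc, h1, hI]
  simp
  ring

/-- Nonnegativity of the Jacobian passes to uniform limits of `p`-harmonic pairs. -/
theorem im_conj_mul_nonneg_of_tendstoUniformlyOn {p : ℝ} (hp : 1 < p) {V : Set ℂ} (hV : IsOpen V)
    {u v : ℂ → ℝ} (hu : PH p V u) (hv : PH p V v) {u' v' : ℕ → ℂ → ℝ} (hu' : ∀ n, PH p V (u' n))
    (hv' : ∀ n, PH p V (v' n)) (hlim : TendstoUniformlyOn u' u atTop V)
    (hlim' : TendstoUniformlyOn v' v atTop V)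
    (hJ : ∀ n, ∀ z ∈ V, 0 ≤ (conj (cgrad (u' n) z) * cgrad (v' n) z).im) {z₀ : ℂ}
    (hz₀ : z₀ ∈ V) : 0 ≤ (conj (cgrad u z₀) * cgrad v z₀).im := by
  by_contra! hneg
  have hcJ : Continuous fun x : ℂ × ℂ => (conj x.1 * x.2).im := by fun_prop
  obtain ⟨ε, hε, hball⟩ := Metric.isOpen_iff.1 (isOpen_lt hcJ continuous_const)
    (cgrad u z₀, cgrad v z₀) hneg
  have hnear : ∀ᶠ z in 𝓝 z₀, z ∈ V ∧ dist (cgrad u z) (cgrad u z₀) < ε / 2 ∧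
      dist (cgrad v z) (cgrad v z₀) < ε / 2 :=
    (hV.eventually_mem hz₀).and
      ((hu.continuous_cgrad.continuousAt.eventually (Metric.ball_mem_nhds _ (half_pos hε))).and
        (hv.continuous_cgrad.continuousAt.eventually (Metric.ball_mem_nhds _ (half_pos hε))))
  obtain ⟨r, hr, hKr⟩ := Metric.nhds_basis_closedBall.eventually_iff.1 hnear
  have hK : IsCompact (Metric.closedBall z₀ r) := isCompact_closedBall _ _
  have hKV : Metric.closedBall z₀ r ⊆ V := fun z hz => (hKr hz).1
  have hlow : ∀ n, ∀ z ∈ Metric.closedBall z₀ r,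
      ε / 2 ≤ ‖cgrad (u' n) z - cgrad u z‖ + ‖cgrad (v' n) z - cgrad v z‖ := fun n z hz => by
    by_contra! hlt
    obtain ⟨h0, h1, h2⟩ := hKr hz
    have a1 := norm_nonneg (cgrad (u' n) z - cgrad u z)
    have a2 := norm_nonneg (cgrad (v' n) z - cgrad v z)
    have hmem : (cgrad (u' n) z, cgrad (v' n) z) ∈ Metric.ball (cgrad u z₀, cgrad v z₀) ε := by
      rw [Metric.mem_ball, Prod.dist_eq, max_lt_iff]
      have b1 := dist_triangle (cgrad (u' n) z) (cgrad u z) (cgrad u z₀)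
      have b2 := dist_triangle (cgrad (v' n) z) (cgrad v z) (cgrad v z₀)
      rw [dist_eq_norm (cgrad (u' n) z) (cgrad u z)] at b1
      rw [dist_eq_norm (cgrad (v' n) z) (cgrad v z)] at b2
      constructor <;> dsimp only <;> linarith
    exact absurd (hball hmem) (not_lt.2 (hJ n z h0))
  have hInt : ∀ {f g : ℂ → ℝ}, PH p V f → PH p V g →
      IntegrableOn (fun z => ‖cgrad f z - cgrad g z‖) (Metric.closedBall z₀ r) := fun hf hg =>
    (hf.continuous_cgrad.sub hg.continuous_cgrad).norm.continuousOn.integrableOn_compact hK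
  have hle : ∀ n, volume.real (Metric.closedBall z₀ r) * (ε / 2) ≤
      (∫ z in Metric.closedBall z₀ r, ‖cgrad (u' n) z - cgrad u z‖) +
        ∫ z in Metric.closedBall z₀ r, ‖cgrad (v' n) z - cgrad v z‖ := fun n => by
    rw [← integral_add (hInt (hu' n) hu) (hInt (hv' n) hv), ← smul_eq_mul, ← setIntegral_const]
    have hc : IntegrableOn (fun _ : ℂ => ε / 2) (Metric.closedBall z₀ r) :=
      integrableOn_const hK.measure_lt_top.ne
    exact setIntegral_mono_on hc ((hInt (hu' n) hu).add (hInt (hv' n) hv))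
      hK.measurableSet (hlow n)
  have h0 := ge_of_tendsto' ((tendsto_integral_norm_cgrad_sub hp hV hu hu' hlim hK hKV).add
    (tendsto_integral_norm_cgrad_sub hp hV hv hv' hlim' hK hKV)) hle
  have hpos : 0 < volume.real (Metric.closedBall z₀ r) :=
    ENNReal.toReal_pos (Metric.measure_closedBall_pos volume z₀ hr).ne' hK.measure_lt_top.ne
  have := mul_pos hpos (half_pos hε)
  linarith

theorem exists_chart_cutoff {Ω : Set (EuclideanSpace ℝ (Fin 2))} (hΩ : IsOpen Ω)
    {x₀ : EuclideanSpace ℝ (Fin 2)} (hx₀ : x₀ ∈ Ω) :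
    ∃ R > 0, ∃ χ : ℂ → ℝ, ContDiff ℝ 1 χ ∧ HasCompactSupport χ ∧ tsupport χ ⊆ chart x₀ ⁻¹' Ω ∧
      ∀ z ∈ Metric.ball (0 : ℂ) R, χ z = 1 := by
  obtain ⟨χ, hχ, hχc, hχs, -, O, hO, h0O, hχ1⟩ := exists_bump (isCompact_singleton (x := (0 : ℂ)))
    (hΩ.preimage (chart x₀).continuous)
    (singleton_subset_iff.2 (by rwa [mem_preimage, chart_zero]))
  obtain ⟨R, hR, hRO⟩ := Metric.isOpen_iff.1 hO 0 (h0O rfl)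
  exact ⟨R, hR, χ, hχ.of_le (by simp), hχc, hχs, fun z hz => hχ1 z (hRO hz)⟩

/-- On a preconnected open set, a zero set which is both open and closed is trivial. -/
theorem forall_eq_zero_or_forall_ne {X Y : Type*} [TopologicalSpace X] [TopologicalSpace Y]
    [T1Space Y] [Zero Y] {Ω : Set X} (hΩ : IsOpen Ω) (hc : IsPreconnected Ω) {f : X → Y}
    (hf : ContinuousOn f Ω) (h : ∀ x ∈ Ω, f x = 0 → ∀ᶠ y in 𝓝 x, f y = 0) :
    (∀ x ∈ Ω, f x = 0) ∨ ∀ x ∈ Ω, f x ≠ 0 := by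
  rcases isPreconnected_iff_subset_of_disjoint.1 hc {x | ∀ᶠ y in 𝓝 x, f y = 0}
    (Ω ∩ f ⁻¹' {0}ᶜ) isOpen_setOfPred_eventually_nhds
    (hf.isOpen_inter_preimage hΩ isOpen_compl_singleton)
    (fun x hx => (em (f x = 0)).imp (h x hx) fun h' => ⟨hx, h'⟩)
    (eq_empty_of_forall_notMem fun x hx => hx.2.2.2 hx.2.1.self_of_nhds) with h' | h'
  · exact Or.inl fun x hx => (h' hx).self_of_nhds
  · exact Or.inr fun x hx => (h' hx).2

theorem tendstoUniformlyOn_mul_comp_chart {Ω : Set (EuclideanSpace ℝ (Fin 2))}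
    {F : ℕ → EuclideanSpace ℝ (Fin 2) → EuclideanSpace ℝ (Fin 2)}
    {G : EuclideanSpace ℝ (Fin 2) → EuclideanSpace ℝ (Fin 2)}
    (hconv : TendstoUniformlyOn F G atTop Ω) {x₀ : EuclideanSpace ℝ (Fin 2)} {χ : ℂ → ℝ}
    {V : Set ℂ} (hχ1 : ∀ z ∈ V, χ z = 1) (hV : ∀ z ∈ V, chart x₀ z ∈ Ω) (i : Fin 2) :
    TendstoUniformlyOn (fun n z => χ z * F n (chart x₀ z) i) (fun z => χ z * G (chart x₀ z) i)
      atTop V := by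
  rw [Metric.tendstoUniformlyOn_iff] at hconv ⊢
  intro ε hε
  filter_upwards [hconv ε hε] with n hn z hz
  rw [hχ1 z hz, one_mul, one_mul]
  refine lt_of_le_of_lt ?_ (hn _ (hV z hz))
  rw [dist_eq_norm, dist_eq_norm]
  exact PiLp.norm_apply_le (G (chart x₀ z) - F n (chart x₀ z)) i

theorem eventually_nhds_of_chart {x₀ : EuclideanSpace ℝ (Fin 2)}
    {P : EuclideanSpace ℝ (Fin 2) → Prop} {r : ℝ} (hr : 0 < r)
    (h : ∀ z ∈ Metric.ball (0 : ℂ) r, P (chart x₀ z)) : ∀ᶠ x in 𝓝 x₀, P x := by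
  have h' : ∀ᶠ z in 𝓝 (0 : ℂ), P (chart x₀ z) := by
    filter_upwards [Metric.ball_mem_nhds 0 hr] with z hz using h z hz
  rwa [← eventually_map (m := chart x₀), (chart x₀).map_nhds_eq, chart_zero] at h'

end PHarmonic

open PHarmonic ComplexConjugate in
/-- A `p`-harmonic variant of Hurwitz's theorem: if injective coordinate-wise
`p`-harmonic maps with everywhere positive Jacobian converge uniformly on a
connected open set `Ω` to a coordinate-wise `p`-harmonic map `F`, then either the
Jacobian of `F` is everywhere positive on `Ω` or it vanishes identically on `Ω`. -/
theorem pharmonic_hurwitz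
    (p : ℝ) (hp : 1 < p)
    (Ω : Set (EuclideanSpace ℝ (Fin 2))) (hΩne : Ω.Nonempty)
    (hΩo : IsOpen Ω) (hΩconn : IsConnected Ω)
    (F : ℕ → EuclideanSpace ℝ (Fin 2) → EuclideanSpace ℝ (Fin 2))
    (hFp : ∀ n, ∀ i : Fin 2, PHarmonicOn p Ω (fun x => F n x i))
    (hFinj : ∀ n, InjOn (F n) Ω)
    (hFdet : ∀ n, ∀ x ∈ Ω, 0 < (fderiv ℝ (F n) x).det)
    (G : EuclideanSpace ℝ (Fin 2) → EuclideanSpace ℝ (Fin 2))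
    (hGp : ∀ i : Fin 2, PHarmonicOn p Ω (fun x => G x i))
    (hconv : TendstoUniformlyOn (fun n x => F n x) G atTop Ω) :
    (∀ x ∈ Ω, 0 < (fderiv ℝ G x).det) ∨ (∀ x ∈ Ω, (fderiv ℝ G x).det = 0) := by
  have hcd : ∀ {H : EuclideanSpace ℝ (Fin 2) → EuclideanSpace ℝ (Fin 2)},
      (∀ i : Fin 2, PHarmonicOn p Ω (fun x => H x i)) → ContDiffOn ℝ 1 H Ω := fun hH =>
    (contDiffOn_euclidean).2 fun i => (hH i).1
  have hdiff : ∀ {H : EuclideanSpace ℝ (Fin 2) → EuclideanSpace ℝ (Fin 2)},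
      (∀ i : Fin 2, PHarmonicOn p Ω (fun x => H x i)) → ∀ x ∈ Ω, DifferentiableAt ℝ H x :=
    fun hH x hx => ((hcd hH).differentiableOn (by norm_num)).differentiableAt (hΩo.mem_nhds hx)
  have hdiffi : ∀ i : Fin 2, ∀ x ∈ Ω, DifferentiableAt ℝ (fun x => G x i) x := fun i x hx =>
    ((hGp i).1.differentiableOn (by norm_num)).differentiableAt (hΩo.mem_nhds hx)
  -- local description of the gradients and of the Jacobian near a point of `Ω`
  have key : ∀ x₀ ∈ Ω, ∃ R > 0, ∃ (u : Fin 2 → ℂ → ℝ) (w : ℕ → Fin 2 → ℂ → ℝ),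
      (∀ i, PH p (Metric.ball 0 R) (u i)) ∧ (∀ n i, PH p (Metric.ball 0 R) (w n i)) ∧
      (∀ i, TendstoUniformlyOn (fun n => w n i) (u i) atTop (Metric.ball 0 R)) ∧
      (∀ z ∈ Metric.ball (0 : ℂ) R, chart x₀ z ∈ Ω ∧
        (∀ i, gradient (fun x => G x i) (chart x₀ z) =
          Complex.orthonormalBasisOneI.repr (cgrad (u i) z)) ∧
        (fderiv ℝ G (chart x₀ z)).det = (conj (cgrad (u 0) z) * cgrad (u 1) z).im ∧
        ∀ n, 0 < (conj (cgrad (w n 0) z) * cgrad (w n 1) z).im) := by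
    intro x₀ hx₀
    obtain ⟨R, hR, χ, hχ, hχc, hχs, hχ1⟩ := exists_chart_cutoff hΩo hx₀
    have hVΩ : ∀ z ∈ Metric.ball (0 : ℂ) R, chart x₀ z ∈ Ω := fun z hz =>
      hχs (subset_tsupport _ (by simp [hχ1 z hz]))
    have hcg : ∀ (φ : EuclideanSpace ℝ (Fin 2) → ℝ), ∀ z ∈ Metric.ball (0 : ℂ) R,
        cgrad (fun z => φ (chart x₀ z)) z = cgrad (fun z => χ z * φ (chart x₀ z)) z :=
      fun φ z hz => cgrad_eq_of_eventuallyEq <| by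
        filter_upwards [Metric.isOpen_ball.mem_nhds hz] with y hy
        rw [hχ1 y hy, one_mul]
    refine ⟨R, hR, fun i z => χ z * G (chart x₀ z) i, fun n i z => χ z * F n (chart x₀ z) i,
      fun i => ph_mul_comp_chart hΩo (hGp i) hχ hχc hχs Metric.isOpen_ball hχ1,
      fun n i => ph_mul_comp_chart hΩo (hFp n i) hχ hχc hχs Metric.isOpen_ball hχ1,
      tendstoUniformlyOn_mul_comp_chart hconv hχ1 hVΩ,
      fun z hz => ⟨hVΩ z hz, fun i => ?_, ?_, fun n => ?_⟩⟩
    · rw [gradient_chart (hdiffi i _ (hVΩ z hz)), hcg (fun x => G x i) z hz]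
    · rw [det_fderiv_chart (hdiff hGp _ (hVΩ z hz)), hcg (fun x => G x 0) z hz,
        hcg (fun x => G x 1) z hz]
    · rw [← hcg (fun x => F n x 0) z hz, ← hcg (fun x => F n x 1) z hz,
        ← det_fderiv_chart (hdiff (hFp n) _ (hVΩ z hz))]
      exact hFdet n _ (hVΩ z hz)
  have hdet0 : ∀ i : Fin 2, ∀ x ∈ Ω, gradient (fun x => G x i) x = 0 →
      (fderiv ℝ G x).det = 0 := fun i x hx h => by
    obtain ⟨R, hR, u, w, -, -, -, h4⟩ := key x hx
    obtain ⟨-, h5, h6, -⟩ := h4 0 (Metric.mem_ball_self hR)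
    have h7 := h5 i
    rw [chart_zero, h, eq_comm, map_eq_zero_iff _ (LinearIsometryEquiv.injective _)] at h7
    rw [chart_zero] at h6
    rw [h6]
    obtain rfl | rfl : i = 0 ∨ i = 1 := by omega
    · rw [h7, map_zero, zero_mul, Complex.zero_im]
    · rw [h7, mul_zero, Complex.zero_im]
  have hgrad : ∀ i : Fin 2, (∀ x ∈ Ω, gradient (fun x => G x i) x = 0) ∨
      ∀ x ∈ Ω, gradient (fun x => G x i) x ≠ 0 := fun i => by
    refine forall_eq_zero_or_forall_ne hΩo hΩconn.isPreconnected ?_ fun x hx h0 => ?_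
    · exact (InnerProductSpace.toDual ℝ _).symm.continuous.comp_continuousOn
        ((hGp i).1.continuousOn_fderiv_of_isOpen hΩo le_rfl)
    · obtain ⟨R, hR, u, w, h1, h2, h3, h4⟩ := key x hx
      have hu0 := (h4 0 (Metric.mem_ball_self hR)).2.1 i
      rw [chart_zero, h0, eq_comm, map_eq_zero_iff _ (LinearIsometryEquiv.injective _)] at hu0
      refine eventually_nhds_of_chart (r := R / 6) (by positivity) fun z hz => ?_
      rw [mem_ball_zero_iff] at hz
      rw [(h4 z (mem_ball_zero_iff.2 (by linarith))).2.1 i,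
        cgrad_eq_zero_of_tendstoUniformlyOn hp (h1 i) (fun n => h2 n i) (h3 i) ?_ hu0
          (by linarith), map_zero]
      intro n y hy h
      refine ((h4 y hy).2.2.2 n).ne' ?_
      obtain rfl | rfl : i = 0 ∨ i = 1 := by omega
      · rw [h, map_zero, zero_mul, Complex.zero_im]
      · rw [h, mul_zero, Complex.zero_im]
  have hnonneg : ∀ x ∈ Ω, 0 ≤ (fderiv ℝ G x).det := fun x hx => by
    obtain ⟨R, hR, u, w, h1, h2, h3, h4⟩ := key x hx
    have h5 := (h4 0 (Metric.mem_ball_self hR)).2.2.1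
    rw [chart_zero] at h5
    rw [h5]
    exact im_conj_mul_nonneg_of_tendstoUniformlyOn hp Metric.isOpen_ball (h1 0) (h1 1)
      (fun n => h2 n 0) (fun n => h2 n 1) (h3 0) (h3 1)
      (fun n z hz => ((h4 z hz).2.2.2 n).le) (Metric.mem_ball_self hR)
  rcases hgrad 0 with h0 | h0
  · exact Or.inr fun x hx => hdet0 0 x hx (h0 x hx)
  rcases hgrad 1 with h1 | h1
  · exact Or.inr fun x hx => hdet0 1 x hx (h1 x hx)
  have hdet : (∀ x ∈ Ω, (fderiv ℝ G x).det = 0) ∨ ∀ x ∈ Ω, (fderiv ℝ G x).det ≠ 0 := by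
    refine forall_eq_zero_or_forall_ne hΩo hΩconn.isPreconnected ?_ fun x hx hx0 => ?_
    · exact ContinuousLinearMap.continuous_det.comp_continuousOn
        ((hcd hGp).continuousOn_fderiv_of_isOpen hΩo le_rfl)
    · obtain ⟨R, hR, u, w, g1, g2, g3, g4⟩ := key x hx
      have hne : ∀ i : Fin 2, (∀ x ∈ Ω, gradient (fun x => G x i) x ≠ 0) →
          ∀ z ∈ Metric.ball (0 : ℂ) R, cgrad (u i) z ≠ 0 := fun i hi z hz h => by
        refine hi _ (g4 z hz).1 ?_
        rw [(g4 z hz).2.1 i, h, map_zero]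
      obtain ⟨r, hr, hz⟩ := exists_im_conj_mul_eq_zero hp hR (g1 0) (g1 1) (hne 0 h0) (hne 1 h1)
        (fun z hz => by rw [← (g4 z hz).2.2.1]; exact hnonneg _ (g4 z hz).1)
        (by rw [← (g4 0 (Metric.mem_ball_self hR)).2.2.1, chart_zero, hx0])
      refine eventually_nhds_of_chart (r := min r R) (lt_min hr hR) fun z hz' => ?_
      rw [(g4 z (Metric.ball_subset_ball (min_le_right _ _) hz')).2.2.1]
      exact hz z (Metric.ball_subset_ball (min_le_left _ _) hz')
  exact hdet.symm.imp_left fun h x hx => (hnonneg x hx).lt_of_ne' (h x hx)
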